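/- arXiv:2603.21805 — 7 statements merged into one kernel-verified Lean document; each statement's English description precedes it below -/
import Mathlib

section
/- Let Ω ⊆ ℝ^d (d ≥ 1) be open and nonempty, and let a, q : ℝ^d → ℝ be measurable, nonnegative a.e. on Ω and locally integrable on Ω. Assume the ball condition: there exist x₀ ∈ ℝ^d, r₀ > 0 and a₀ > 0 such that the closed ball of center x₀ and radius r₀ is contained in Ω, ∫_{B(x₀,r₀)} a(x) dx > 0, and a(x) ≥ a₀ for a.e. x ∈ Ω ∖ B(x₀,r₀). Then there exist τ₀ ∈ (0,1] and C > 0 such that for every λ ∈ ℂ with Re λ ≥ 0 and 0 < |λ| ≤ τ₀, and every test function u on Ω, one has |‖∇u‖²_{L²} + ∫ q|u|² + λ ∫ a|u|² + λ² ∫ |u|²| ≥ C ( ‖∇u‖²_{L²} + ∫ q|u|² + |λ| ∫ a|u|² + |λ| ∫ |u|² ). -/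
open MeasureTheory Metric

lemma aux_alg (P A N K : ℝ) (l : ℂ) (hP : 0 ≤ P) (hA : 0 ≤ A) (hN : 0 ≤ N) (hK : 1 ≤ K)
    (hl : 0 ≤ l.re) (hl1 : ‖l‖ ≤ 1 / (4 * K)) (h : N ≤ K * (P + A)) :
    (1 / (8 * K)) * (P + ‖l‖ * A + ‖l‖ * N) ≤ ‖(P : ℂ) + l * A + l ^ 2 * N‖ := by
  have h1 : (P + ‖l‖ * A) / 2 ≤ ‖(P : ℂ) + l * A‖ := by
    refine (sq_le_sq₀ (by positivity) (norm_nonneg _)).1 ?_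
    rw [Complex.sq_norm, Complex.normSq_apply]
    have e : ‖l‖ ^ 2 = l.re * l.re + l.im * l.im := by
      rw [Complex.sq_norm, Complex.normSq_apply]
    simp
    have e2 : (‖l‖ * A) ^ 2 = (l.re * l.re + l.im * l.im) * A ^ 2 := by rw [mul_pow, e]
    have : 0 ≤ l.re * (P * A) := by positivity
    nlinarith [sq_nonneg (P - ‖l‖ * A), sq_nonneg (P + ‖l‖ * A)]
  have h2 : ‖(P : ℂ) + l * A‖ - ‖l‖ ^ 2 * N ≤ ‖(P : ℂ) + l * A + l ^ 2 * N‖ := by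
    have := norm_sub_le ((P : ℂ) + l * A + l ^ 2 * N) (l ^ 2 * N)
    rw [add_sub_cancel_right] at this
    have e : ‖l ^ 2 * (N : ℂ)‖ = ‖l‖ ^ 2 * N := by simp [abs_of_nonneg hN]
    linarith
  have hK0 : 0 < K := by linarith
  have hlK : ‖l‖ * K ≤ 1 / 4 := by
    rw [le_div_iff₀ (by positivity)] at hl1; linarith
  have hl0 := norm_nonneg l
  have hl1' : ‖l‖ ≤ 1 := by nlinarith
  have h3 : ‖l‖ * N ≤ K * (P + ‖l‖ * A) := by
    have := mul_le_mul_of_nonneg_left h hl0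
    have : ‖l‖ * (K * P) ≤ 1 * (K * P) := by gcongr
    linarith
  have h4 : ‖l‖ ^ 2 * N ≤ (P + ‖l‖ * A) / 4 := by
    have := mul_le_mul_of_nonneg_left h3 hl0
    have : (‖l‖ * K) * (P + ‖l‖ * A) ≤ 1 / 4 * (P + ‖l‖ * A) := by gcongr
    nlinarith
  have h5 : (1 / (8 * K)) * (P + ‖l‖ * A + ‖l‖ * N) ≤ (P + ‖l‖ * A) / 4 := by
    rw [one_div_mul_eq_div, div_le_iff₀ (by positivity)]
    have : 0 ≤ (K - 1) * (P + ‖l‖ * A) := mul_nonneg (by linarith) (by positivity)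
    nlinarith
  linarith

lemma aux_trans {d : ℕ} (u : EuclideanSpace ℝ (Fin d) → ℂ) (hu : ContDiff ℝ (⊤ : ℕ∞) u)
    (h : EuclideanSpace ℝ (Fin d)) :
    ∫⁻ x, ‖u (x + h) - u x‖ₑ ^ 2 ≤ ‖h‖ₑ ^ 2 * ∫⁻ x, ‖fderiv ℝ u x‖ₑ ^ 2 := by
  have hdu : Continuous (fderiv ℝ u) := hu.continuous_fderiv (by simp)
  have pw : ∀ x, ‖u (x + h) - u x‖ₑ ^ 2 ≤
      ∫⁻ t in Set.Ioc (0:ℝ) 1, ‖h‖ₑ ^ 2 * ‖fderiv ℝ u (x + t • h)‖ₑ ^ 2 := by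
    intro x
    have hc : Continuous fun t : ℝ => fderiv ℝ u (x + t • h) := by fun_prop
    have hd : ∀ t : ℝ, HasDerivAt (fun t : ℝ => u (x + t • h)) (fderiv ℝ u (x + t • h) h) t := by
      intro t
      have h1 : HasDerivAt (fun t : ℝ => x + t • h) h t := by
        simpa using ((hasDerivAt_id t).smul_const h).const_add x
      exact ((hu.differentiable (by simp)).differentiableAt.hasFDerivAt).comp_hasDerivAt t h1
    have e : u (x + h) - u x = ∫ t in (0:ℝ)..1, fderiv ℝ u (x + t • h) h := by
      rw [intervalIntegral.integral_eq_sub_of_hasDerivAt (fun t _ => hd t)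
        ((by fun_prop : Continuous fun t : ℝ => fderiv ℝ u (x + t • h) h).intervalIntegrable _ _)]
      simp
    rw [e, intervalIntegral.integral_of_le zero_le_one]
    have hm : AEMeasurable (fun t : ℝ => ‖fderiv ℝ u (x + t • h) h‖ₑ)
        (volume.restrict (Set.Ioc (0:ℝ) 1)) :=
      (by fun_prop : Continuous fun t : ℝ => ‖fderiv ℝ u (x + t • h) h‖ₑ).measurable.aemeasurable
    have hold := ENNReal.lintegral_mul_le_Lp_mul_Lq (volume.restrict (Set.Ioc (0:ℝ) 1))
      Real.HolderConjugate.two_two hm (aemeasurable_const (b := (1 : ENNReal)))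
    simp at hold
    calc ‖∫ t in Set.Ioc (0:ℝ) 1, fderiv ℝ u (x + t • h) h‖ₑ ^ 2
        ≤ (∫⁻ t in Set.Ioc (0:ℝ) 1, ‖fderiv ℝ u (x + t • h) h‖ₑ) ^ 2 := by
          gcongr; exact enorm_integral_le_lintegral_enorm _
      _ ≤ ∫⁻ t in Set.Ioc (0:ℝ) 1, ‖fderiv ℝ u (x + t • h) h‖ₑ ^ 2 := by
          refine (pow_le_pow_left' hold 2).trans (le_of_eq ?_)
          rw [← ENNReal.rpow_natCast, ← ENNReal.rpow_mul]
          simp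
      _ ≤ _ := by
          gcongr with t
          rw [← mul_pow, mul_comm]
          gcongr
          exact ContinuousLinearMap.le_opENorm _ _
  calc _ ≤ ∫⁻ x, ∫⁻ t in Set.Ioc (0:ℝ) 1, ‖h‖ₑ ^ 2 * ‖fderiv ℝ u (x + t • h)‖ₑ ^ 2 :=
        lintegral_mono pw
    _ = ∫⁻ t in Set.Ioc (0:ℝ) 1, ∫⁻ x, ‖h‖ₑ ^ 2 * ‖fderiv ℝ u (x + t • h)‖ₑ ^ 2 := by
        apply lintegral_lintegral_swap
        apply Measurable.aemeasurable
        apply Measurable.const_mul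
        exact (by fun_prop : Continuous fun p : EuclideanSpace ℝ (Fin d) × ℝ =>
          ‖fderiv ℝ u (p.1 + p.2 • h)‖ₑ ^ 2).measurable
    _ = ∫⁻ t in Set.Ioc (0:ℝ) 1, ‖h‖ₑ ^ 2 * ∫⁻ x, ‖fderiv ℝ u x‖ₑ ^ 2 := by
        congr 1; ext t
        rw [lintegral_const_mul]
        · rw [lintegral_add_right_eq_self (fun x => ‖fderiv ℝ u x‖ₑ ^ 2)]
        · exact (by fun_prop : Continuous fun x => ‖fderiv ℝ u (x + t • h)‖ₑ ^ 2).measurable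
    _ = _ := by simp

lemma aux_poinc {d : ℕ} (u : EuclideanSpace ℝ (Fin d) → ℂ) (hu : ContDiff ℝ (⊤ : ℕ∞) u)
    (x₀ : EuclideanSpace ℝ (Fin d)) (r : ℝ) (E : Set (EuclideanSpace ℝ (Fin d)))
    (hE : MeasurableSet E) (hEB : E ⊆ ball x₀ r) :
    volume E * ∫⁻ x in ball x₀ r, ‖u x‖ₑ ^ 2 ≤
      2 * (volume (ball x₀ r) * ∫⁻ x in E, ‖u x‖ₑ ^ 2) +
      2 * (volume (ball (0 : EuclideanSpace ℝ (Fin d)) (2 * r)) *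
        (ENNReal.ofReal (2 * r) ^ 2 * ∫⁻ x, ‖fderiv ℝ u x‖ₑ ^ 2)) := by
  have hc : Continuous u := hu.continuous
  have m1 : Measurable fun x => ‖u x‖ₑ ^ 2 := (by fun_prop : Continuous _).measurable
  have m2 : Measurable fun p : EuclideanSpace ℝ (Fin d) × EuclideanSpace ℝ (Fin d) =>
    ‖u p.2 - u p.1‖ₑ ^ 2 := (by fun_prop : Continuous _).measurable
  have m2x : ∀ x, Measurable fun y => ‖u y - u x‖ₑ ^ 2 :=
    fun x => (by fun_prop : Continuous _).measurable
  have pw : ∀ x y, ‖u x‖ₑ ^ 2 ≤ 2 * ‖u y‖ₑ ^ 2 + 2 * ‖u y - u x‖ₑ ^ 2 := by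
    intro x y
    have : ‖u x‖ ^ 2 ≤ 2 * ‖u y‖ ^ 2 + 2 * ‖u y - u x‖ ^ 2 := by
      have h1 : ‖u x‖ ≤ ‖u y‖ + ‖u y - u x‖ := by
        have := norm_sub_le (u y) (u y - u x); simpa using this
      have := pow_le_pow_left₀ (norm_nonneg _) h1 2
      nlinarith [sq_nonneg (‖u y‖ - ‖u y - u x‖)]
    have := ENNReal.ofReal_le_ofReal this
    rw [ENNReal.ofReal_add (by positivity) (by positivity), ENNReal.ofReal_mul (by norm_num),
      ENNReal.ofReal_mul (by norm_num)] at this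
    simpa [ENNReal.ofReal_pow, ofReal_norm] using this
  have cross : ∫⁻ x in ball x₀ r, ∫⁻ y in E, ‖u y - u x‖ₑ ^ 2 ≤
      volume (ball (0 : EuclideanSpace ℝ (Fin d)) (2 * r)) *
        (ENNReal.ofReal (2 * r) ^ 2 * ∫⁻ x, ‖fderiv ℝ u x‖ₑ ^ 2) := by
    calc _ ≤ ∫⁻ x in ball x₀ r, ∫⁻ h in ball (0 : EuclideanSpace ℝ (Fin d)) (2 * r),
          ‖u (x + h) - u x‖ₑ ^ 2 := by
          apply setLIntegral_mono' measurableSet_ball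
          intro x hx
          rw [← lintegral_indicator hE, ← lintegral_indicator measurableSet_ball,
            ← lintegral_add_left_eq_self _ x]
          apply lintegral_mono
          intro h
          by_cases hh : x + h ∈ E
          · have : h ∈ ball (0 : EuclideanSpace ℝ (Fin d)) (2 * r) := by
              have h1 := mem_ball.1 (hEB hh)
              have h2 := mem_ball'.1 hx
              have h3 := dist_triangle (x + h) x₀ x
              rw [dist_eq_norm, add_sub_cancel_left] at h3
              rw [mem_ball_zero_iff]
              linarith
            simp [hh, this]
          · simp [hh]
      _ ≤ ∫⁻ x, ∫⁻ h in ball (0 : EuclideanSpace ℝ (Fin d)) (2 * r),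
          ‖u (x + h) - u x‖ₑ ^ 2 := setLIntegral_le_lintegral _ _
      _ = ∫⁻ h in ball (0 : EuclideanSpace ℝ (Fin d)) (2 * r), ∫⁻ x,
          ‖u (x + h) - u x‖ₑ ^ 2 := by
          apply lintegral_lintegral_swap
          exact (by fun_prop : Continuous
            fun p : EuclideanSpace ℝ (Fin d) × EuclideanSpace ℝ (Fin d) =>
            ‖u (p.1 + p.2) - u p.1‖ₑ ^ 2).measurable.aemeasurable
      _ ≤ ∫⁻ h in ball (0 : EuclideanSpace ℝ (Fin d)) (2 * r),
          (ENNReal.ofReal (2 * r) ^ 2 * ∫⁻ x, ‖fderiv ℝ u x‖ₑ ^ 2) := by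
          apply setLIntegral_mono' measurableSet_ball
          intro h hh
          refine (aux_trans u hu h).trans ?_
          gcongr
          rw [← ofReal_norm]
          apply ENNReal.ofReal_le_ofReal
          simpa using (mem_ball.1 hh).le
      _ = _ := by simp [mul_comm]
  calc _ = ∫⁻ x in ball x₀ r, ∫⁻ y in E, ‖u x‖ₑ ^ 2 := by
        simp [lintegral_mul_const _ m1, mul_comm]
    _ ≤ ∫⁻ x in ball x₀ r, ∫⁻ y in E, (2 * ‖u y‖ₑ ^ 2 + 2 * ‖u y - u x‖ₑ ^ 2) := by
        gcongr with x y; exact pw x y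
    _ = ∫⁻ x in ball x₀ r, (2 * (∫⁻ y in E, ‖u y‖ₑ ^ 2) + 2 * ∫⁻ y in E, ‖u y - u x‖ₑ ^ 2) := by
        congr 1; ext x
        rw [lintegral_add_left (m1.const_mul 2), lintegral_const_mul _ m1,
          lintegral_const_mul _ (m2x x)]
    _ = 2 * (volume (ball x₀ r) * ∫⁻ x in E, ‖u x‖ₑ ^ 2) +
          2 * ∫⁻ x in ball x₀ r, ∫⁻ y in E, ‖u y - u x‖ₑ ^ 2 := by
        rw [lintegral_add_left measurable_const, lintegral_const_mul 2 (f := fun x => ∫⁻ y in E, ‖u y - u x‖ₑ ^ 2)]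
        · simp; ring
        · exact m2.lintegral_prod_right'
    _ ≤ _ := by gcongr

lemma aux_int {d : ℕ} {F : Type*} [NormedAddCommGroup F]
    (f : EuclideanSpace ℝ (Fin d) → F) (hf : Continuous f) (hs : HasCompactSupport f) :
    Integrable (fun x => ‖f x‖ ^ 2) := by
  apply Continuous.integrable_of_hasCompactSupport (by fun_prop)
  exact hs.comp_left (g := fun y => ‖y‖ ^ 2) (by simp)

lemma aux_conv {d : ℕ} {F : Type*} [NormedAddCommGroup F]
    (f : EuclideanSpace ℝ (Fin d) → F) (hf : Continuous f) (hs : HasCompactSupport f)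
    (S : Set (EuclideanSpace ℝ (Fin d))) :
    ∫⁻ x in S, ‖f x‖ₑ ^ 2 = ENNReal.ofReal (∫ x in S, ‖f x‖ ^ 2) := by
  rw [ofReal_integral_eq_lintegral_ofReal (aux_int f hf hs).integrableOn
    (Filter.Eventually.of_forall fun x => by positivity)]
  simp [ENNReal.ofReal_pow, ofReal_norm]

lemma aux_real {d : ℕ} (u : EuclideanSpace ℝ (Fin d) → ℂ) (hu : ContDiff ℝ (⊤ : ℕ∞) u)
    (hs : HasCompactSupport u)
    (x₀ : EuclideanSpace ℝ (Fin d)) (r : ℝ) (hr : 0 < r) (E : Set (EuclideanSpace ℝ (Fin d)))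
    (hE : MeasurableSet E) (hEB : E ⊆ ball x₀ r) :
    volume.real E * ∫ x in ball x₀ r, ‖u x‖ ^ 2 ≤
      2 * (volume.real (ball x₀ r) * ∫ x in E, ‖u x‖ ^ 2) +
      2 * (volume.real (ball (0 : EuclideanSpace ℝ (Fin d)) (2 * r)) *
        ((2 * r) ^ 2 * ∫ x, ‖fderiv ℝ u x‖ ^ 2)) := by
  have h := aux_poinc u hu x₀ r E hE hEB
  have hG := aux_conv (fderiv ℝ u) (hu.continuous_fderiv (by simp)) (hs.fderiv ℝ) Set.univ
  simp only [Measure.restrict_univ] at hG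
  rw [hG, aux_conv u hu.continuous hs, aux_conv u hu.continuous hs] at h
  have hEf : volume E ≠ ⊤ := ((measure_mono hEB).trans_lt measure_ball_lt_top).ne
  have p1 : 0 ≤ ∫ x in E, ‖u x‖ ^ 2 := integral_nonneg fun x => by positivity
  have p2 : 0 ≤ ∫ x in ball x₀ r, ‖u x‖ ^ 2 := integral_nonneg fun x => by positivity
  have p3 : 0 ≤ ∫ x, ‖fderiv ℝ u x‖ ^ 2 := integral_nonneg fun x => by positivity
  have h' := ENNReal.toReal_mono (by finiteness) h
  rw [ENNReal.toReal_add (by finiteness) (by finiteness)] at h'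
  simpa [ENNReal.toReal_mul, ENNReal.toReal_ofReal, p1, p2, p3, hr.le, measureReal_def] using h'

lemma aux_E {d : ℕ} (a : EuclideanSpace ℝ (Fin d) → ℝ) (ha : Measurable a)
    (B : Set (EuclideanSpace ℝ (Fin d))) (hB : MeasurableSet B) (h : 0 < ∫ x in B, a x) :
    ∃ ε > 0, volume (B ∩ {x | ε ≤ a x}) ≠ 0 := by
  by_contra! hc
  have h0 : volume (⋃ n : ℕ, B ∩ {x | 1 / ((n : ℝ) + 1) ≤ a x}) = 0 :=
    measure_iUnion_null fun n => hc _ (by positivity)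
  have : ∫ x in B, a x ≤ 0 := by
    apply integral_nonpos_of_ae
    rw [Filter.EventuallyLE, ae_restrict_iff' hB]
    filter_upwards [measure_eq_zero_iff_ae_notMem.1 h0] with x hx hxB
    by_contra! hpos
    obtain ⟨n, hn⟩ := exists_nat_one_div_lt hpos
    exact hx (Set.mem_iUnion.2 ⟨n, hxB, hn.le⟩)
  linarith

lemma aux_low {d : ℕ} (f a : EuclideanSpace ℝ (Fin d) → ℝ) (hf : Integrable f)
    (hint : Integrable fun x => a x * f x) (hn : ∀ᵐ x, 0 ≤ a x * f x)
    (S : Set (EuclideanSpace ℝ (Fin d))) (hS : MeasurableSet S) (c : ℝ)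
    (h : ∀ᵐ x, x ∈ S → c * f x ≤ a x * f x) :
    c * ∫ x in S, f x ≤ ∫ x, a x * f x := by
  rw [← integral_const_mul]
  refine le_trans (setIntegral_mono_on_ae (hf.const_mul c).integrableOn hint.integrableOn hS h) ?_
  exact setIntegral_le_integral hint hn

theorem coercivity_t_lambda_ball_condition
    (d : ℕ) (hd : 1 ≤ d)
    (Ω : Set (EuclideanSpace ℝ (Fin d))) (hΩopen : IsOpen Ω) (hΩne : Ω.Nonempty)
    (a q : EuclideanSpace ℝ (Fin d) → ℝ)
    (ha_meas : Measurable a) (hq_meas : Measurable q)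
    (ha_nonneg : ∀ᵐ x, x ∈ Ω → 0 ≤ a x)
    (hq_nonneg : ∀ᵐ x, x ∈ Ω → 0 ≤ q x)
    (ha_loc : LocallyIntegrableOn a Ω)
    (hq_loc : LocallyIntegrableOn q Ω)
    (hball : ∃ (x₀ : EuclideanSpace ℝ (Fin d)) (r₀ a₀ : ℝ), 0 < r₀ ∧ 0 < a₀ ∧
      closedBall x₀ r₀ ⊆ Ω ∧
      (0 < ∫ x in ball x₀ r₀, a x) ∧
      (∀ᵐ x, x ∈ Ω \ ball x₀ r₀ → a₀ ≤ a x)) :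
    ∃ (τ₀ C : ℝ), τ₀ ∈ Set.Ioc (0 : ℝ) 1 ∧ 0 < C ∧
      ∀ (l : ℂ), 0 ≤ l.re → 0 < ‖l‖ → ‖l‖ ≤ τ₀ →
      ∀ u : EuclideanSpace ℝ (Fin d) → ℂ,
        ContDiff ℝ (⊤ : ℕ∞) u → HasCompactSupport u → tsupport u ⊆ Ω →
        C * ((∫ x, ‖fderiv ℝ u x‖ ^ 2) + (∫ x, q x * ‖u x‖ ^ 2)
            + ‖l‖ * (∫ x, a x * ‖u x‖ ^ 2)
            + ‖l‖ * (∫ x, ‖u x‖ ^ 2))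
          ≤ ‖((((∫ x, ‖fderiv ℝ u x‖ ^ 2) : ℝ) : ℂ)
            + (((∫ x, q x * ‖u x‖ ^ 2) : ℝ) : ℂ)
            + l * (((∫ x, a x * ‖u x‖ ^ 2) : ℝ) : ℂ)
            + l ^ 2 * (((∫ x, ‖u x‖ ^ 2) : ℝ) : ℂ))‖ := by
  obtain ⟨x₀, r, a₀, hr, ha₀, hBΩ, hpos, hout⟩ := hball
  obtain ⟨ε, hε, hEpos⟩ := aux_E a ha_meas _ measurableSet_ball hpos
  set E := ball x₀ r ∩ {x | ε ≤ a x} with hEdef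
  have hE : MeasurableSet E :=
    measurableSet_ball.inter (measurableSet_le measurable_const ha_meas)
  have hEB : E ⊆ ball x₀ r := Set.inter_subset_left
  have hEf : volume E ≠ ⊤ := ((measure_mono hEB).trans_lt measure_ball_lt_top).ne
  set e := volume.real E with he
  have he0 : 0 < e := ENNReal.toReal_pos hEpos hEf
  set b := volume.real (ball x₀ r) with hb
  set V := volume.real (ball (0 : EuclideanSpace ℝ (Fin d)) (2 * r)) with hV
  have hb0 : 0 ≤ b := measureReal_nonneg
  have hV0 : 0 ≤ V := measureReal_nonneg
  obtain ⟨K, hK⟩ : ∃ K, K = 1 + 2 * b / (e * ε) + 2 * (V * (2 * r) ^ 2) / e + 1 / a₀ := ⟨_, rfl⟩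
  have t1 : 0 ≤ 2 * b / (e * ε) := by positivity
  have t2 : 0 ≤ 2 * (V * (2 * r) ^ 2) / e := by positivity
  have t3 : 0 ≤ 1 / a₀ := by positivity
  have hK1 : 1 ≤ K := by linarith
  have hK0 : 0 < K := by linarith
  refine ⟨1 / (4 * K), 1 / (8 * K), ⟨by positivity, ?_⟩, by positivity, ?_⟩
  · rw [div_le_one (by positivity)]; linarith
  intro l hl _ hlt u hu hs hsΩ
  have hfi := aux_int u hu.continuous hs
  have hz : ∀ x, x ∉ Ω → ‖u x‖ ^ 2 = 0 := by
    intro x hx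
    simp [image_eq_zero_of_notMem_tsupport fun h => hx (hsΩ h)]
  have hAn : ∀ᵐ x, 0 ≤ a x * ‖u x‖ ^ 2 := by
    filter_upwards [ha_nonneg] with x hx
    by_cases h : x ∈ Ω
    · have := hx h; positivity
    · simp [hz x h]
  have hQn : ∀ᵐ x, 0 ≤ q x * ‖u x‖ ^ 2 := by
    filter_upwards [hq_nonneg] with x hx
    by_cases h : x ∈ Ω
    · have := hx h; positivity
    · simp [hz x h]
  have hAi : Integrable fun x => a x * ‖u x‖ ^ 2 := by
    have h1 : IntegrableOn a (tsupport u) := ha_loc.integrableOn_compact_subset hsΩ hs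
    have h2 : IntegrableOn (fun x => a x * ‖u x‖ ^ 2) (tsupport u) :=
      h1.mul_continuousOn (by have := hu.continuous; fun_prop) hs
    refine (integrableOn_iff_integrable_of_support_subset ?_).1 h2
    intro x hx
    by_contra hcon
    exact hx (by simp [image_eq_zero_of_notMem_tsupport hcon])
  have hNE := aux_low _ a hfi hAi hAn E hE ε (Filter.Eventually.of_forall fun x hx =>
    mul_le_mul_of_nonneg_right hx.2 (by positivity))
  have hNB := aux_low _ a hfi hAi hAn (ball x₀ r)ᶜ measurableSet_ball.compl a₀ (by
    filter_upwards [hout] with x hx hxB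
    by_cases h : x ∈ Ω
    · exact mul_le_mul_of_nonneg_right (hx ⟨h, hxB⟩) (by positivity)
    · simp [hz x h])
  have hP := aux_real u hu hs x₀ r hr E hE hEB
  have hsplit := integral_add_compl (measurableSet_ball (x := x₀) (ε := r)) hfi
  have hA0 := integral_nonneg_of_ae hAn
  have hQ0 := integral_nonneg_of_ae hQn
  have hG0 : 0 ≤ ∫ x, ‖fderiv ℝ u x‖ ^ 2 := integral_nonneg fun x => by positivity
  have hN0 : 0 ≤ ∫ x, ‖u x‖ ^ 2 := integral_nonneg fun x => by positivity
  rw [← Complex.ofReal_add]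
  apply aux_alg _ _ _ K l (by positivity) hA0 hN0 hK1 hl hlt
  rw [← hsplit]
  generalize (∫ x, ‖fderiv ℝ u x‖ ^ 2) = G at *
  generalize (∫ x, q x * ‖u x‖ ^ 2) = Q at *
  generalize (∫ x, a x * ‖u x‖ ^ 2) = A at *
  generalize (∫ x in E, ‖u x‖ ^ 2) = NE at *
  generalize (∫ x in ball x₀ r, ‖u x‖ ^ 2) = NB at *
  generalize (∫ x in (ball x₀ r)ᶜ, ‖u x‖ ^ 2) = NC at *
  have i1 : NC ≤ 1 / a₀ * A := by
    rw [one_div_mul_eq_div, le_div_iff₀ ha₀]; linarith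
  have i2 : NE ≤ A / ε := by rw [le_div_iff₀ hε]; linarith
  have i3 : NB ≤ 2 * b / (e * ε) * A + 2 * (V * (2 * r) ^ 2) / e * G := by
    have : e * NB ≤ 2 * (b * (A / ε)) + 2 * (V * ((2 * r) ^ 2 * G)) := by
      refine hP.trans ?_
      gcongr
    have e1 : 2 * b / (e * ε) * A + 2 * (V * (2 * r) ^ 2) / e * G =
      (2 * (b * (A / ε)) + 2 * (V * ((2 * r) ^ 2 * G))) / e := by
      field_simp
    rw [e1, le_div_iff₀ he0]; linarith
  have j1 : 2 * b / (e * ε) * A ≤ (1 + 2 * b / (e * ε)) * (G + Q + A) := by nlinarith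
  have j2 := mul_nonneg t1 (add_nonneg hG0 hQ0)
  have j3 := mul_nonneg t2 (add_nonneg hA0 hQ0)
  have j4 := mul_nonneg t3 (add_nonneg hG0 hQ0)
  rw [hK]
  linarith
end

section
/- Let Ω ⊆ ℝ^d (d ≥ 1) be open, and let a, q : ℝ^d → ℝ be measurable, nonnegative a.e. on Ω and locally integrable on Ω. Assume the polynomial growth condition: there exist r₀ > 0, c > 0 and β > 0 such that ℝ^d ∖ B(0,r₀) ⊆ Ω and a(x) ≥ c‖x‖^β for a.e. x with ‖x‖ > r₀. Then there exist τ₀ ∈ (0,1] and C > 0 such that for every λ ∈ ℂ with Re λ ≥ 0 and 0 < |λ| ≤ τ₀, and every test function u on Ω, one has |‖∇u‖²_{L²} + ∫ q|u|² + λ ∫ a|u|² + λ² ∫ |u|²| ≥ C ( ‖∇u‖²_{L²} + ∫ q|u|² + |λ| ∫ a|u|² + |λ|^{2/(2+β)} ∫ |u|² ). -/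
open MeasureTheory Metric

lemma coer_pointwise {E : Type*} [NormedAddCommGroup E] [NormedSpace ℝ E]
    (u : E → ℂ) (hu : ContDiff ℝ (⊤ : ℕ∞) u) (x h : E) :
    ‖u (x + h) - u x‖ ^ 2 ≤ ‖h‖ ^ 2 * ∫ t in (0:ℝ)..1, ‖fderiv ℝ u (x + t • h)‖ ^ 2 := by
  have hc : Continuous (fderiv ℝ u) := hu.continuous_fderiv (by simp)
  have hc2 : Continuous (fun t : ℝ => ‖fderiv ℝ u (x + t • h)‖) := by fun_prop
  have hd : ∀ t : ℝ, HasDerivAt (fun t : ℝ => u (x + t • h)) (fderiv ℝ u (x + t • h) h) t := by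
    intro t
    have h1 : HasDerivAt (fun t : ℝ => x + t • h) h t := by
      simpa using ((hasDerivAt_id t).smul_const h).const_add x
    exact ((hu.differentiable (by simp)) (x + t • h)).hasFDerivAt.comp_hasDerivAt t h1
  have hI := intervalIntegral.integral_eq_sub_of_hasDerivAt (a := 0) (b := 1) (fun t _ => hd t)
    ((by fun_prop : Continuous (fun t : ℝ => fderiv ℝ u (x + t • h) h)).intervalIntegrable 0 1)
  simp only [one_smul, zero_smul, add_zero] at hI
  set m := ∫ t in (0:ℝ)..1, ‖fderiv ℝ u (x + t • h)‖ with hm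
  have hm0 : 0 ≤ m := intervalIntegral.integral_nonneg (by norm_num) (fun _ _ => norm_nonneg _)
  have h1 : ‖u (x + h) - u x‖ ≤ m * ‖h‖ := by
    rw [← hI, hm, ← intervalIntegral.integral_mul_const]
    refine intervalIntegral.norm_integral_le_of_norm_le (by norm_num) ?_
      ((hc2.mul continuous_const).intervalIntegrable 0 1)
    exact Filter.Eventually.of_forall (fun t _ => ContinuousLinearMap.le_opNorm _ _)
  have h2 : m ^ 2 ≤ ∫ t in (0:ℝ)..1, ‖fderiv ℝ u (x + t • h)‖ ^ 2 := by
    have h3 : 2 * m * m - m ^ 2 ≤ ∫ t in (0:ℝ)..1, ‖fderiv ℝ u (x + t • h)‖ ^ 2 := by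
      have : ∫ t in (0:ℝ)..1, (2 * m * ‖fderiv ℝ u (x + t • h)‖ - m ^ 2) = 2 * m * m - m ^ 2 := by
        rw [intervalIntegral.integral_sub ((hc2.const_mul _).intervalIntegrable 0 1) (by simp),
          intervalIntegral.integral_const_mul]
        simp [hm]
      rw [← this]
      refine intervalIntegral.integral_mono_on (by norm_num)
        ((by fun_prop : Continuous _).intervalIntegrable 0 1)
        ((by fun_prop : Continuous _).intervalIntegrable 0 1) ?_
      intro t _
      nlinarith [sq_nonneg (‖fderiv ℝ u (x + t • h)‖ - m)]
    nlinarith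
  calc ‖u (x + h) - u x‖ ^ 2 ≤ (m * ‖h‖) ^ 2 := by gcongr
    _ = ‖h‖ ^ 2 * m ^ 2 := by ring
    _ ≤ _ := by gcongr

lemma coer_shift {d : ℕ} (u : EuclideanSpace ℝ (Fin d) → ℂ) (hu : ContDiff ℝ (⊤ : ℕ∞) u)
    (hs : HasCompactSupport u) (h : EuclideanSpace ℝ (Fin d)) :
    ∫ x, ‖u (x + h) - u x‖ ^ 2 ≤ ‖h‖ ^ 2 * ∫ x, ‖fderiv ℝ u x‖ ^ 2 := by
  have hc : Continuous (fderiv ℝ u) := hu.continuous_fderiv (by simp)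
  have hcs : HasCompactSupport (fderiv ℝ u) := hs.fderiv ℝ
  have hgi : Integrable (fun x => ‖fderiv ℝ u x‖ ^ 2) := by
    refine Continuous.integrable_of_hasCompactSupport (by fun_prop) ?_
    exact hcs.comp_left (g := fun z => ‖z‖ ^ 2) (by simp)
  have hprod : Integrable (fun p : EuclideanSpace ℝ (Fin d) × ℝ =>
      ‖fderiv ℝ u (p.1 + p.2 • h)‖ ^ 2)
      ((volume : Measure (EuclideanSpace ℝ (Fin d))).prod
        ((volume : Measure ℝ).restrict (Set.Ioc 0 1))) := by
    rw [integrable_prod_iff' (by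
      exact (by fun_prop : Continuous _).aestronglyMeasurable)]
    constructor
    · exact Filter.Eventually.of_forall (fun t => hgi.comp_add_right (t • h))
    · have : ∀ t : ℝ, ∫ x, ‖‖fderiv ℝ u (x + t • h)‖ ^ 2‖ = ∫ x, ‖fderiv ℝ u x‖ ^ 2 := by
        intro t
        simp only [norm_pow, norm_norm]
        exact integral_add_right_eq_self (fun x => ‖fderiv ℝ u x‖ ^ 2) (t • h)
      simp only [this]
      exact integrable_const _
  have hswap := integral_integral_swap (f := fun x (t : ℝ) => ‖fderiv ℝ u (x + t • h)‖ ^ 2) hprod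
  have hval : ∀ t : ℝ, ∫ x, ‖fderiv ℝ u (x + t • h)‖ ^ 2 = ∫ x, ‖fderiv ℝ u x‖ ^ 2 := fun t =>
    integral_add_right_eq_self (fun x => ‖fderiv ℝ u x‖ ^ 2) (t • h)
  simp only [hval] at hswap
  have hone : ∫ _t in Set.Ioc (0:ℝ) 1, (∫ x, ‖fderiv ℝ u x‖ ^ 2) = ∫ x, ‖fderiv ℝ u x‖ ^ 2 := by
    simp
  rw [hone] at hswap
  rw [← hswap, ← integral_const_mul]
  refine integral_mono_of_nonneg (Filter.Eventually.of_forall (fun x => by positivity))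
    (hprod.integral_prod_left.const_mul _) (Filter.Eventually.of_forall (fun x => ?_))
  have := coer_pointwise u hu x h
  rwa [intervalIntegral.integral_of_le (by norm_num)] at this

/-- Poincare-type estimate. -/
lemma coer_poincare {d : ℕ} (hd : 1 ≤ d) (u : EuclideanSpace ℝ (Fin d) → ℂ)
    (hu : ContDiff ℝ (⊤ : ℕ∞) u) (hs : HasCompactSupport u) (R : ℝ) (hR : 0 < R) :
    ∫ x, ‖u x‖ ^ 2 ≤ 3 * (∫ x, (ball 0 R)ᶜ.indicator (fun x => ‖u x‖ ^ 2) x)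
      + 8 * R ^ 2 * ∫ x, ‖fderiv ℝ u x‖ ^ 2 := by
  obtain ⟨h, hh⟩ : ∃ h : EuclideanSpace ℝ (Fin d), ‖h‖ = 2 * R := by
    refine ⟨EuclideanSpace.single ⟨0, hd⟩ (2 * R), ?_⟩
    simp [abs_of_pos hR]
  have hsh := coer_shift u hu hs h
  rw [hh] at hsh
  have hcu := hu.continuous
  have hui : Integrable (fun x => ‖u x‖ ^ 2) :=
    Continuous.integrable_of_hasCompactSupport (by fun_prop)
      (hs.comp_left (g := fun z => ‖z‖ ^ 2) (by simp))
  set w := (ball (0 : EuclideanSpace ℝ (Fin d)) R)ᶜ.indicator (fun x => ‖u x‖ ^ 2) with hw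
  have hwi : Integrable w := hui.indicator measurableSet_ball.compl
  have hw0 : ∀ x, 0 ≤ w x := fun x => Set.indicator_nonneg (fun _ _ => by positivity) x
  have hdi : Integrable (fun x => ‖u (x + h) - u x‖ ^ 2) := by
    refine Integrable.mono' (((hui.comp_add_right h).const_mul 2).add (hui.const_mul 2))
      (by fun_prop : Continuous _).aestronglyMeasurable (Filter.Eventually.of_forall fun x => ?_)
    simp only [norm_pow, norm_norm, Pi.add_apply]
    have := norm_sub_le (u (x + h)) (u x)
    nlinarith [sq_nonneg (‖u (x+h)‖ - ‖u x‖), norm_nonneg (u (x + h) - u x)]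
  have hpt : ∀ x, ‖u x‖ ^ 2 ≤ w x + 2 * w (x + h) + 2 * ‖u (x + h) - u x‖ ^ 2 := by
    intro x
    by_cases hx : x ∈ ball (0 : EuclideanSpace ℝ (Fin d)) R
    · have hx' : x + h ∈ (ball (0 : EuclideanSpace ℝ (Fin d)) R)ᶜ := by
        simp only [Set.mem_compl_iff, mem_ball, dist_zero_right, not_lt] at hx ⊢
        have := norm_sub_le (x + h) x
        simp only [add_sub_cancel_left] at this
        linarith
      have e : w (x + h) = ‖u (x + h)‖ ^ 2 := Set.indicator_of_mem hx' _
      rw [e]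
      have := norm_sub_le (u (x + h)) (u (x + h) - u x)
      simp only [sub_sub_cancel] at this
      nlinarith [sq_nonneg (‖u (x+h)‖ - ‖u (x + h) - u x‖), norm_nonneg (u x), hw0 x]
    · have e : w x = ‖u x‖ ^ 2 := Set.indicator_of_mem hx _
      rw [e]
      have := hw0 (x + h)
      nlinarith [sq_nonneg (‖u (x + h) - u x‖)]
  have hwh := hwi.comp_add_right h
  have hmono := integral_mono hui ((hwi.add (hwh.const_mul 2)).add (hdi.const_mul 2)) hpt
  have e1 : ∫ x, (w x + 2 * w (x + h) + 2 * ‖u (x + h) - u x‖ ^ 2)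
      = (∫ x, w x) + 2 * (∫ x, w x) + 2 * ∫ x, ‖u (x + h) - u x‖ ^ 2 := by
    have hadd : Integrable (fun x => w x + 2 * w (x + h)) := hwi.add (hwh.const_mul 2)
    rw [integral_add hadd (hdi.const_mul 2),
      integral_add hwi (hwh.const_mul 2), integral_const_mul, integral_const_mul,
      integral_add_right_eq_self w h]
  have hmono' : ∫ x, ‖u x‖ ^ 2 ≤ ∫ x, (w x + 2 * w (x + h) + 2 * ‖u (x + h) - u x‖ ^ 2) := hmono
  rw [e1] at hmono'
  nlinarith

lemma coer_weight {d : ℕ}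
    (Ω : Set (EuclideanSpace ℝ (Fin d)))
    (a : EuclideanSpace ℝ (Fin d) → ℝ)
    (ha_nonneg : ∀ᵐ x, x ∈ Ω → 0 ≤ a x)
    (ha_loc : LocallyIntegrableOn a Ω)
    (β : ℝ) (hβ : 0 < β) (r₀ c : ℝ) (hr₀ : 0 < r₀) (hc : 0 < c)
    (hg : ∀ᵐ x, r₀ < ‖x‖ → c * ‖x‖ ^ β ≤ a x)
    (R : ℝ) (hR : r₀ < R)
    (u : EuclideanSpace ℝ (Fin d) → ℂ) (hu : Continuous u) (hs : HasCompactSupport u)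
    (hsub : tsupport u ⊆ Ω) :
    c * R ^ β * (∫ x, (ball 0 R)ᶜ.indicator (fun x => ‖u x‖ ^ 2) x)
      ≤ ∫ x, a x * ‖u x‖ ^ 2 := by
  have hai : IntegrableOn a (tsupport u) := ha_loc.integrableOn_compact_subset hsub hs
  have hint : Integrable (fun x => a x * ‖u x‖ ^ 2) := by
    have h1 : IntegrableOn (fun x => a x * ‖u x‖ ^ 2) (tsupport u) :=
      hai.mul_continuousOn (by fun_prop) hs
    refine (integrableOn_iff_integrable_of_support_subset ?_).1 h1
    intro x hx
    apply subset_tsupport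
    intro h0
    simp [h0] at hx
  rw [← integral_const_mul]
  have hR0 : 0 < R := hr₀.trans hR
  refine integral_mono_of_nonneg (Filter.Eventually.of_forall fun x => ?_) hint ?_
  · exact mul_nonneg (by positivity) (Set.indicator_nonneg (fun _ _ => by positivity) x)
  · filter_upwards [ha_nonneg, hg] with x h1 h2
    by_cases hx : x ∈ (ball (0 : EuclideanSpace ℝ (Fin d)) R)ᶜ
    · rw [Set.indicator_of_mem hx]
      simp only [Set.mem_compl_iff, mem_ball, dist_zero_right, not_lt] at hx
      have h3 := h2 (hR.trans_le hx)
      have h4 : R ^ β ≤ ‖x‖ ^ β := Real.rpow_le_rpow hR0.le hx hβ.le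
      have : c * R ^ β ≤ a x := le_trans (by gcongr) h3
      gcongr
    · rw [Set.indicator_of_notMem hx, mul_zero]
      by_cases hxu : u x = 0
      · simp [hxu]
      · exact mul_nonneg (h1 (hsub (subset_tsupport _ hxu))) (by positivity)

lemma coer_algebra (l : ℂ) (hl : 0 ≤ l.re) (A D N : ℝ) (hA : 0 ≤ A) (hD : 0 ≤ D) (hN : 0 ≤ N)
    (h : ‖l‖ ^ 2 * N ≤ (A + ‖l‖ * D) / 4) :
    (A + ‖l‖ * D) / 4 ≤ ‖(A : ℂ) + l * (D : ℂ) + l ^ 2 * (N : ℂ)‖ := by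
  have h1 : (A + ‖l‖ * D) / 2 ≤ ‖(A : ℂ) + l * (D : ℂ)‖ := by
    refine abs_le_of_sq_le_sq' ?_ (norm_nonneg _) |>.2
    have e : ‖(A : ℂ) + l * (D : ℂ)‖ ^ 2 = (A + l.re * D) ^ 2 + (l.im * D) ^ 2 := by
      rw [Complex.sq_norm, Complex.normSq_apply]; simp; ring
    have e2 : ‖l‖ ^ 2 = l.re ^ 2 + l.im ^ 2 := by
      rw [Complex.sq_norm, Complex.normSq_apply]; ring
    have e3 : ((A + ‖l‖ * D) / 2) ^ 2 ≤ A ^ 2 + ‖l‖ ^ 2 * D ^ 2 := by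
      nlinarith [sq_nonneg (A - ‖l‖ * D), sq_nonneg (A + ‖l‖ * D)]
    rw [e]
    rw [e2] at e3
    have : 0 ≤ A * (l.re * D) := by positivity
    nlinarith
  have h2 : ‖l ^ 2 * (N : ℂ)‖ = ‖l‖ ^ 2 * N := by
    simp [abs_of_nonneg hN]
  have h3 := norm_sub_le ((A : ℂ) + l * (D : ℂ) + l ^ 2 * (N : ℂ)) (l ^ 2 * (N : ℂ))
  rw [add_sub_cancel_right, h2] at h3
  linarith

/-- **Proposition 3.3 (γ = 2/(2+β)), low-frequency coercivity of the quadratic form `t_λ`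
under the polynomial growth condition (Assumption 3.2).** -/
theorem coercivity_t_lambda_polynomial_growth
    (d : ℕ) (hd : 1 ≤ d)
    (Ω : Set (EuclideanSpace ℝ (Fin d))) (hΩopen : IsOpen Ω)
    (a q : EuclideanSpace ℝ (Fin d) → ℝ)
    (ha_meas : Measurable a) (hq_meas : Measurable q)
    (ha_nonneg : ∀ᵐ x, x ∈ Ω → 0 ≤ a x)
    (hq_nonneg : ∀ᵐ x, x ∈ Ω → 0 ≤ q x)
    (ha_loc : LocallyIntegrableOn a Ω)
    (hq_loc : LocallyIntegrableOn q Ω)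
    (β : ℝ) (hβ : 0 < β)
    (hgrowth : ∃ (r₀ c : ℝ), 0 < r₀ ∧ 0 < c ∧
      (ball (0 : EuclideanSpace ℝ (Fin d)) r₀)ᶜ ⊆ Ω ∧
      (∀ᵐ x, r₀ < ‖x‖ → c * ‖x‖ ^ β ≤ a x)) :
    ∃ (τ₀ C : ℝ), τ₀ ∈ Set.Ioc (0 : ℝ) 1 ∧ 0 < C ∧
      ∀ (l : ℂ), 0 ≤ l.re → 0 < ‖l‖ → ‖l‖ ≤ τ₀ →
      ∀ u : EuclideanSpace ℝ (Fin d) → ℂ,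
        ContDiff ℝ (⊤ : ℕ∞) u → HasCompactSupport u → tsupport u ⊆ Ω →
        C * ((∫ x, ‖fderiv ℝ u x‖ ^ 2) + (∫ x, q x * ‖u x‖ ^ 2)
            + ‖l‖ * (∫ x, a x * ‖u x‖ ^ 2)
            + ‖l‖ ^ (2 / (2 + β)) * (∫ x, ‖u x‖ ^ 2))
          ≤ ‖(((∫ x, ‖fderiv ℝ u x‖ ^ 2) : ℝ) : ℂ)
            + (((∫ x, q x * ‖u x‖ ^ 2) : ℝ) : ℂ)
            + l * (((∫ x, a x * ‖u x‖ ^ 2) : ℝ) : ℂ)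
            + l ^ 2 * (((∫ x, ‖u x‖ ^ 2) : ℝ) : ℂ)‖ := by
  obtain ⟨r₀, c, hr₀, hc, -, hg⟩ := hgrowth
  have hβ2 : 0 < 2 + β := by linarith
  set K : ℝ := 8 + 3 / c with hK
  have hKpos : 0 < K := by positivity
  refine ⟨min (min 1 (1 / (4 * K))) ((r₀ + 1) ^ (-(2 + β))), 1 / (4 * (1 + K)),
    ⟨by positivity, (min_le_left _ _).trans (min_le_left _ _)⟩, by positivity, ?_⟩
  intro l hl hs hsτ u hu hsupp hsub
  have hs1 : ‖l‖ ≤ 1 := hsτ.trans ((min_le_left _ _).trans (min_le_left _ _))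
  have hs2 : ‖l‖ ≤ 1 / (4 * K) := hsτ.trans ((min_le_left _ _).trans (min_le_right _ _))
  have hs3 : ‖l‖ ≤ (r₀ + 1) ^ (-(2 + β)) := hsτ.trans (min_le_right _ _)
  set s := ‖l‖ with hsdef
  set R : ℝ := s ^ (-(1 / (2 + β))) with hRdef
  have hR0 : 0 < R := by positivity
  have hRr : r₀ < R := by
    have h1 : ((r₀ + 1) ^ (-(2 + β))) ^ (-(1 / (2 + β))) ≤ R :=
      Real.rpow_le_rpow_of_nonpos hs hs3 (by
        have : 0 < 1 / (2 + β) := by positivity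
        linarith)
    rw [← Real.rpow_mul (by positivity)] at h1
    have e : -(2 + β) * -(1 / (2 + β)) = 1 := by field_simp
    rw [e, Real.rpow_one] at h1
    linarith
  have hP := coer_poincare hd u hu hsupp R hR0
  have hW := coer_weight Ω a ha_nonneg ha_loc β hβ r₀ c hr₀ hc hg R hRr u hu.continuous hsupp hsub
  set W := ∫ x, (ball (0 : EuclideanSpace ℝ (Fin d)) R)ᶜ.indicator (fun x => ‖u x‖ ^ 2) x
  have hW0 : 0 ≤ W := integral_nonneg fun x => Set.indicator_nonneg (fun _ _ => by positivity) x
  set G := ∫ x, ‖fderiv ℝ u x‖ ^ 2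
  have hG0 : 0 ≤ G := integral_nonneg fun x => by positivity
  have hQ0 : 0 ≤ ∫ x, q x * ‖u x‖ ^ 2 := by
    refine integral_nonneg_of_ae ?_
    filter_upwards [hq_nonneg] with x h1
    by_cases hxu : u x = 0
    · simp [hxu]
    · exact mul_nonneg (h1 (hsub (subset_tsupport _ hxu))) (by positivity)
  set Q := ∫ x, q x * ‖u x‖ ^ 2
  set D := ∫ x, a x * ‖u x‖ ^ 2
  have hD0 : 0 ≤ D := le_trans (by positivity) hW
  set N := ∫ x, ‖u x‖ ^ 2
  have hN0 : 0 ≤ N := integral_nonneg fun x => by positivity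
  set γ : ℝ := s ^ (2 / (2 + β)) with hγ
  have hγ0 : 0 < γ := by positivity
  have hγR : γ * R ^ 2 = 1 := by
    rw [hγ, hRdef, ← Real.rpow_natCast, ← Real.rpow_mul hs.le, ← Real.rpow_add hs]
    have : 2 / (2 + β) + -(1 / (2 + β)) * ((2 : ℕ) : ℝ) = 0 := by push_cast; field_simp; ring
    rw [this, Real.rpow_zero]
  have hγs : s * R ^ β = γ := by
    rw [hγ, hRdef, ← Real.rpow_mul hs.le]
    nth_rewrite 1 [← Real.rpow_one s]
    rw [← Real.rpow_add hs]
    congr 1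
    field_simp
    ring
  have hsγ : s ≤ γ := by
    have : 2 / (2 + β) ≤ 1 := by rw [div_le_one hβ2]; linarith
    calc s = s ^ (1 : ℝ) := (Real.rpow_one s).symm
      _ ≤ γ := Real.rpow_le_rpow_of_exponent_ge hs hs1 this
  have hgW : γ * W ≤ s * D / c := by
    rw [le_div_iff₀ hc, ← hγs]
    calc s * R ^ β * W * c = s * (c * R ^ β * W) := by ring
      _ ≤ s * D := by gcongr
  have hkey : γ * N ≤ K * (G + Q + s * D) := by
    have h1 : γ * N ≤ γ * (3 * W + 8 * R ^ 2 * G) := by gcongr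
    have h2 : γ * (3 * W + 8 * R ^ 2 * G) = 3 * (γ * W) + 8 * (γ * R ^ 2) * G := by ring
    rw [h2, hγR] at h1
    have h3 : K * (G + Q + s * D) = 8 * (G + Q + s * D) + 3 / c * (G + Q) + 3 * (s * D / c) := by
      rw [hK]; ring
    have h4 : 0 ≤ 3 / c * (G + Q) := by positivity
    have h5 : 0 ≤ s * D := by positivity
    rw [h3]
    linarith
  have hX0 : 0 ≤ G + Q + s * D := by positivity
  have hsmall : s ^ 2 * N ≤ (G + Q + s * D) / 4 := by
    have hsK : s * K ≤ 1 / 4 := by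
      calc s * K ≤ 1 / (4 * K) * K := by gcongr
        _ = 1 / 4 := by field_simp
    calc s ^ 2 * N = s * (s * N) := by ring
      _ ≤ s * (γ * N) := by gcongr
      _ ≤ s * (K * (G + Q + s * D)) := by gcongr
      _ = (s * K) * (G + Q + s * D) := by ring
      _ ≤ 1 / 4 * (G + Q + s * D) := by gcongr
      _ = _ := by ring
  have hfin := coer_algebra l hl (G + Q) D N (by positivity) hD0 hN0 hsmall
  rw [Complex.ofReal_add] at hfin
  refine le_trans ?_ hfin
  calc 1 / (4 * (1 + K)) * (G + Q + s * D + γ * N)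
      ≤ 1 / (4 * (1 + K)) * (G + Q + s * D + K * (G + Q + s * D)) := by gcongr
    _ = (G + Q + s * D) / 4 := by field_simp
end

section
/- Let K be a complex Hilbert space, X and Y normed vector spaces, and T_X : X → K, T_Y : K → Y bounded linear operators. Let S : [0,∞) → B(K) satisfy S(0) = I, S(t+s) = S(t)S(s) for all t, s ≥ 0, t ↦ S(t)x continuous on [0,∞) for every x ∈ K, and ‖S(t)‖ ≤ M e^{ωt} for some M ≥ 1, ω ≥ 0. Let τ₀ ≥ 1, γ > 0, C₁ > 0, let U ⊆ ℂ be open with {λ : Re λ > 0} ∪ {λ : Re λ > −2γ and |Im λ| > τ₀/2} ⊆ U, and let R : U → B(K) be holomorphic and satisfy: (i) R(λ) − R(μ) = (λ−μ) R(λ) R(μ) for all λ, μ ∈ U; (ii) R(λ)x = −∫₀^∞ e^{−λt} S(t)x dt for every x ∈ K whenever Re λ > ω; (iii) ‖R(λ)‖_{B(K)} ≤ C₁ whenever Re λ > −2γ and |Im λ| > τ₀/2. Let m ∈ ℕ₀, κ ∈ [0,1) and C₀ > 0 be such that ‖T_Y ∘ R(λ)^{1+j} ∘ T_X‖_{B(X,Y)}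 ≤ C₀ |λ|^{m−κ−j} for all λ with Re λ > 0 and |λ| < τ₀, for every j ∈ {m, m+1, m+2} if κ = 0 and every j ∈ {m, m+1} if κ ≠ 0. Then there exists C > 0 such that for all t ≥ 0: ‖T_Y ∘ S(t) ∘ T_X‖_{B(X,Y)} ≤ C (1+t²)^{(−m−1+κ)/2}. -/
open MeasureTheory
set_option linter.unusedSectionVars false

lemma aux_integrable_exp_neg_abs : Integrable (fun t : ℝ => Real.exp (-|t|)) := by
  have h1 : IntegrableOn (fun t : ℝ => Real.exp (-|t|)) (Set.Iic 0) := by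
    refine (integrableOn_exp_Iic 0).congr_fun (fun t ht => ?_) measurableSet_Iic
    simp only [Set.mem_Iic] at ht
    simp [abs_of_nonpos ht]
  have h2 : IntegrableOn (fun t : ℝ => Real.exp (-|t|)) (Set.Ioi 0) := by
    refine (integrableOn_exp_neg_Ioi 0).congr_fun (fun t ht => ?_) measurableSet_Ioi
    simp only [Set.mem_Ioi] at ht
    simp [abs_of_pos ht]
  have := h1.union h2
  rwa [Set.Iic_union_Ioi, integrableOn_univ] at this

lemma aux_kernel (x : ℝ) :
    ∫ t : ℝ, ((Real.exp (-|t|) : ℝ) : ℂ) * Complex.exp (Complex.I * x * t) = 2 * ((1 + x ^ 2)⁻¹ : ℝ) := by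
  have hint : Integrable (fun t : ℝ => ((Real.exp (-|t|) : ℝ) : ℂ) * Complex.exp (Complex.I * x * t)) := by
    refine aux_integrable_exp_neg_abs.mono' (by fun_prop) (Filter.Eventually.of_forall fun t => ?_)
    rw [norm_mul, Complex.norm_exp]
    simp [Complex.norm_exp]
  rw [← intervalIntegral.integral_Iic_add_Ioi (b := 0) hint.integrableOn hint.integrableOn]
  have e1 : ∫ t in Set.Iic (0:ℝ), ((Real.exp (-|t|) : ℝ) : ℂ) * Complex.exp (Complex.I * x * t)
      = ∫ t in Set.Iic (0:ℝ), Complex.exp ((1 + Complex.I * x) * t) := by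
    refine setIntegral_congr_fun measurableSet_Iic (fun t ht => ?_)
    simp only [Set.mem_Iic] at ht
    simp only [abs_of_nonpos ht, neg_neg, Complex.ofReal_exp, ← Complex.exp_add]
    congr 1; ring
  have e2 : ∫ t in Set.Ioi (0:ℝ), ((Real.exp (-|t|) : ℝ) : ℂ) * Complex.exp (Complex.I * x * t)
      = ∫ t in Set.Ioi (0:ℝ), Complex.exp ((-1 + Complex.I * x) * t) := by
    refine setIntegral_congr_fun measurableSet_Ioi (fun t ht => ?_)
    simp only [Set.mem_Ioi] at ht
    simp only [abs_of_pos ht, Complex.ofReal_exp, ← Complex.exp_add]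
    congr 1; push_cast; ring
  rw [e1, e2, integral_exp_mul_complex_Iic (by simp), integral_exp_mul_complex_Ioi (by simp)]
  have h1 : (1 + Complex.I * x : ℂ) ≠ 0 := fun h => by simpa using congrArg Complex.re h
  have h2 : (-1 + Complex.I * x : ℂ) ≠ 0 := fun h => by simpa using congrArg Complex.re h
  have h3 : (1 + (x:ℂ)^2) ≠ 0 := by
    intro h
    have : (1 + x^2 : ℝ) = 0 := by exact_mod_cast h
    nlinarith [sq_nonneg x]
  push_cast
  simp only [mul_zero, Complex.exp_zero]
  field_simp
  linear_combination (-2 * (x:ℂ)^2) * Complex.I_sq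

lemma aux_integrable_cont {E : Type*} [NormedAddCommGroup E] (T : ℝ) {f : ℝ → E} (hf : Continuous f) :
    Integrable f (volume.restrict (Set.Icc (-T) T)) :=
  hf.continuousOn.integrableOn_compact isCompact_Icc

lemma aux_integrable_cont2 {E : Type*} [NormedAddCommGroup E] (T : ℝ) {f : ℝ × ℝ → E} (hf : Continuous f) :
    Integrable f ((volume.restrict (Set.Icc (-T) T)).prod (volume.restrict (Set.Icc (-T) T))) := by
  rw [Measure.prod_restrict]
  exact hf.continuousOn.integrableOn_compact (isCompact_Icc.prod isCompact_Icc)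


section
variable {K : Type*} [NormedAddCommGroup K] [InnerProductSpace ℂ K] [CompleteSpace K]

/-- truncated Fourier transform -/
noncomputable def auxH (h : ℝ → K) (T t : ℝ) : K :=
  ∫ τ in Set.Icc (-T) T, Complex.exp (-(Complex.I * τ * t)) • h τ

lemma auxH_cont {h : ℝ → K} (hc : Continuous h) (T : ℝ) : Continuous (auxH h T) := by
  unfold auxH
  refine continuous_of_dominated (bound := fun τ => ‖h τ‖) ?_ ?_ ?_ ?_
  · intro t; exact (by fun_prop : Continuous _).aestronglyMeasurable
  · intro t; refine Filter.Eventually.of_forall fun τ => ?_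
    rw [norm_smul, Complex.norm_exp]; simp
  · exact aux_integrable_cont T hc.norm
  · refine Filter.Eventually.of_forall fun τ => ?_
    fun_prop

lemma auxH_bound (h : ℝ → K) (T t : ℝ) :
    ‖auxH h T t‖ ≤ ∫ τ in Set.Icc (-T) T, ‖h τ‖ := by
  unfold auxH
  refine (norm_integral_le_integral_norm _).trans (le_of_eq ?_)
  congr 1; ext τ
  rw [norm_smul, Complex.norm_exp]; simp

lemma auxH_inner {h : ℝ → K} (hc : Continuous h) (T t : ℝ) :
    ((‖auxH h T t‖ ^ 2 : ℝ) : ℂ) = ∫ z, Complex.exp (Complex.I * (z.1 - z.2 : ℝ) * t) * inner ℂ (h z.1) (h z.2)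
      ∂((volume.restrict (Set.Icc (-T) T)).prod (volume.restrict (Set.Icc (-T) T))) := by
  have hi : Integrable (fun τ : ℝ => Complex.exp (-(Complex.I * τ * t)) • h τ) (volume.restrict (Set.Icc (-T) T)) :=
    aux_integrable_cont T (by fun_prop)
  rw [integral_prod _ (aux_integrable_cont2 T (by fun_prop))]
  have h1 : ((‖auxH h T t‖ ^ 2 : ℝ) : ℂ) = inner ℂ (auxH h T t) (auxH h T t) := by
    rw [inner_self_eq_norm_sq_to_K]; simp
  rw [h1]
  have h2 : ∀ k : K, inner ℂ (auxH h T t) k = ∫ τ in Set.Icc (-T) T, inner ℂ (Complex.exp (-(Complex.I * τ * t)) • h τ) k := by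
    intro k
    rw [← inner_conj_symm, auxH, ← integral_inner hi, ← integral_conj]
    simp only [inner_conj_symm]
  rw [h2]
  congr 1; ext τ
  conv_lhs => rw [auxH]
  rw [← integral_inner hi]
  congr 1; ext s
  rw [inner_smul_left, inner_smul_right, ← Complex.exp_conj, ← mul_assoc, ← Complex.exp_add]
  congr 2
  simp
  ring

lemma aux_plancherel {h : ℝ → K} (hc : Continuous h) (T : ℝ) :
    ∫ t : ℝ, Real.exp (-|t|) * ‖auxH h T t‖ ^ 2 ≤ 2 * Real.pi * ∫ τ in Set.Icc (-T) T, ‖h τ‖ ^ 2 := by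
  set μ := volume.restrict (Set.Icc (-T) T) with hμ
  set N := ∫ τ in Set.Icc (-T) T, ‖h τ‖ ^ 2 with hN
  have hJ : ((∫ t : ℝ, Real.exp (-|t|) * ‖auxH h T t‖ ^ 2 : ℝ) : ℂ)
      = ∫ z, 2 * ((1 + (z.1 - z.2) ^ 2)⁻¹ : ℝ) * inner ℂ (h z.1) (h z.2) ∂(μ.prod μ) := by
    rw [← integral_complex_ofReal]
    have : ∀ t : ℝ, ((Real.exp (-|t|) * ‖auxH h T t‖ ^ 2 : ℝ) : ℂ) =
        ∫ z, ((Real.exp (-|t|) : ℝ) : ℂ) * (Complex.exp (Complex.I * (z.1 - z.2 : ℝ) * t) * inner ℂ (h z.1) (h z.2)) ∂(μ.prod μ) := by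
      intro t
      rw [integral_const_mul, ← auxH_inner hc]; push_cast; ring
    simp_rw [this]
    rw [integral_integral_swap]
    · congr 1; ext z
      simp_rw [← mul_assoc]
      rw [integral_mul_const, aux_kernel]
    · have hb : Integrable (fun p : ℝ × (ℝ × ℝ) => Real.exp (-|p.1|) * (‖h p.2.1‖ * ‖h p.2.2‖)) (volume.prod (μ.prod μ)) :=
        aux_integrable_exp_neg_abs.mul_prod (aux_integrable_cont2 T (f := fun z => ‖h z.1‖ * ‖h z.2‖) (by fun_prop))
      refine hb.mono' ?_ (Filter.Eventually.of_forall fun p => ?_)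
      · refine StronglyMeasurable.aestronglyMeasurable ?_
        refine Continuous.stronglyMeasurable ?_
        simp only [Function.uncurry_def]
        fun_prop
      · simp only [Function.uncurry_def, norm_mul, Complex.norm_exp]
        have := norm_inner_le_norm (𝕜 := ℂ) (h p.2.1) (h p.2.2)
        simp [Complex.norm_exp]
        try gcongr
  have hker : ∀ τ : ℝ, ∫ s, (1 + (τ - s) ^ 2)⁻¹ ∂μ ≤ Real.pi := by
    intro τ
    have hi : Integrable (fun s : ℝ => (1 + (τ - s) ^ 2)⁻¹) :=
      integrable_inv_one_add_sq.comp_sub_left τ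
    refine (setIntegral_le_integral hi (Filter.Eventually.of_forall fun s => by positivity)).trans (le_of_eq ?_)
    rw [← integral_univ_inv_one_add_sq]
    exact integral_sub_left_eq_self (fun x : ℝ => (1 + x ^ 2)⁻¹) volume τ
  have hkc : Continuous fun z : ℝ × ℝ => (1 + (z.1 - z.2) ^ 2)⁻¹ := by
    refine Continuous.inv₀ (by fun_prop) (fun z => by positivity)
  have hnonneg : 0 ≤ ∫ t : ℝ, Real.exp (-|t|) * ‖auxH h T t‖ ^ 2 := integral_nonneg fun t => by positivity
  have e1 : ∫ z, (1 + (z.1 - z.2) ^ 2)⁻¹ * ‖h z.1‖ ^ 2 ∂(μ.prod μ) ≤ Real.pi * N := by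
    rw [integral_prod _ (aux_integrable_cont2 T (by fun_prop)), hN, ← integral_const_mul]
    simp_rw [integral_mul_const]
    refine integral_mono_of_nonneg (Filter.Eventually.of_forall fun τ => ?_) (aux_integrable_cont T (by fun_prop)) (Filter.Eventually.of_forall fun τ => ?_)
    · exact mul_nonneg (integral_nonneg fun s => by positivity) (by positivity)
    · exact mul_le_mul_of_nonneg_right (hker τ) (by positivity)
  have e2 : ∫ z, (1 + (z.1 - z.2) ^ 2)⁻¹ * ‖h z.2‖ ^ 2 ∂(μ.prod μ) ≤ Real.pi * N := by
    rw [integral_prod_symm _ (aux_integrable_cont2 T (by fun_prop)), hN, ← integral_const_mul]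
    simp_rw [integral_mul_const]
    refine integral_mono_of_nonneg (Filter.Eventually.of_forall fun τ => ?_) (aux_integrable_cont T (by fun_prop)) (Filter.Eventually.of_forall fun τ => ?_)
    · exact mul_nonneg (integral_nonneg fun s => by positivity) (by positivity)
    · refine mul_le_mul_of_nonneg_right ?_ (by positivity)
      refine (le_of_eq ?_).trans (hker τ)
      congr 1; ext s; congr 2; ring
  have key : ∫ t : ℝ, Real.exp (-|t|) * ‖auxH h T t‖ ^ 2 ≤
      ∫ z, ((1 + (z.1 - z.2) ^ 2)⁻¹ * ‖h z.1‖ ^ 2 + (1 + (z.1 - z.2) ^ 2)⁻¹ * ‖h z.2‖ ^ 2) ∂(μ.prod μ) := by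
    rw [← abs_of_nonneg hnonneg, ← Real.norm_eq_abs, ← Complex.norm_real, hJ]
    refine norm_integral_le_of_norm_le (aux_integrable_cont2 T (by fun_prop)) (Filter.Eventually.of_forall fun z => ?_)
    rw [norm_mul, norm_mul, Complex.norm_real, Real.norm_of_nonneg (by positivity)]
    have h1 := norm_inner_le_norm (𝕜 := ℂ) (h z.1) (h z.2)
    have h2 : 2 * (‖h z.1‖ * ‖h z.2‖) ≤ ‖h z.1‖^2 + ‖h z.2‖^2 := by nlinarith [sq_nonneg (‖h z.1‖ - ‖h z.2‖)]
    have h3 : (0:ℝ) ≤ (1 + (z.1 - z.2) ^ 2)⁻¹ := by positivity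
    simp only [Complex.norm_ofNat]
    nlinarith [mul_le_mul_of_nonneg_left h1 h3, mul_le_mul_of_nonneg_left h2 h3]
  rw [integral_add (aux_integrable_cont2 T (by fun_prop)) (aux_integrable_cont2 T (by fun_prop))] at key
  linarith
end
section
variable {K : Type*} [NormedAddCommGroup K] [InnerProductSpace ℂ K] [CompleteSpace K]

lemma aux_L2 {h : ℝ → K} (hc : Continuous h) (l : ℝ → K →L[ℂ] ℂ) (hlc : ∀ k, Continuous fun t => l t k)
    (A ω : ℝ) (hl : ∀ t, 0 ≤ t → ‖l t‖ ≤ A * Real.exp (ω * t))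
    (hrep : ∀ τ : ℝ, ((‖h τ‖ ^ 2 : ℝ) : ℂ) =
      -∫ t in Set.Ioi (0:ℝ), Complex.exp (-(((ω:ℂ) + 1 + τ * Complex.I) * t)) * l t (h τ)) (T : ℝ) :
    ∫ τ in Set.Icc (-T) T, ‖h τ‖ ^ 2 ≤ 2 * Real.pi * A ^ 2 := by
  set N := ∫ τ in Set.Icc (-T) T, ‖h τ‖ ^ 2 with hN
  set μ := volume.restrict (Set.Icc (-T) T) with hμ
  have hN0 : 0 ≤ N := integral_nonneg fun t => by positivity
  have hexp : ∀ τ t : ℝ, ‖Complex.exp (-(((ω:ℂ) + 1 + τ * Complex.I) * t))‖ = Real.exp (-t) * Real.exp (-(ω * t)) := by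
    intro τ t
    rw [Complex.norm_exp, ← Real.exp_add]
    simp; ring
  have hexp2 : ∀ t : ℝ, Real.exp (-(ω * t)) * Real.exp (ω * t) = 1 := by
    intro t; rw [← Real.exp_add]; simp
  have hint : Integrable (Function.uncurry fun τ t : ℝ => Complex.exp (-(((ω:ℂ) + 1 + τ * Complex.I) * t)) * l t (h τ))
      (μ.prod (volume.restrict (Set.Ioi 0))) := by
    have hb : Integrable (fun p : ℝ × ℝ => (A * ‖h p.1‖) * Real.exp (-p.2)) (μ.prod (volume.restrict (Set.Ioi 0))) :=
      (aux_integrable_cont T (f := fun τ => A * ‖h τ‖) (by fun_prop)).mul_prod (integrableOn_exp_neg_Ioi 0)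
    refine hb.mono' ?_ ?_
    · refine StronglyMeasurable.aestronglyMeasurable ?_
      refine stronglyMeasurable_uncurry_of_continuous_of_stronglyMeasurable ?_ ?_
      · intro t; fun_prop
      · intro τ
        have := hlc (h τ)
        exact Continuous.stronglyMeasurable (by fun_prop)
    · rw [hμ, Measure.prod_restrict]
      refine ae_restrict_of_forall_mem (measurableSet_Icc.prod measurableSet_Ioi) (fun p hp => ?_)
      have ht : 0 ≤ p.2 := le_of_lt hp.2
      simp only [Function.uncurry_def, norm_mul, hexp]
      have h1 : ‖l p.2 (h p.1)‖ ≤ A * Real.exp (ω * p.2) * ‖h p.1‖ :=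
        (l p.2).le_of_opNorm_le (hl _ ht) _
      calc _ ≤ Real.exp (-p.2) * Real.exp (-(ω * p.2)) * (A * Real.exp (ω * p.2) * ‖h p.1‖) := by gcongr
        _ = (A * ‖h p.1‖ * Real.exp (-p.2)) * (Real.exp (-(ω * p.2)) * Real.exp (ω * p.2)) := by ring
        _ = _ := by rw [hexp2, mul_one]
  have hNe : (N : ℂ) = -∫ t in Set.Ioi (0:ℝ), Complex.exp (-(((ω:ℂ) + 1) * t)) * l t (auxH h T t) := by
    rw [hN, ← integral_complex_ofReal]
    simp_rw [hrep]
    rw [integral_neg, integral_integral_swap hint]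
    congr 2; ext t
    rw [auxH, ← ContinuousLinearMap.integral_comp_comm _ (aux_integrable_cont T (by fun_prop)), ← integral_const_mul]
    congr 1; ext τ
    rw [map_smul, smul_eq_mul, ← mul_assoc, ← Complex.exp_add]
    congr 2; ring
  have hHint : Integrable (fun t : ℝ => Real.exp (-|t|) * ‖auxH h T t‖ ^ 2) := by
    refine (aux_integrable_exp_neg_abs.mul_const ((∫ τ in Set.Icc (-T) T, ‖h τ‖) ^ 2)).mono' ?_ (Filter.Eventually.of_forall fun t => ?_)
    · have := auxH_cont hc T
      exact Continuous.aestronglyMeasurable (by fun_prop)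
    · rw [Real.norm_of_nonneg (by positivity)]
      gcongr
      exact auxH_bound h T t
  have hpl := aux_plancherel hc T
  have hi2 : IntegrableOn (fun t : ℝ => Real.exp (-t) * ‖auxH h T t‖ ^ 2) (Set.Ioi 0) :=
    hHint.integrableOn.congr_fun (fun t ht => by simp only [abs_of_pos (Set.mem_Ioi.1 ht)]) measurableSet_Ioi
  have hle2 : ∫ t in Set.Ioi (0:ℝ), Real.exp (-t) * ‖auxH h T t‖ ^ 2 ≤ 2 * Real.pi * N := by
    refine le_trans ?_ hpl
    rw [← setIntegral_congr_fun (f := fun t : ℝ => Real.exp (-|t|) * ‖auxH h T t‖ ^ 2) measurableSet_Ioi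
      (fun t ht => by simp only [abs_of_pos (Set.mem_Ioi.1 ht)])]
    exact setIntegral_le_integral hHint (Filter.Eventually.of_forall fun t => by positivity)
  have hfin : N ≤ ∫ t in Set.Ioi (0:ℝ), (Real.pi * A ^ 2 * Real.exp (-t) + (4 * Real.pi)⁻¹ * (Real.exp (-t) * ‖auxH h T t‖ ^ 2)) := by
    have : N = ‖(N:ℂ)‖ := by rw [Complex.norm_real, Real.norm_of_nonneg hN0]
    rw [this, hNe, norm_neg]
    refine norm_integral_le_of_norm_le (((integrableOn_exp_neg_Ioi 0).const_mul _).add (hi2.const_mul _)) ?_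
    refine ae_restrict_of_forall_mem measurableSet_Ioi (fun t ht => ?_)
    have h0 := hexp 0 t
    simp only [Complex.ofReal_zero, zero_mul, add_zero] at h0
    rw [norm_mul, h0]
    have h1 : ‖l t (auxH h T t)‖ ≤ A * Real.exp (ω * t) * ‖auxH h T t‖ :=
        (l t).le_of_opNorm_le (hl _ (le_of_lt ht)) _
    have h2 : A * ‖auxH h T t‖ ≤ Real.pi * A ^ 2 + (4 * Real.pi)⁻¹ * ‖auxH h T t‖ ^ 2 := by
      have hp := Real.pi_pos
      have : Real.pi * A ^ 2 + (4 * Real.pi)⁻¹ * ‖auxH h T t‖ ^ 2 - A * ‖auxH h T t‖ = (4 * Real.pi)⁻¹ * (2 * Real.pi * A - ‖auxH h T t‖)^2 := by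
        field_simp; ring
      have h5 : 0 ≤ (4 * Real.pi)⁻¹ * (2 * Real.pi * A - ‖auxH h T t‖)^2 := by positivity
      linarith
    calc _ ≤ Real.exp (-t) * Real.exp (-(ω * t)) * (A * Real.exp (ω * t) * ‖auxH h T t‖) := by gcongr
        _ = (Real.exp (-t) * (A * ‖auxH h T t‖)) * (Real.exp (-(ω * t)) * Real.exp (ω * t)) := by ring
        _ = Real.exp (-t) * (A * ‖auxH h T t‖) := by rw [hexp2, mul_one]
        _ ≤ Real.exp (-t) * (Real.pi * A ^ 2 + (4 * Real.pi)⁻¹ * ‖auxH h T t‖ ^ 2) := by gcongr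
        _ = _ := by ring
  rw [integral_add ((integrableOn_exp_neg_Ioi 0).const_mul _) (hi2.const_mul _), integral_const_mul, integral_const_mul, integral_exp_neg_Ioi_zero] at hfin
  have : (4 * Real.pi)⁻¹ * ∫ t in Set.Ioi (0:ℝ), Real.exp (-t) * ‖auxH h T t‖ ^ 2 ≤ (4 * Real.pi)⁻¹ * (2 * Real.pi * N) := by
    gcongr
  have e : (4 * Real.pi)⁻¹ * (2 * Real.pi * N) = N / 2 := by
    have hp := Real.pi_pos
    field_simp; ring
  linarith

/-- whole-line version -/
lemma aux_L2' {h : ℝ → K} (hc : Continuous h) {B : ℝ}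
    (hB : ∀ T : ℝ, ∫ τ in Set.Icc (-T) T, ‖h τ‖ ^ 2 ≤ B) :
    Integrable (fun τ => ‖h τ‖ ^ 2) ∧ ∫ τ, ‖h τ‖ ^ 2 ≤ B := by
  have ha : Filter.Tendsto (fun i : ℕ => -(i:ℝ)) Filter.atTop Filter.atBot :=
    Filter.tendsto_neg_atTop_atBot.comp tendsto_natCast_atTop_atTop
  have hb : Filter.Tendsto (fun i : ℕ => (i:ℝ)) Filter.atTop Filter.atTop := tendsto_natCast_atTop_atTop
  have he : ∀ i : ℕ, ∫ τ in (-(i:ℝ))..i, ‖h τ‖ ^ 2 ≤ B := by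
    intro i
    rw [intervalIntegral.integral_of_le (by simp : (-(i:ℝ)) ≤ i), ← integral_Icc_eq_integral_Ioc]
    exact hB i
  have hi : Integrable (fun τ => ‖h τ‖ ^ 2) := by
    refine integrable_of_intervalIntegral_norm_bounded (l := Filter.atTop) B (fun i : ℕ => ?_) ha hb (Filter.Eventually.of_forall fun i => ?_)
    · exact (Continuous.continuousOn (by fun_prop)).integrableOn_compact isCompact_Icc |>.mono_set Set.Ioc_subset_Icc_self
    · refine le_trans (le_of_eq ?_) (he i)
      congr 1; ext τ; simp
  exact ⟨hi, le_of_tendsto (intervalIntegral_tendsto_integral hi ha hb) (Filter.Eventually.of_forall he)⟩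
end
section
variable {K : Type*} [NormedAddCommGroup K] [InnerProductSpace ℂ K] [CompleteSpace K]

lemma aux_pow_exp_int (n : ℕ) {δ : ℝ} (hδ : 0 < δ) :
    IntegrableOn (fun t : ℝ => t ^ n * Real.exp (-(δ * t))) (Set.Ioi 0) := by
  have := integrableOn_rpow_mul_exp_neg_mul_rpow (p := 1) (s := n) (b := δ) (lt_of_lt_of_le (by norm_num) (Nat.cast_nonneg n)) one_pos hδ
  refine this.congr_fun (fun t ht => ?_) measurableSet_Ioi
  simp [Real.rpow_natCast]

lemma aux_laplace_int {E : Type*} [NormedAddCommGroup E] [NormedSpace ℂ E] {φ : ℝ → E} (hφ : ContinuousOn φ (Set.Ici 0)) {A ω : ℝ}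
    (hb : ∀ t, 0 ≤ t → ‖φ t‖ ≤ A * Real.exp (ω * t)) (n : ℕ) {l : ℂ} (hl : ω < l.re) :
    IntegrableOn (fun t : ℝ => (Complex.exp (-(l * t)) * (t:ℂ) ^ n) • φ t) (Set.Ioi 0) := by
  have h1 := (aux_pow_exp_int n (sub_pos.2 hl)).const_mul A
  refine Integrable.mono' h1 ?_ ?_
  · refine ContinuousOn.aestronglyMeasurable ?_ measurableSet_Ioi
    exact ContinuousOn.smul (by fun_prop) (hφ.mono Set.Ioi_subset_Ici_self)
  · refine ae_restrict_of_forall_mem measurableSet_Ioi (fun t ht => ?_)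
    have ht' : 0 ≤ t := le_of_lt ht
    rw [norm_smul, norm_mul, norm_pow, Complex.norm_real, Real.norm_of_nonneg ht', Complex.norm_exp]
    calc _ ≤ Real.exp (-(l * t)).re * t ^ n * (A * Real.exp (ω * t)) := by gcongr; exact hb t ht'
      _ = A * (t ^ n * (Real.exp (-(l * t)).re * Real.exp (ω * t))) := by ring
      _ = _ := by rw [← Real.exp_add]; congr 3; simp; ring

lemma aux_laplace_deriv {φ : ℝ → ℂ} (hφ : ContinuousOn φ (Set.Ici 0)) {A ω : ℝ}
    (hb : ∀ t, 0 ≤ t → ‖φ t‖ ≤ A * Real.exp (ω * t)) (n : ℕ) {l : ℂ} (hl : ω < l.re) :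
    HasDerivAt (fun l : ℂ => ∫ t in Set.Ioi (0:ℝ), (Complex.exp (-(l * t)) * (t:ℂ) ^ n) • φ t)
      (-∫ t in Set.Ioi (0:ℝ), (Complex.exp (-(l * t)) * (t:ℂ) ^ (n+1)) • φ t) l := by
  set δ := (l.re - ω) / 2 with hδ
  have hδ0 : 0 < δ := by rw [hδ]; linarith
  have hs : {z : ℂ | ω + δ < z.re} ∈ nhds l := by
    refine (isOpen_lt continuous_const Complex.continuous_re).mem_nhds ?_
    simp only [Set.mem_ofPred_eq]; linarith
  have hA : 0 ≤ A := by
    have := (norm_nonneg _).trans (hb 0 le_rfl); simpa using this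
  rw [← integral_neg]
  refine (hasDerivAt_integral_of_dominated_loc_of_deriv_le (F := fun (l : ℂ) (t : ℝ) => (Complex.exp (-(l * t)) * (t:ℂ) ^ n) • φ t)
    (F' := fun (l : ℂ) (t : ℝ) => -((Complex.exp (-(l * t)) * (t:ℂ) ^ (n+1)) • φ t))
    (bound := fun t => A * (t ^ (n+1) * Real.exp (-(δ * t)))) hs ?_ ?_ ?_ ?_ ?_ ?_).2
  · refine Filter.Eventually.of_forall fun z => ?_
    refine ContinuousOn.aestronglyMeasurable ?_ measurableSet_Ioi
    exact ContinuousOn.smul (f := fun t : ℝ => Complex.exp (-(z * t)) * (t:ℂ) ^ n) (by fun_prop) (hφ.mono Set.Ioi_subset_Ici_self)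
  · exact aux_laplace_int hφ hb n hl
  · exact (aux_laplace_int hφ hb (n+1) hl).aestronglyMeasurable.neg
  · refine ae_restrict_of_forall_mem measurableSet_Ioi (fun t ht z hz => ?_)
    have ht' : 0 ≤ t := le_of_lt ht
    simp only [Set.mem_ofPred_eq] at hz
    rw [norm_neg, norm_smul, norm_mul, norm_pow, Complex.norm_real, Real.norm_of_nonneg ht', Complex.norm_exp]
    calc _ ≤ Real.exp (-(z * t)).re * t ^ (n+1) * (A * Real.exp (ω * t)) := by gcongr; exact hb t ht'
      _ = A * (t ^ (n+1) * (Real.exp (-(z * t)).re * Real.exp (ω * t))) := by ring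
      _ ≤ _ := by
        rw [← Real.exp_add]; gcongr
        simp; nlinarith
  · exact (aux_pow_exp_int (n+1) hδ0).const_mul A
  · refine ae_restrict_of_forall_mem measurableSet_Ioi (fun t ht z hz => ?_)
    have h1 : HasDerivAt (fun z : ℂ => Complex.exp (-(z * t))) (Complex.exp (-(z * t)) * (-(1 * t))) z :=
      (((hasDerivAt_id z).mul_const (t:ℂ)).neg).cexp
    have h2 := (h1.mul_const ((t:ℂ)^n)).mul_const (φ t)
    simp only [smul_eq_mul]
    have e : -(Complex.exp (-(z * t)) * (t:ℂ) ^ (n+1) * φ t) = Complex.exp (-(z * t)) * (-(1 * t)) * (t:ℂ) ^ n * φ t := by ring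
    rw [e]
    exact h2

variable {U : Set ℂ} {R : ℂ → K →L[ℂ] K}

lemma aux_R_deriv (hUopen : IsOpen U) (hRholo : DifferentiableOn ℂ R U)
    (hRres : ∀ l μ : ℂ, l ∈ U → μ ∈ U → R l - R μ = (l - μ) • ((R l).comp (R μ)))
    {l : ℂ} (hl : l ∈ U) : HasDerivAt R (R l * R l) l := by
  rw [hasDerivAt_iff_tendsto_slope]
  have hc : ContinuousAt R l := (hRholo.differentiableAt (hUopen.mem_nhds hl)).continuousAt
  have h1 : Filter.Tendsto (fun z => R z * R l) (nhdsWithin l {l}ᶜ) (nhds (R l * R l)) :=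
    (hc.mul continuousAt_const).tendsto.mono_left nhdsWithin_le_nhds
  refine h1.congr' ?_
  have : ∀ᶠ z in nhdsWithin l {l}ᶜ, z ∈ U := nhdsWithin_le_nhds (hUopen.mem_nhds hl)
  filter_upwards [this, self_mem_nhdsWithin] with z hz hne
  have hne' : z - l ≠ 0 := sub_ne_zero.2 hne
  rw [slope_def_module, hRres z l hz hl, smul_smul, inv_mul_cancel₀ hne', one_smul]
  rfl

lemma aux_Rpow_deriv (hUopen : IsOpen U) (hRholo : DifferentiableOn ℂ R U)
    (hRres : ∀ l μ : ℂ, l ∈ U → μ ∈ U → R l - R μ = (l - μ) • ((R l).comp (R μ)))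
    {l : ℂ} (hl : l ∈ U) (n : ℕ) : HasDerivAt (fun z => R z ^ n) ((n:ℂ) • R l ^ (n+1)) l := by
  induction n with
  | zero => simpa using hasDerivAt_const l (1 : K →L[ℂ] K)
  | succ n ih =>
    have := ih.mul (aux_R_deriv hUopen hRholo hRres hl)
    have e : (((n+1 : ℕ)):ℂ) • R l ^ (n+1+1) = (n:ℂ) • R l ^ (n+1) * R l + R l ^ n * (R l * R l) := by
      push_cast
      rw [add_smul, one_smul]
      simp only [pow_succ, smul_mul_assoc, mul_assoc]
    rw [e]
    simp only [pow_succ _ n]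
    exact this

lemma aux_g_deriv (hUopen : IsOpen U) (hRholo : DifferentiableOn ℂ R U)
    (hRres : ∀ l μ : ℂ, l ∈ U → μ ∈ U → R l - R μ = (l - μ) • ((R l).comp (R μ)))
    {l : ℂ} (hl : l ∈ U) (u v : K) (n : ℕ) :
    HasDerivAt (fun z => inner ℂ v ((R z ^ n) u)) ((n:ℂ) * inner ℂ v ((R l ^ (n+1)) u)) l := by
  have h1 := aux_Rpow_deriv hUopen hRholo hRres hl n
  let L : (K →L[ℂ] K) →L[ℂ] ℂ := (innerSL ℂ v).comp (ContinuousLinearMap.apply ℂ K u)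
  have h2 := L.hasFDerivAt.comp_hasDerivAt l h1
  have h3 : L ((n:ℂ) • R l ^ (n+1)) = (n:ℂ) * inner ℂ v ((R l ^ (n+1)) u) := by
    simp [L]
  rw [h3] at h2
  exact h2

lemma aux_laplace_pow {S : ℝ → K →L[ℂ] K}
    (hScont : ∀ x : K, ContinuousOn (fun t => S t x) (Set.Ici 0))
    {M ω : ℝ} (hω : 0 ≤ ω)
    (hSbound : ∀ t : ℝ, 0 ≤ t → ‖S t‖ ≤ M * Real.exp (ω * t))
    (hUopen : IsOpen U) (hRholo : DifferentiableOn ℂ R U)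
    (hRres : ∀ l μ : ℂ, l ∈ U → μ ∈ U → R l - R μ = (l - μ) • ((R l).comp (R μ)))
    (hUsub : ∀ l : ℂ, 0 < l.re → l ∈ U)
    (hRlaplace : ∀ l : ℂ, ω < l.re → ∀ x : K,
      R l x = -∫ t in Set.Ioi (0 : ℝ), Complex.exp (-(l * t)) • S t x) (u v : K) (n : ℕ) :
    ∀ l : ℂ, ω < l.re → (n.factorial : ℂ) * inner ℂ v ((R l ^ (n+1)) u) =
      (-1)^(n+1) * ∫ t in Set.Ioi (0:ℝ), (Complex.exp (-(l * t)) * (t:ℂ) ^ n) • inner ℂ v (S t u) := by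
  have hSu : ∀ x : K, ∀ t, 0 ≤ t → ‖S t x‖ ≤ (M * ‖x‖) * Real.exp (ω * t) := fun x t ht => by
    have := (S t).le_of_opNorm_le (hSbound t ht) x
    linarith
  have hφ : ContinuousOn (fun t => inner ℂ v (S t u)) (Set.Ici 0) := by
    have := hScont u
    fun_prop
  have hb : ∀ t, 0 ≤ t → ‖inner ℂ v (S t u)‖ ≤ (‖v‖ * (M * ‖u‖)) * Real.exp (ω * t) := fun t ht => by
    refine (norm_inner_le_norm _ _).trans ?_
    rw [mul_assoc]
    gcongr
    exact hSu u t ht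
  induction n with
  | zero =>
    intro l hl
    have hi : IntegrableOn (fun t : ℝ => Complex.exp (-(l * t)) • S t u) (Set.Ioi 0) := by
      simpa using aux_laplace_int (hScont u) (hSu u) 0 hl
    simp only [Nat.factorial_zero, Nat.cast_one, one_mul, zero_add, pow_one, pow_zero, mul_one]
    rw [hRlaplace l hl, inner_neg_right, ← integral_inner hi]
    simp [inner_smul_right]
  | succ n ih =>
    intro l hl
    have hlU := hUsub l (by linarith)
    have h1 := (aux_g_deriv hUopen hRholo hRres hlU u v (n+1)).const_mul (n.factorial : ℂ)
    have h2 := (aux_laplace_deriv hφ hb n hl).const_mul ((-1 : ℂ)^(n+1))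
    have h3 := h2.congr_of_eventuallyEq (f₁ := fun l => (n.factorial : ℂ) * inner ℂ v ((R l ^ (n+1)) u)) (by
      filter_upwards [(isOpen_lt continuous_const Complex.continuous_re).mem_nhds hl] with z hz
      exact ih z hz)
    have h4 := h1.unique h3
    rw [Nat.factorial_succ]
    rw [pow_succ (-1 : ℂ) (n+1)]
    push_cast at h4 ⊢
    linear_combination h4
end
section
variable {K : Type*} [NormedAddCommGroup K] [InnerProductSpace ℂ K] [CompleteSpace K]
variable {U : Set ℂ} {R : ℂ → K →L[ℂ] K}

lemma aux_line_cont (hRholo : DifferentiableOn ℂ R U)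
    (hUsub : ∀ l : ℂ, 0 < l.re → l ∈ U) {σ : ℝ} (hσ : 0 < σ) :
    Continuous (fun τ : ℝ => R ((σ:ℂ) + τ * Complex.I)) := by
  refine hRholo.continuousOn.comp_continuous (by fun_prop) (fun τ => hUsub _ ?_)
  simpa using hσ

lemma aux_sq_int {S : ℝ → K →L[ℂ] K}
    (hScont : ∀ x : K, ContinuousOn (fun t => S t x) (Set.Ici 0))
    {M ω : ℝ} (hω : 0 ≤ ω)
    (hSbound : ∀ t : ℝ, 0 ≤ t → ‖S t‖ ≤ M * Real.exp (ω * t))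
    (hRholo : DifferentiableOn ℂ R U)
    (hUsub : ∀ l : ℂ, 0 < l.re → l ∈ U)
    (hRlaplace : ∀ l : ℂ, ω < l.re → ∀ x : K,
      R l x = -∫ t in Set.Ioi (0 : ℝ), Complex.exp (-(l * t)) • S t x) (u : K) :
    Integrable (fun τ : ℝ => ‖R (((ω + 1 : ℝ):ℂ) + τ * Complex.I) u‖ ^ 2) ∧
      ∫ τ : ℝ, ‖R (((ω + 1 : ℝ):ℂ) + τ * Complex.I) u‖ ^ 2 ≤ 2 * Real.pi * (M * ‖u‖) ^ 2 := by
  have hSu : ∀ x : K, ∀ t, 0 ≤ t → ‖S t x‖ ≤ (M * ‖x‖) * Real.exp (ω * t) := fun x t ht => by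
    have := (S t).le_of_opNorm_le (hSbound t ht) x
    linarith
  have hc := aux_line_cont hRholo hUsub (by linarith : 0 < ω + 1)
  have hc' : Continuous (fun τ : ℝ => R (((ω + 1 : ℝ):ℂ) + (-τ : ℝ) * Complex.I) u) :=
    (hc.comp continuous_neg).clm_apply continuous_const
  have hS' : Continuous fun t => S (max t 0) u :=
    (hScont u).comp_continuous (by fun_prop) (fun t => Set.mem_Ici.2 (le_max_right _ _))
  have key : ∀ T : ℝ, ∫ τ in Set.Icc (-T) T, ‖R (((ω + 1 : ℝ):ℂ) + (-τ : ℝ) * Complex.I) u‖ ^ 2 ≤ 2 * Real.pi * (M * ‖u‖) ^ 2 := by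
    intro T
    refine aux_L2 hc' (fun t => innerSL ℂ (S (max t 0) u)) ?_ (M * ‖u‖) ω ?_ ?_ T
    · intro k; simp only [innerSL_apply_apply]; exact hS'.inner continuous_const
    · intro t ht
      rw [innerSL_apply_norm, max_eq_left ht]; exact hSu u t ht
    · intro τ
      set l : ℂ := ((ω + 1 : ℝ):ℂ) + (-τ : ℝ) * Complex.I with hl
      have hlr : ω < l.re := by simp [hl]
      have hi : IntegrableOn (fun t : ℝ => Complex.exp (-(l * t)) • S t u) (Set.Ioi 0) := by
        simpa using aux_laplace_int (hScont u) (hSu u) 0 hlr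
      have h1 : ((‖R l u‖ ^ 2 : ℝ) : ℂ) = inner ℂ (R l u) (R l u) := by
        rw [inner_self_eq_norm_sq_to_K]; simp
      rw [h1]
      nth_rw 1 [hRlaplace l hlr u]
      rw [inner_neg_left, ← inner_conj_symm, ← integral_inner hi, ← integral_conj]
      congr 1
      refine setIntegral_congr_fun measurableSet_Ioi (fun t ht => ?_)
      simp only [inner_conj_symm, inner_smul_left, innerSL_apply_apply, max_eq_left (le_of_lt (Set.mem_Ioi.1 ht)), ← Complex.exp_conj]
      congr 2
      simp [hl]
  obtain ⟨k1, k2⟩ := aux_L2' hc' key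
  constructor
  · simpa using k1.comp_neg
  · rw [← integral_neg_eq_self]; exact k2

lemma aux_sq_int_adj {S : ℝ → K →L[ℂ] K}
    (hScont : ∀ x : K, ContinuousOn (fun t => S t x) (Set.Ici 0))
    {M ω : ℝ} (hω : 0 ≤ ω)
    (hSbound : ∀ t : ℝ, 0 ≤ t → ‖S t‖ ≤ M * Real.exp (ω * t))
    (hRholo : DifferentiableOn ℂ R U)
    (hUsub : ∀ l : ℂ, 0 < l.re → l ∈ U)
    (hRlaplace : ∀ l : ℂ, ω < l.re → ∀ x : K,
      R l x = -∫ t in Set.Ioi (0 : ℝ), Complex.exp (-(l * t)) • S t x) (v : K) :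
    Integrable (fun τ : ℝ => ‖ContinuousLinearMap.adjoint (R (((ω + 1 : ℝ):ℂ) + τ * Complex.I)) v‖ ^ 2) ∧
      ∫ τ : ℝ, ‖ContinuousLinearMap.adjoint (R (((ω + 1 : ℝ):ℂ) + τ * Complex.I)) v‖ ^ 2 ≤ 2 * Real.pi * (M * ‖v‖) ^ 2 := by
  have hSu : ∀ x : K, ∀ t, 0 ≤ t → ‖S t x‖ ≤ (M * ‖x‖) * Real.exp (ω * t) := fun x t ht => by
    have := (S t).le_of_opNorm_le (hSbound t ht) x
    linarith
  have hc := aux_line_cont hRholo hUsub (by linarith : 0 < ω + 1)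
  have hc' : Continuous (fun τ : ℝ => ContinuousLinearMap.adjoint (R (((ω + 1 : ℝ):ℂ) + τ * Complex.I)) v) :=
    (ContinuousLinearMap.adjoint.continuous.comp hc).clm_apply continuous_const
  have hS' : ∀ u, Continuous fun t => S (max t 0) u := fun u =>
    (hScont u).comp_continuous (by fun_prop) (fun t => Set.mem_Ici.2 (le_max_right _ _))
  refine aux_L2' hc' fun T => ?_
  refine aux_L2 hc' (fun t => (innerSL ℂ v).comp (S (max t 0))) ?_ (M * ‖v‖) ω ?_ ?_ T
  · intro k
    have := hS' k
    simp only [ContinuousLinearMap.comp_apply, innerSL_apply_apply]; exact continuous_const.inner this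
  · intro t ht
    refine (ContinuousLinearMap.opNorm_comp_le _ _).trans ?_
    rw [innerSL_apply_norm, max_eq_left ht]
    have := mul_le_mul_of_nonneg_left (hSbound t ht) (norm_nonneg v)
    linarith
  · intro τ
    set l : ℂ := ((ω + 1 : ℝ):ℂ) + τ * Complex.I with hl
    have hlr : ω < l.re := by simp [hl]
    set k := ContinuousLinearMap.adjoint (R l) v with hk
    have hi : IntegrableOn (fun t : ℝ => Complex.exp (-(l * t)) • S t k) (Set.Ioi 0) := by
      simpa using aux_laplace_int (hScont k) (hSu k) 0 hlr
    have h1 : ((‖k‖ ^ 2 : ℝ) : ℂ) = inner ℂ v (R l k) := by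
      rw [← ContinuousLinearMap.adjoint_inner_left, ← hk, inner_self_eq_norm_sq_to_K]; simp
    rw [h1, hRlaplace l hlr k, inner_neg_right, ← integral_inner hi]
    congr 1
    refine setIntegral_congr_fun measurableSet_Ioi (fun t ht => ?_)
    simp only [inner_smul_right, ContinuousLinearMap.comp_apply, innerSL_apply_apply, max_eq_left (le_of_lt (Set.mem_Ioi.1 ht))]
    congr 2
    simp [hl]

lemma aux_RL {S : ℝ → K →L[ℂ] K}
    {ω : ℝ}
    (hRlaplace : ∀ l : ℂ, ω < l.re → ∀ x : K,
      R l x = -∫ t in Set.Ioi (0 : ℝ), Complex.exp (-(l * t)) • S t x) (u : K) :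
    Filter.Tendsto (fun τ : ℝ => ‖R (((ω + 1 : ℝ):ℂ) + τ * Complex.I) u‖) (Filter.cocompact ℝ) (nhds 0) := by
  rw [← tendsto_zero_iff_norm_tendsto_zero]
  have h1 := Real.zero_at_infty_fourier ((Set.Ioi (0:ℝ)).indicator fun t : ℝ => Complex.exp (-((ω + 1 : ℝ) * t)) • S t u)
  have h2 : Filter.Tendsto (fun τ : ℝ => τ * (2 * Real.pi)⁻¹) (Filter.cocompact ℝ) (Filter.cocompact ℝ) :=
    (Homeomorph.mulRight₀ ((2 * Real.pi)⁻¹) (by positivity)).isClosedEmbedding.tendsto_cocompact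
  have h3 := (h1.comp h2).neg
  rw [neg_zero] at h3
  refine h3.congr fun τ => ?_
  rw [hRlaplace _ (by simp), Function.comp_apply, Real.fourier_eq']
  congr 1
  rw [← integral_indicator measurableSet_Ioi]
  congr 1; ext t
  by_cases ht : t ∈ Set.Ioi (0:ℝ)
  · rw [Set.indicator_of_mem ht, Set.indicator_of_mem ht, smul_smul, ← Complex.exp_add]
    congr 2
    have hp : (Real.pi : ℂ) ≠ 0 := by exact_mod_cast Real.pi_ne_zero
    simp
    field_simp
    ring
  · simp [Set.indicator_of_notMem ht]

lemma aux_high_bound {n : ℕ} (hn : 1 ≤ n) {C₁ D : ℝ} (hC₁ : 0 ≤ C₁)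
    (hRres : ∀ l μ : ℂ, l ∈ U → μ ∈ U → R l - R μ = (l - μ) • ((R l).comp (R μ)))
    {l μ : ℂ} (hl : l ∈ U) (hμ : μ ∈ U) (hR : ‖R l‖ ≤ C₁) (hlμ : ‖l - μ‖ ≤ D) (u v : K) :
    ‖inner ℂ v ((R l ^ (n+1)) u)‖ ≤ (1 + D * C₁) ^ 2 * C₁ ^ (n - 1) *
      (‖ContinuousLinearMap.adjoint (R μ) v‖ * ‖R μ u‖) := by
  obtain ⟨k, rfl⟩ : ∃ k, n = k + 1 := ⟨n - 1, by omega⟩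
  have hD : 0 ≤ D := (norm_nonneg _).trans hlμ
  have hu : ‖R l u‖ ≤ (1 + D * C₁) * ‖R μ u‖ := by
    have h := congrArg (fun L : K →L[ℂ] K => L u) (hRres l μ hl hμ)
    simp only [sub_apply, smul_apply, ContinuousLinearMap.comp_apply] at h
    have h2 : R l u = R μ u + (l - μ) • R l (R μ u) := by rw [← h]; abel
    rw [h2]
    refine (norm_add_le _ _).trans ?_
    rw [norm_smul]
    have h3 := (R l).le_of_opNorm_le hR (R μ u)
    have h4 := mul_le_mul hlμ h3 (norm_nonneg _) hD
    linarith
  have hv : ∀ w, ‖inner ℂ v (R l w)‖ ≤ ‖ContinuousLinearMap.adjoint (R μ) v‖ * ((1 + D * C₁) * ‖w‖) := by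
    intro w
    have h := congrArg (fun L : K →L[ℂ] K => L w) (hRres μ l hμ hl)
    simp only [sub_apply, smul_apply, ContinuousLinearMap.comp_apply] at h
    have h2 : R l w = R μ (w + (l - μ) • R l w) := by
      rw [map_add, map_smul, ← neg_sub μ l, neg_smul, ← h]; abel
    rw [h2, ← ContinuousLinearMap.adjoint_inner_left]
    refine (norm_inner_le_norm _ _).trans ?_
    gcongr
    refine (norm_add_le _ _).trans ?_
    rw [norm_smul]
    have h3 := (R l).le_of_opNorm_le hR w
    have h4 := mul_le_mul hlμ h3 (norm_nonneg _) hD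
    linarith
  have e : (R l ^ (k + 1 + 1)) u = R l ((R l ^ k) (R l u)) := by
    rw [pow_succ, pow_succ']; rfl
  rw [e]
  have hk : ‖(R l ^ k) (R l u)‖ ≤ C₁ ^ k * ((1 + D * C₁) * ‖R μ u‖) := by
    have h1 : ‖R l ^ k‖ ≤ C₁ ^ k := by
      rcases Nat.eq_zero_or_pos k with rfl | hk
      · rw [pow_zero, pow_zero]; exact ContinuousLinearMap.norm_id_le (𝕜 := ℂ) (E := K)
      · exact (norm_pow_le' _ hk).trans (by gcongr)
    refine ((R l ^ k).le_of_opNorm_le h1 _).trans ?_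
    gcongr
  refine (hv _).trans ?_
  calc _ ≤ ‖ContinuousLinearMap.adjoint (R μ) v‖ * ((1 + D * C₁) * (C₁ ^ k * ((1 + D * C₁) * ‖R μ u‖))) := by gcongr
    _ = _ := by simp; ring
end
section

lemma aux_line_integrable {g : ℂ → ℂ} (hg : DifferentiableOn ℂ g {z : ℂ | 0 < z.re}) {W : ℝ → ℝ} (hW : Integrable W)
    {a σ : ℝ} (hσ : 0 < σ)
    (hgW : ∀ τ : ℝ, a < |τ| → ‖g ((σ:ℂ) + τ * Complex.I)‖ ≤ W τ) :
    Integrable (fun τ : ℝ => g ((σ:ℂ) + τ * Complex.I)) := by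
  have hc : Continuous (fun τ : ℝ => g ((σ:ℂ) + τ * Complex.I)) :=
    hg.continuousOn.comp_continuous (by fun_prop) (fun τ => by simpa using hσ)
  rw [← integrableOn_univ, ← Set.union_compl_self (Set.Icc (-a) a)]
  refine IntegrableOn.union (hc.continuousOn.integrableOn_compact isCompact_Icc) ?_
  refine Integrable.mono' hW.integrableOn hc.aestronglyMeasurable ?_
  refine ae_restrict_of_forall_mem measurableSet_Icc.compl (fun τ hτ => hgW τ ?_)
  rw [Set.mem_compl_iff, Set.mem_Icc, ← abs_le] at hτ
  exact not_le.1 hτ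

lemma aux_shift {g : ℂ → ℂ} (hg : DifferentiableOn ℂ g {z : ℂ | 0 < z.re}) {W : ℝ → ℝ} (hW : Integrable W)
    (hW0 : Filter.Tendsto W (Filter.cocompact ℝ) (nhds 0)) {a σ₁ : ℝ}
    (hgW : ∀ σ τ : ℝ, 0 < σ → σ ≤ σ₁ → a < |τ| → ‖g ((σ:ℂ) + τ * Complex.I)‖ ≤ W τ)
    {σ t : ℝ} (hσ : 0 < σ) (hσ1 : σ ≤ σ₁) (ht : 0 ≤ t) :
    ∫ τ : ℝ, Complex.exp (((σ:ℂ) + τ * Complex.I) * t) * g ((σ:ℂ) + τ * Complex.I) =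
    ∫ τ : ℝ, Complex.exp (((σ₁:ℂ) + τ * Complex.I) * t) * g ((σ₁:ℂ) + τ * Complex.I) := by
  set G : ℂ → ℂ := fun z => Complex.exp (z * t) * g z with hG
  have hGd : DifferentiableOn ℂ G {z : ℂ | 0 < z.re} := by
    refine DifferentiableOn.mul ?_ hg
    fun_prop
  have hGb : ∀ s τ : ℝ, 0 < s → s ≤ σ₁ → a < |τ| → ‖G ((s:ℂ) + τ * Complex.I)‖ ≤ Real.exp (σ₁ * t) * W τ := by
    intro s τ hs hs1 hτ
    rw [hG]
    simp only [norm_mul, Complex.norm_exp]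
    have := hgW s τ hs hs1 hτ
    have h2 : ((((s:ℂ) + τ * Complex.I) * t)).re ≤ σ₁ * t := by
      simp; nlinarith
    gcongr
  have hi : ∀ s : ℝ, 0 < s → s ≤ σ₁ → Integrable (fun τ : ℝ => G ((s:ℂ) + τ * Complex.I)) := fun s hs hs1 =>
    aux_line_integrable hGd (hW.const_mul (Real.exp (σ₁ * t))) hs (fun τ hτ => hGb s τ hs hs1 hτ)
  have ha : Filter.Tendsto (fun T : ℝ => -T) Filter.atTop Filter.atBot := Filter.tendsto_neg_atTop_atBot
  have hlim : ∀ s : ℝ, 0 < s → s ≤ σ₁ → Filter.Tendsto (fun T : ℝ => ∫ τ in (-T)..T, G ((s:ℂ) + τ * Complex.I)) Filter.atTop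
      (nhds (∫ τ : ℝ, G ((s:ℂ) + τ * Complex.I))) := fun s hs hs1 =>
    intervalIntegral_tendsto_integral (hi s hs hs1) ha Filter.tendsto_id
  have hσ₁ : 0 < σ₁ := hσ.trans_le hσ1
  have hd := (hlim σ hσ hσ1).sub (hlim σ₁ hσ₁ le_rfl)
  have hhor : ∀ T : ℝ, a < |T| → ‖∫ x in σ..σ₁, G ((x:ℂ) + T * Complex.I)‖ ≤ (Real.exp (σ₁ * t) * W T) * |σ₁ - σ| := by
    intro T hT
    refine intervalIntegral.norm_integral_le_of_norm_le_const fun x hx => ?_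
    rw [Set.uIoc_of_le hσ1] at hx
    exact hGb x T (hσ.trans hx.1) hx.2 hT
  have hW1 : Filter.Tendsto W Filter.atTop (nhds 0) := hW0.mono_left atTop_le_cocompact
  have hW2 : Filter.Tendsto (fun T => W (-T)) Filter.atTop (nhds 0) :=
    (hW0.mono_left atBot_le_cocompact).comp ha
  have hz : Filter.Tendsto (fun T : ℝ => (∫ τ in (-T)..T, G ((σ:ℂ) + τ * Complex.I)) - ∫ τ in (-T)..T, G ((σ₁:ℂ) + τ * Complex.I))
      Filter.atTop (nhds 0) := by
    have hb : Filter.Tendsto (fun T : ℝ => (Real.exp (σ₁ * t) * W (-T)) * |σ₁ - σ| + (Real.exp (σ₁ * t) * W T) * |σ₁ - σ|) Filter.atTop (nhds 0) := by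
      have := ((hW2.const_mul (Real.exp (σ₁ * t))).mul_const (|σ₁ - σ|)).add ((hW1.const_mul (Real.exp (σ₁ * t))).mul_const (|σ₁ - σ|))
      simpa using this
    refine squeeze_zero_norm' ?_ hb
    filter_upwards [Filter.eventually_gt_atTop a, Filter.eventually_ge_atTop 0] with T hT hT0
    have hrect := Complex.integral_boundary_rect_eq_zero_of_differentiableOn G ⟨σ, -T⟩ ⟨σ₁, T⟩ (hGd.mono (by
      intro z hz
      have := hz.1
      simp only [Set.mem_preimage] at this
      rw [Set.uIcc_of_le hσ1] at this
      exact hσ.trans_le this.1))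
    simp only [smul_eq_mul] at hrect
    set V := ∫ τ in (-T)..T, G ((σ:ℂ) + τ * Complex.I)
    set V1 := ∫ τ in (-T)..T, G ((σ₁:ℂ) + τ * Complex.I)
    have e : Complex.I * (V - V1) = (∫ x in σ..σ₁, G ((x:ℂ) + (-T : ℝ) * Complex.I)) - ∫ x in σ..σ₁, G ((x:ℂ) + (T:ℝ) * Complex.I) := by
      linear_combination -hrect
    have e2 : ‖V - V1‖ = ‖Complex.I * (V - V1)‖ := by simp
    rw [e2, e]
    refine (norm_sub_le _ _).trans (add_le_add (hhor (-T) ?_) (hhor T ?_))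
    · rw [abs_neg, abs_of_nonneg hT0]; exact hT
    · rw [abs_of_nonneg hT0]; exact hT
  exact sub_eq_zero.1 (tendsto_nhds_unique hd hz)

lemma aux_inversion {φ : ℝ → ℂ} (hφ : ContinuousOn φ (Set.Ici 0)) {A ω : ℝ}
    (hb : ∀ t, 0 ≤ t → ‖φ t‖ ≤ A * Real.exp (ω * t)) (n : ℕ) {σ : ℝ} (hσ : ω < σ)
    {G : ℂ → ℂ} (hG : ∀ l : ℂ, ω < l.re → G l = ∫ t in Set.Ioi (0:ℝ), (Complex.exp (-(l * t)) * (t:ℂ) ^ n) • φ t)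
    (hGi : Integrable fun τ : ℝ => G ((σ:ℂ) + τ * Complex.I)) {t : ℝ} (ht : 0 < t) :
    ∫ τ : ℝ, Complex.exp (((σ:ℂ) + τ * Complex.I) * t) * G ((σ:ℂ) + τ * Complex.I) =
      2 * Real.pi * ((t:ℂ) ^ n * φ t) := by
  set f : ℝ → ℂ := (Set.Ioi (0:ℝ)).indicator fun t : ℝ => (Complex.exp (-((σ:ℂ) * t)) * (t:ℂ) ^ n) • φ t with hf
  have hfi : Integrable f := (aux_laplace_int hφ hb n (l := (σ:ℂ)) (by simpa using hσ)).integrable_indicator measurableSet_Ioi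
  have hF : ∀ ξ : ℝ, FourierTransform.fourier f ξ = G ((σ:ℂ) + ((2 * Real.pi * ξ : ℝ):ℂ) * Complex.I) := by
    intro ξ
    rw [Real.fourier_eq', hG _ (by simpa using hσ), ← integral_indicator measurableSet_Ioi]
    congr 1; ext s
    by_cases hs : s ∈ Set.Ioi (0:ℝ)
    · rw [hf, Set.indicator_of_mem hs, Set.indicator_of_mem hs, smul_smul, ← mul_assoc, ← Complex.exp_add]
      congr 3
      simp
      ring
    · simp [hf, Set.indicator_of_notMem hs]
  have hFi : Integrable (FourierTransform.fourier f) := by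
    have h1 : FourierTransform.fourier f = fun ξ : ℝ => G ((σ:ℂ) + ((2 * Real.pi * ξ : ℝ):ℂ) * Complex.I) := funext hF
    rw [h1]
    exact hGi.comp_mul_left' (R := 2 * Real.pi) (by positivity)
  have hfc : ContinuousAt f t := by
    have h1 : ContinuousAt (fun t : ℝ => (Complex.exp (-((σ:ℂ) * t)) * (t:ℂ) ^ n) • φ t) t := by
      have h2 : ContinuousAt φ t := hφ.continuousAt (Ici_mem_nhds ht)
      exact ContinuousAt.smul (f := fun t : ℝ => Complex.exp (-((σ:ℂ) * t)) * (t:ℂ) ^ n) (by fun_prop) h2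
    refine h1.congr ?_
    filter_upwards [Ioi_mem_nhds ht] with s hs
    rw [hf, Set.indicator_of_mem hs]
  have hinv := hfi.fourierInv_fourier_eq hFi hfc
  rw [Real.fourierInv_eq'] at hinv
  have h3 := Measure.integral_comp_mul_left (fun τ : ℝ => Complex.exp ((τ * t : ℂ) * Complex.I) * G ((σ:ℂ) + τ * Complex.I)) (2 * Real.pi)
  have h4 : ∫ ξ : ℝ, Complex.exp (((2 * Real.pi * inner ℝ ξ t : ℝ):ℂ) * Complex.I) • FourierTransform.fourier f ξ
      = ∫ x : ℝ, Complex.exp ((((2 * Real.pi * x : ℝ):ℂ) * t : ℂ) * Complex.I) * G ((σ:ℂ) + ((2 * Real.pi * x : ℝ):ℂ) * Complex.I) := by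
    congr 1; ext ξ
    rw [hF, smul_eq_mul]
    congr 3
    simp
    ring
  rw [h4, h3, hf, Set.indicator_of_mem (Set.mem_Ioi.2 ht), smul_eq_mul] at hinv
  have h5 : ∫ τ : ℝ, Complex.exp (((σ:ℂ) + τ * Complex.I) * t) * G ((σ:ℂ) + τ * Complex.I)
      = Complex.exp ((σ:ℂ) * t) * ∫ τ : ℝ, Complex.exp ((τ * t : ℂ) * Complex.I) * G ((σ:ℂ) + τ * Complex.I) := by
    rw [← integral_const_mul]
    congr 1; ext τ
    rw [← mul_assoc, ← Complex.exp_add]; congr 2; ring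
  rw [h5]
  have hp : (0:ℝ) < (2 * Real.pi)⁻¹ := by positivity
  rw [abs_of_pos hp, Complex.real_smul] at hinv
  set Z := ∫ τ : ℝ, Complex.exp ((τ * t : ℂ) * Complex.I) * G ((σ:ℂ) + τ * Complex.I)
  have hpc : (Real.pi : ℂ) ≠ 0 := by exact_mod_cast Real.pi_ne_zero
  have hZ : Z = 2 * Real.pi * (Complex.exp (-((σ:ℂ) * t)) * (t:ℂ) ^ n * φ t) := by
    push_cast at hinv
    rw [← hinv]; field_simp
  have hee : Complex.exp ((σ:ℂ) * t) * Complex.exp (-((σ:ℂ) * t)) = 1 := by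
    rw [← Complex.exp_add]; simp
  rw [hZ]
  linear_combination (2 * Real.pi * ((t:ℂ)^n * φ t)) * hee

lemma aux_low_integral {p : ℝ} (hp : 1 < p) {σ : ℝ} (hσ : 0 < σ) :
    Integrable (fun τ : ℝ => ‖(σ:ℂ) + τ * Complex.I‖ ^ (-p)) ∧
    ∫ τ : ℝ, ‖(σ:ℂ) + τ * Complex.I‖ ^ (-p) = σ ^ (1 - p) * ∫ s : ℝ, (1 + ‖s‖ ^ 2) ^ (-p / 2) := by
  have h0 : Integrable (fun s : ℝ => (1 + ‖s‖ ^ 2) ^ (-p / 2)) := integrable_rpow_neg_one_add_norm_sq (by simpa using hp)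
  have e : ∀ τ : ℝ, ‖(σ:ℂ) + τ * Complex.I‖ ^ (-p) = σ ^ (-p) * (1 + ‖σ⁻¹ * τ‖ ^ 2) ^ (-p / 2) := by
    intro τ
    have h1 : ‖(σ:ℂ) + τ * Complex.I‖ = Real.sqrt (σ ^ 2 * (1 + (σ⁻¹ * τ) ^ 2)) := by
      rw [Complex.norm_add_mul_I]; congr 1; field_simp
    rw [h1, Real.norm_eq_abs, sq_abs, Real.sqrt_mul (by positivity), Real.sqrt_sq hσ.le, Real.mul_rpow hσ.le (by positivity),
      Real.sqrt_eq_rpow, ← Real.rpow_mul (by positivity)]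
    congr 2; ring
  simp_rw [e]
  constructor
  · exact (h0.comp_mul_left' (inv_ne_zero hσ.ne')).const_mul _
  · rw [integral_const_mul, Measure.integral_comp_mul_left (fun s : ℝ => (1 + ‖s‖ ^ 2) ^ (-p / 2)), inv_inv, abs_of_pos hσ, smul_eq_mul, ← mul_assoc]
    congr 1
    rw [sub_eq_add_neg, Real.rpow_add hσ, Real.rpow_one, mul_comm]
end
section
variable {K : Type*} [NormedAddCommGroup K] [InnerProductSpace ℂ K] [CompleteSpace K]
variable {U : Set ℂ} {R : ℂ → K →L[ℂ] K}

set_option maxHeartbeats 2000000 in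
lemma aux_scalar_bound {S : ℝ → K →L[ℂ] K}
    (hScont : ∀ x : K, ContinuousOn (fun t => S t x) (Set.Ici 0))
    {M ω : ℝ} (hM : 1 ≤ M) (hω : 0 ≤ ω)
    (hSbound : ∀ t : ℝ, 0 ≤ t → ‖S t‖ ≤ M * Real.exp (ω * t))
    {τ₀ C₁ : ℝ} (hτ₀ : 1 ≤ τ₀) (hC₁ : 0 < C₁)
    (hUopen : IsOpen U) (hRholo : DifferentiableOn ℂ R U)
    (hRres : ∀ l μ : ℂ, l ∈ U → μ ∈ U → R l - R μ = (l - μ) • ((R l).comp (R μ)))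
    (hUsub : ∀ l : ℂ, 0 < l.re → l ∈ U)
    (hRlaplace : ∀ l : ℂ, ω < l.re → ∀ x : K,
      R l x = -∫ t in Set.Ioi (0 : ℝ), Complex.exp (-(l * t)) • S t x)
    (hRhigh : ∀ l : ℂ, 0 < l.re → τ₀ / 2 < |l.im| → ‖R l‖ ≤ C₁)
    {n : ℕ} (hn : 1 ≤ n) {p : ℝ} (hp : 1 < p) {C₀ : ℝ} (hC₀ : 0 < C₀) {u v : K} {a b : ℝ} (hu : ‖u‖ ≤ a) (hv : ‖v‖ ≤ b)
    (hlow : ∀ l : ℂ, 0 < l.re → ‖l‖ < τ₀ → ‖inner ℂ v ((R l ^ (n+1)) u)‖ ≤ C₀ * ‖l‖ ^ (-p))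
    {t : ℝ} (ht : 2 ≤ t) :
    t ^ n * ‖inner ℂ v (S t u)‖ ≤ n.factorial * Real.exp 1 *
      ((1 + (ω + 1) * C₁) ^ 2 * C₁ ^ (n - 1) * (Real.pi * ((M * a) ^ 2 + (M * b) ^ 2))
        + C₀ * (t ^ (p - 1) * ∫ s : ℝ, (1 + ‖s‖ ^ 2) ^ (-p / 2))) := by
  set c := (1 + (ω + 1) * C₁) ^ 2 * C₁ ^ (n - 1) with hc
  have hc0 : 0 ≤ c := by positivity
  set pu : ℝ → ℝ := fun τ => ‖R (((ω + 1 : ℝ):ℂ) + τ * Complex.I) u‖ with hpu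
  set pv : ℝ → ℝ := fun τ => ‖ContinuousLinearMap.adjoint (R (((ω + 1 : ℝ):ℂ) + τ * Complex.I)) v‖ with hpv
  have hlc := aux_line_cont hRholo hUsub (by linarith : 0 < ω + 1)
  have hpuc : Continuous pu := (hlc.clm_apply continuous_const).norm
  have hpvc : Continuous pv := ((ContinuousLinearMap.adjoint.continuous.comp hlc).clm_apply continuous_const).norm
  obtain ⟨hui, huB⟩ := aux_sq_int hScont hω hSbound hRholo hUsub hRlaplace u
  obtain ⟨hvi, hvB⟩ := aux_sq_int_adj hScont hω hSbound hRholo hUsub hRlaplace v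
  set W : ℝ → ℝ := fun τ => c * (pv τ * pu τ) with hWdef
  have hW0 : ∀ τ, 0 ≤ W τ := fun τ => by positivity
  have hWle : ∀ τ, W τ ≤ c * ((pu τ ^ 2 + pv τ ^ 2) / 2) := fun τ => by
    simp only [hWdef]
    gcongr
    nlinarith [sq_nonneg (pu τ - pv τ)]
  have hWbi : Integrable (fun τ => c * ((pu τ ^ 2 + pv τ ^ 2) / 2)) := ((hui.add hvi).div_const 2).const_mul c
  have hWi : Integrable W := by
    refine hWbi.mono' (Continuous.aestronglyMeasurable (by fun_prop)) (Filter.Eventually.of_forall fun τ => ?_)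
    rw [Real.norm_of_nonneg (hW0 τ)]; exact hWle τ
  have hWint : ∫ τ, W τ ≤ c * (Real.pi * ((M * a) ^ 2 + (M * b) ^ 2)) := by
    refine (integral_mono hWi hWbi hWle).trans ?_
    rw [integral_const_mul, integral_div, integral_add hui hvi]
    gcongr
    have h1 : (M * ‖u‖) ^ 2 ≤ (M * a) ^ 2 := by gcongr
    have h2 : (M * ‖v‖) ^ 2 ≤ (M * b) ^ 2 := by gcongr
    have h3 := mul_le_mul_of_nonneg_left h1 Real.pi_pos.le
    have h4 := mul_le_mul_of_nonneg_left h2 Real.pi_pos.le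
    linarith
  have hRM : ∀ τ : ℝ, pv τ ≤ (M * 1) * ‖v‖ := by
    intro τ
    set l := (((ω + 1 : ℝ):ℂ) + τ * Complex.I) with hl
    have hlr : l.re = ω + 1 := by simp [hl]
    refine ContinuousLinearMap.le_of_opNorm_le _ ?_ _
    rw [LinearIsometryEquiv.norm_map]
    refine ContinuousLinearMap.opNorm_le_bound _ (by positivity) fun x => ?_
    rw [hRlaplace l (by linarith), norm_neg]
    have hb : ∀ t : ℝ, t ∈ Set.Ioi (0:ℝ) → ‖Complex.exp (-(l * t)) • S t x‖ ≤ (M * ‖x‖) * Real.exp (-t) := by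
      intro t ht
      rw [norm_smul, Complex.norm_exp]
      have h1 := (S t).le_of_opNorm_le (hSbound t (le_of_lt ht)) x
      calc _ ≤ Real.exp (-(l * t)).re * (M * Real.exp (ω * t) * ‖x‖) := by gcongr
        _ = (M * ‖x‖) * (Real.exp (-(l * t)).re * Real.exp (ω * t)) := by ring
        _ = _ := by rw [← Real.exp_add]; congr 2; simp [hlr]; ring
    refine (norm_integral_le_of_norm_le ((integrableOn_exp_neg_Ioi 0).const_mul (M * ‖x‖)) (ae_restrict_of_forall_mem measurableSet_Ioi hb)).trans ?_
    rw [integral_const_mul, integral_exp_neg_Ioi_zero]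
    linarith
  have hWt : Filter.Tendsto W (Filter.cocompact ℝ) (nhds 0) := by
    have h1 := (aux_RL hRlaplace u).const_mul (c * (M * 1 * ‖v‖))
    rw [mul_zero] at h1
    refine squeeze_zero hW0 (fun τ => ?_) h1
    simp only [hWdef, mul_assoc c]
    gcongr
    exact hRM τ
  set g : ℂ → ℂ := fun z => inner ℂ v ((R z ^ (n+1)) u) with hg
  have hgd : DifferentiableOn ℂ g {z : ℂ | 0 < z.re} := fun z hz =>
    (aux_g_deriv hUopen hRholo hRres (hUsub z hz) u v (n+1)).differentiableAt.differentiableWithinAt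
  have hgW : ∀ σ τ : ℝ, 0 < σ → σ ≤ ω + 1 → τ₀ / 2 < |τ| → ‖g ((σ:ℂ) + τ * Complex.I)‖ ≤ W τ := by
    intro σ τ hσ hσ1 hτ
    refine aux_high_bound hn hC₁.le hRres (hUsub _ (by simpa using hσ)) (hUsub _ (by simp; linarith)) (hRhigh _ (by simpa using hσ) (by simpa using hτ)) ?_ u v
    have : ((σ:ℂ) + τ * Complex.I) - (((ω + 1 : ℝ):ℂ) + τ * Complex.I) = ((σ - (ω + 1) : ℝ) : ℂ) := by push_cast; ring
    rw [this, Complex.norm_real, Real.norm_eq_abs, abs_le]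
    constructor <;> linarith
  have ht0 : 0 < t := by linarith
  set σ := t⁻¹ with hσdef
  have hσ : 0 < σ := by positivity
  have hσ2 : σ ≤ 1 / 2 := by
    rw [hσdef, one_div]; exact inv_anti₀ (by norm_num) ht
  have hshift := aux_shift hgd hWi hWt hgW hσ (by linarith : σ ≤ ω + 1) ht0.le
  have hgi1 : Integrable (fun τ : ℝ => g (((ω + 1 : ℝ):ℂ) + τ * Complex.I)) :=
    aux_line_integrable hgd hWi (by linarith) (fun τ hτ => hgW (ω + 1) τ (by linarith) le_rfl hτ)
  have hφ : ContinuousOn (fun t => inner ℂ v (S t u)) (Set.Ici 0) := by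
    have := hScont u
    fun_prop
  have hb : ∀ t, 0 ≤ t → ‖inner ℂ v (S t u)‖ ≤ (‖v‖ * (M * ‖u‖)) * Real.exp (ω * t) := fun t ht => by
    refine (norm_inner_le_norm _ _).trans ?_
    rw [mul_assoc]
    gcongr
    have := (S t).le_of_opNorm_le (hSbound t ht) u
    linarith
  have hlap := aux_laplace_pow hScont hω hSbound hUopen hRholo hRres hUsub hRlaplace u v n
  have hinv := aux_inversion hφ hb n (by linarith : ω < ω + 1) (G := fun l => (-1) ^ (n+1) * (n.factorial * g l))
    (fun l hl => by
      simp only [hg]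
      rw [hlap l hl, ← mul_assoc, ← pow_add, Even.neg_one_pow ⟨n+1, rfl⟩, one_mul])
    ((hgi1.const_mul _).const_mul _) ht0
  have hinv2 : ∫ τ : ℝ, Complex.exp ((((ω + 1 : ℝ):ℂ) + τ * Complex.I) * t) * ((-1) ^ (n+1) * (n.factorial * g (((ω + 1 : ℝ):ℂ) + τ * Complex.I)))
     = (-1) ^ (n+1) * n.factorial * ∫ τ : ℝ, Complex.exp ((((ω + 1 : ℝ):ℂ) + τ * Complex.I) * t) * g (((ω + 1 : ℝ):ℂ) + τ * Complex.I) := by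
    rw [← integral_const_mul]; congr 1; ext τ; ring
  rw [hinv2, ← hshift] at hinv
  obtain ⟨hqi, hqe⟩ := aux_low_integral hp hσ
  have hmain : ‖∫ τ : ℝ, Complex.exp (((σ:ℂ) + τ * Complex.I) * t) * g ((σ:ℂ) + τ * Complex.I)‖ ≤
      ∫ τ : ℝ, Real.exp 1 * (W τ + C₀ * ‖(σ:ℂ) + τ * Complex.I‖ ^ (-p)) := by
    refine norm_integral_le_of_norm_le ((hWi.add (hqi.const_mul _)).const_mul _) (Filter.Eventually.of_forall fun τ => ?_)
    rw [norm_mul, Complex.norm_exp]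
    have e1 : ((((σ:ℂ) + τ * Complex.I) * t)).re = 1 := by
      simp [hσdef]; field_simp
    rw [e1]
    gcongr
    rcases lt_or_ge (τ₀ / 2) |τ| with h | h
    · have h1 := hgW σ τ hσ (by linarith) h
      have h2 : 0 ≤ C₀ * ‖(σ:ℂ) + τ * Complex.I‖ ^ (-p) := by positivity
      linarith
    · have h1 := hlow ((σ:ℂ) + τ * Complex.I) (by simpa using hσ) (by
        rw [Complex.norm_add_mul_I, Real.sqrt_lt' (by linarith)]
        have := sq_abs τ
        have h5 : |τ| ^ 2 ≤ (τ₀ / 2) ^ 2 := by gcongr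
        nlinarith)
      have := hW0 τ
      simp only [hg]
      linarith
  rw [integral_const_mul, integral_add hWi (hqi.const_mul _), integral_const_mul C₀, hqe] at hmain
  have hσp : σ ^ (1 - p) = t ^ (p - 1) := by
    rw [hσdef, Real.inv_rpow ht0.le, ← Real.rpow_neg ht0.le]; congr 1; ring
  rw [hσp] at hmain
  have hnorm := congrArg norm hinv
  simp only [norm_mul, norm_pow, norm_neg, norm_one, one_pow, one_mul, Complex.norm_natCast, Complex.norm_real, Complex.norm_ofNat,
    Real.norm_of_nonneg ht0.le, Real.norm_of_nonneg Real.pi_pos.le] at hnorm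
  set Q := t ^ n * ‖inner ℂ v (S t u)‖ with hQ
  have hQ0 : 0 ≤ Q := by positivity
  have hfac : (0:ℝ) ≤ n.factorial := by positivity
  calc Q ≤ 2 * Real.pi * Q := by nlinarith [Real.pi_gt_three]
    _ = n.factorial * _ := hnorm.symm
    _ ≤ n.factorial * (Real.exp 1 * ((∫ τ, W τ) + C₀ * (t ^ (p - 1) * ∫ s : ℝ, (1 + ‖s‖ ^ 2) ^ (-p / 2)))) := mul_le_mul_of_nonneg_left hmain hfac
    _ ≤ _ := by
      rw [mul_assoc]
      gcongr
end

lemma aux_final {e A D : ℝ} (he0 : e ≤ 0) (hA0 : 0 ≤ A) (hD0 : 0 ≤ D) {N t : ℝ} (ht : 0 ≤ t)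
    (hs : t ≤ 2 → N ≤ A) (hb : 2 ≤ t → N ≤ D * t ^ e) :
    N ≤ (A * 5 ^ (-e / 2) + D * 2 ^ (-e / 2) + 1) * (1 + t ^ 2) ^ (e / 2) := by
  have hpos : 0 < (1 + t ^ 2) ^ (e / 2) := by positivity
  have hX : 0 ≤ A * (5:ℝ) ^ (-e / 2) := by positivity
  have hZ : 0 ≤ D * (2:ℝ) ^ (-e / 2) := by positivity
  rcases le_total t 2 with h | h
  · have h1 := hs h
    have h2 : (5:ℝ) ^ (e / 2) ≤ (1 + t ^ 2) ^ (e / 2) :=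
      Real.rpow_le_rpow_of_nonpos (by positivity) (by nlinarith) (by linarith)
    have h3 : A = A * (5:ℝ) ^ (-e / 2) * (5:ℝ) ^ (e / 2) := by
      rw [mul_assoc, ← Real.rpow_add (by norm_num)]
      simp [neg_div]
    have h4 := mul_le_mul_of_nonneg_left h2 hX
    nlinarith
  · have h1 := hb h
    have ht0 : 0 < t := by linarith
    have h2 : (2 * t ^ 2 : ℝ) ^ (e / 2) ≤ (1 + t ^ 2) ^ (e / 2) :=
      Real.rpow_le_rpow_of_nonpos (by positivity) (by nlinarith) (by linarith)
    have h3 : D * t ^ e = D * (2:ℝ) ^ (-e / 2) * (2 * t ^ 2 : ℝ) ^ (e / 2) := by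
      rw [Real.mul_rpow (by norm_num) (by positivity), mul_assoc, ← mul_assoc (2 ^ (-e / 2)), ← Real.rpow_add (by norm_num),
        ← Real.rpow_natCast t 2, ← Real.rpow_mul ht0.le]
      simp only [neg_div, neg_add_cancel, Real.rpow_zero, one_mul]
      congr 2; push_cast; ring
    have h4 := mul_le_mul_of_nonneg_left h2 hZ
    nlinarith


set_option maxHeartbeats 1000000 in
theorem abstract_resolvent_to_time_decay
    {K X Y : Type*}
    [NormedAddCommGroup K] [InnerProductSpace ℂ K] [CompleteSpace K]
    [NormedAddCommGroup X] [NormedSpace ℂ X]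
    [NormedAddCommGroup Y] [NormedSpace ℂ Y]
    (TX : X →L[ℂ] K) (TY : K →L[ℂ] Y)
    (S : ℝ → K →L[ℂ] K)
    (hS0 : S 0 = 1)
    (hSadd : ∀ t s : ℝ, 0 ≤ t → 0 ≤ s → S (t + s) = (S t).comp (S s))
    (hScont : ∀ x : K, ContinuousOn (fun t => S t x) (Set.Ici 0))
    (M ω : ℝ) (hM : 1 ≤ M) (hω : 0 ≤ ω)
    (hSbound : ∀ t : ℝ, 0 ≤ t → ‖S t‖ ≤ M * Real.exp (ω * t))
    (τ₀ : ℝ) (hτ₀ : 1 ≤ τ₀) (γ : ℝ) (hγ : 0 < γ) (C₁ : ℝ) (hC₁ : 0 < C₁)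
    (U : Set ℂ) (hUopen : IsOpen U)
    (hUsub : {l : ℂ | 0 < l.re} ∪ {l : ℂ | -(2*γ) < l.re ∧ τ₀ / 2 < |l.im|} ⊆ U)
    (R : ℂ → K →L[ℂ] K)
    (hRholo : DifferentiableOn ℂ R U)
    (hRres : ∀ l μ : ℂ, l ∈ U → μ ∈ U → R l - R μ = (l - μ) • ((R l).comp (R μ)))
    (hRlaplace : ∀ l : ℂ, ω < l.re → ∀ x : K,
      R l x = -∫ t in Set.Ioi (0 : ℝ), Complex.exp (-(l * t)) • S t x)
    (hRhigh : ∀ l : ℂ, -(2*γ) < l.re → τ₀ / 2 < |l.im| → ‖R l‖ ≤ C₁)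
    (m : ℕ) (κ : ℝ) (hκ : κ ∈ Set.Ico (0 : ℝ) 1) (C₀ : ℝ) (hC₀ : 0 < C₀)
    (hlow : ∀ j : ℕ,
      ((κ = 0 ∧ (j = m ∨ j = m + 1 ∨ j = m + 2)) ∨ (κ ≠ 0 ∧ (j = m ∨ j = m + 1))) →
      ∀ l : ℂ, 0 < l.re → ‖l‖ < τ₀ →
        ‖TY.comp ((R l ^ (1 + j)).comp TX)‖ ≤ C₀ * ‖l‖ ^ ((m : ℝ) - κ - j)) :
    ∃ C : ℝ, 0 < C ∧ ∀ t : ℝ, 0 ≤ t →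
      ‖TY.comp ((S t).comp TX)‖ ≤ C * (1 + t ^ 2) ^ ((-(m : ℝ) - 1 + κ) / 2) := by
  obtain ⟨hκ0, hκ1⟩ := hκ
  obtain ⟨n, p, hn, hp, hpn, hl⟩ : ∃ (n : ℕ) (p : ℝ), 1 ≤ n ∧ 1 < p ∧ p - 1 - n = -(m:ℝ) - 1 + κ ∧
      ∀ l : ℂ, 0 < l.re → ‖l‖ < τ₀ → ‖TY.comp ((R l ^ (n + 1)).comp TX)‖ ≤ C₀ * ‖l‖ ^ (-p) := by
    by_cases h : κ = 0
    · refine ⟨m + 2, 2, by omega, by norm_num, by push_cast; rw [h]; ring, fun l h1 h2 => ?_⟩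
      have := hlow (m+2) (Or.inl ⟨h, Or.inr (Or.inr rfl)⟩) l h1 h2
      rw [add_comm 1] at this
      refine this.trans (le_of_eq ?_)
      congr 2; push_cast; rw [h]; ring
    · refine ⟨m + 1, 1 + κ, by omega, ?_, by push_cast; ring, fun l h1 h2 => ?_⟩
      · have : 0 < κ := lt_of_le_of_ne hκ0 (Ne.symm h)
        linarith
      have := hlow (m+1) (Or.inr ⟨h, Or.inr rfl⟩) l h1 h2
      rw [add_comm 1] at this
      refine this.trans (le_of_eq ?_)
      congr 2; push_cast; ring
  set e := -(m : ℝ) - 1 + κ with he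
  have he0 : e ≤ 0 := by
    have : (0:ℝ) ≤ m := by positivity
    linarith
  set I := ∫ s : ℝ, (1 + ‖s‖ ^ 2) ^ (-p / 2) with hI
  have hI0 : 0 ≤ I := integral_nonneg fun s => by positivity
  set B := (1 + (ω + 1) * C₁) ^ 2 * C₁ ^ (n - 1) * (Real.pi * ((M * ‖TX‖) ^ 2 + (M * ‖TY‖) ^ 2)) with hB
  have hB0 : 0 ≤ B := by positivity
  set D := n.factorial * Real.exp 1 * (B + C₀ * I) with hD
  have hD0 : 0 ≤ D := by positivity
  have hbig : ∀ t : ℝ, 2 ≤ t → ‖TY.comp ((S t).comp TX)‖ ≤ D * t ^ e := by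
    intro t ht
    have ht0 : 0 < t := by linarith
    refine ContinuousLinearMap.opNorm_le_of_unit_norm (by positivity) fun x hx => ?_
    obtain ⟨f, hf1, hf2⟩ := exists_dual_vector'' ℂ (TY (S t (TX x)))
    set v : K := (InnerProductSpace.toDual ℂ K).symm (f.comp TY) with hv
    have hvi : ∀ k, inner ℂ v k = f (TY k) := fun k => by
      rw [hv, InnerProductSpace.toDual_symm_apply]; rfl
    have hvn : ‖v‖ ≤ ‖TY‖ := by
      rw [hv, LinearIsometryEquiv.norm_map]
      refine (ContinuousLinearMap.opNorm_comp_le _ _).trans ?_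
      have := mul_le_mul_of_nonneg_right hf1 (norm_nonneg TY)
      linarith
    have hun : ‖TX x‖ ≤ ‖TX‖ := by simpa [hx] using TX.le_opNorm x
    have key := aux_scalar_bound hScont hM hω hSbound hτ₀ hC₁ hUopen hRholo hRres
      (fun l hl => hUsub (Or.inl hl)) hRlaplace (fun l h1 h2 => hRhigh l (by linarith) h2) hn hp hC₀ hun hvn
      (fun l h1 h2 => by
        refine le_trans ?_ (hl l h1 h2)
        rw [hvi]
        refine (f.le_of_opNorm_le hf1 _).trans ?_
        rw [one_mul]
        simpa [hx] using (TY.comp ((R l ^ (n + 1)).comp TX)).le_opNorm x) ht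
    rw [hvi, hf2] at key
    have hnn : ‖((‖TY (S t (TX x))‖ : ℝ) : ℂ)‖ = ‖TY (S t (TX x))‖ := by
      rw [Complex.norm_real, norm_norm]
    have h1 : 1 ≤ t ^ (p - 1) := Real.one_le_rpow (by linarith) (by linarith)
    have h2 : t ^ n * ‖TY (S t (TX x))‖ ≤ D * t ^ (p - 1) := by
      rw [← hnn]
      refine key.trans ?_
      rw [hD, mul_assoc _ (B + C₀ * I)]
      gcongr
      nlinarith
    have h3 : D * t ^ e = (D * t ^ (p - 1)) / t ^ n := by
      rw [← hpn, Real.rpow_sub ht0, Real.rpow_natCast, mul_div_assoc]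
    change ‖TY (S t (TX x))‖ ≤ D * t ^ e
    rw [h3, le_div_iff₀ (by positivity)]
    linarith
  set A := ‖TY‖ * (M * Real.exp (ω * 2) * ‖TX‖) with hA
  have hA0 : 0 ≤ A := by positivity
  refine ⟨A * 5 ^ (-e / 2) + D * 2 ^ (-e / 2) + 1, by positivity, fun t ht => ?_⟩
  refine aux_final he0 hA0 hD0 ht (fun h => ?_) (hbig t)
  refine (ContinuousLinearMap.opNorm_comp_le _ _).trans ?_
  rw [hA]
  refine mul_le_mul_of_nonneg_left ?_ (norm_nonneg _)
  refine (ContinuousLinearMap.opNorm_comp_le _ _).trans ?_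
  refine mul_le_mul_of_nonneg_right ?_ (norm_nonneg _)
  refine (hSbound t ht).trans ?_
  refine mul_le_mul_of_nonneg_left ?_ (by linarith)
  exact Real.exp_le_exp.mpr (mul_le_mul_of_nonneg_left h hω)
end

section
/- Fix d ≥ 1 and let c_j := ((j+1)/(2e))^{(j+1)/2} for j ∈ {0,1,2}. Let ρ₀, ρ₁, ρ₂ : (0,∞) → [0,∞) be such that for every measurable F = (F₀, F₁) : ℝ^d → ℂ² with K(F)² := ∫_{ℝ^d} ( (‖ξ‖²+1)|F₀(ξ)|² + |F₁(ξ)|² + ‖ξ‖^{−2}|F₀(ξ)+F₁(ξ)|² ) dξ < ∞ and every t > 0: ∫ |(exp(tM(ξ))F(ξ))₀|² dξ ≤ ρ₀(t)² K(F)², ∫ ‖ξ‖² |(exp(tM(ξ))F(ξ))₀|² dξ ≤ ρ₁(t)² K(F)², and ∫ |(exp(tM(ξ))F(ξ))₁|² dξ ≤ ρ₂(t)² K(F)². Then for every ε > 0 there exists t₀ ≥ 1 such that for all t ≥ t₀: ρ₀(t) ≥ (c₀ − ε) t^{−1/2}, ρ₁(t) ≥ (c₁ − ε) t^{−1}, and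 ρ₂(t) ≥ (c₂ − ε) t^{−3/2}. -/
open MeasureTheory

/-- The symbol `M(ξ)` of the damped wave equation `∂²ₜu + ∂ₜu = Δu` on the Fourier side:
the `2×2` complex matrix with rows `(0, 1)` and `(−‖ξ‖², −1)`. -/
noncomputable def dwSymbol (d : ℕ) (ξ : EuclideanSpace ℝ (Fin d)) :
    Matrix (Fin 2) (Fin 2) ℂ :=
  !![0, 1; -(‖ξ‖ : ℂ) ^ 2, -1]

/-- The propagator `exp(t M(ξ))` (matrix exponential). -/
noncomputable def dwProp (d : ℕ) (t : ℝ) (ξ : EuclideanSpace ℝ (Fin d)) :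
    Matrix (Fin 2) (Fin 2) ℂ :=
  NormedSpace.exp ((t : ℂ) • dwSymbol d ξ)

/-- The Fourier-side integrand of the squared `𝒦`-norm of initial data `F = (F₀, F₁)` for
constant damping `a ≡ 1`, `q ≡ 0`. -/
noncomputable def KKint (d : ℕ) (F : EuclideanSpace ℝ (Fin d) → Fin 2 → ℂ)
    (ξ : EuclideanSpace ℝ (Fin d)) : ℝ :=
  (‖ξ‖ ^ 2 + 1) * ‖F ξ 0‖ ^ 2 + ‖F ξ 1‖ ^ 2 + (‖ξ‖ ^ 2)⁻¹ * ‖F ξ 0 + F ξ 1‖ ^ 2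

theorem dw_exp_mulVec (A : Matrix (Fin 2) (Fin 2) ℂ) (v : Fin 2 → ℂ) (l : ℂ)
    (h : A.mulVec v = l • v) :
    (NormedSpace.exp A).mulVec v = Complex.exp l • v := by
  let _ : NormedRing (Matrix (Fin 2) (Fin 2) ℂ) := Matrix.linftyOpNormedRing
  let _ : NormedAlgebra ℂ (Matrix (Fin 2) (Fin 2) ℂ) := Matrix.linftyOpNormedAlgebra
  have h1 := NormedSpace.exp_series_hasSum_exp' (𝕂 := ℂ) A
  let φ : Matrix (Fin 2) (Fin 2) ℂ →+ (Fin 2 → ℂ) :=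
    { toFun := fun B => B.mulVec v
      map_zero' := Matrix.zero_mulVec v
      map_add' := fun B C => Matrix.add_mulVec B C v }
  have hφ : Continuous φ := by
    change Continuous (fun B : Matrix (Fin 2) (Fin 2) ℂ => B.mulVec v)
    exact Continuous.matrix_mulVec continuous_id continuous_const
  have h2 := h1.map φ hφ
  have h3 := (NormedSpace.exp_series_hasSum_exp' (𝕂 := ℂ) l).smul_const v
  rw [← Complex.exp_eq_exp_ℂ] at h3
  have hp : ∀ n : ℕ, (A ^ n).mulVec v = l ^ n • v := by
    intro n
    induction n with
    | zero => simp
    | succ k ih =>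
      rw [pow_succ, ← Matrix.mulVec_mulVec, h, Matrix.mulVec_smul, ih, smul_smul, pow_succ,
        mul_comm]
  refine h2.unique ?_
  convert h3 using 2 with n
  change ((n.factorial : ℂ)⁻¹ • A ^ n).mulVec v = _
  rw [Matrix.smul_mulVec, hp, smul_smul, smul_eq_mul]

theorem dwProp_continuous (d : ℕ) (t : ℝ) : Continuous (dwProp d t) := by
  let _ : NormedRing (Matrix (Fin 2) (Fin 2) ℂ) := Matrix.linftyOpNormedRing
  let _ : NormedAlgebra ℂ (Matrix (Fin 2) (Fin 2) ℂ) := Matrix.linftyOpNormedAlgebra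
  let _ : NormedAlgebra ℚ (Matrix (Fin 2) (Fin 2) ℂ) := NormedAlgebra.restrictScalars ℚ ℂ _
  have h : Continuous (NormedSpace.exp : Matrix (Fin 2) (Fin 2) ℂ → _) :=
    NormedSpace.exp_continuous
  have hs : Continuous (dwSymbol d) := by
    refine continuous_matrix ?_
    intro i j
    fin_cases i <;> fin_cases j <;> simp [dwSymbol] <;> fun_prop
  exact h.comp (hs.const_smul (t : ℂ))

/-- Localization: integral inequalities on all small balls give a pointwise inequality. -/
theorem dw_localize {d : ℕ} (f k : EuclideanSpace ℝ (Fin d) → ℝ) (C : ℝ)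
    (x : EuclideanSpace ℝ (Fin d)) (R : ℝ) (hR : 0 < R)
    (hf : Continuous f) (hk : ContinuousOn k (Metric.closedBall x R))
    (h : ∀ r, 0 < r → r ≤ R → ∫ y in Metric.closedBall x r, f y ≤
      C * ∫ y in Metric.closedBall x r, k y) : f x ≤ C * k x := by
  by_contra! hlt
  obtain ⟨m, hm1, hm2⟩ := exists_between hlt
  obtain ⟨n, hn1, hn2⟩ := exists_between hm2
  have hkx : ContinuousAt k x := hk.continuousAt (Metric.closedBall_mem_nhds x hR)
  have e1 : ∀ᶠ y in nhds x, C * k y < m := (hkx.const_mul C).eventually_lt_const hm1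
  have e2 : ∀ᶠ y in nhds x, n < f y := hf.continuousAt.eventually_const_lt hn2
  obtain ⟨r, hr, hr'⟩ := Metric.nhds_basis_closedBall.mem_iff.1 (e1.and e2)
  set s := min r R with hs
  have hs0 : 0 < s := lt_min hr hR
  have hsub : Metric.closedBall x s ⊆ Metric.closedBall x r :=
    Metric.closedBall_subset_closedBall (min_le_left _ _)
  have hsub' : Metric.closedBall x s ⊆ Metric.closedBall x R :=
    Metric.closedBall_subset_closedBall (min_le_right _ _)
  have hcomp : IsCompact (Metric.closedBall x s) := isCompact_closedBall x s
  have hfi : IntegrableOn f (Metric.closedBall x s) := hf.continuousOn.integrableOn_compact hcomp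
  have hki : IntegrableOn (fun y => C * k y) (Metric.closedBall x s) :=
    ((hk.mono hsub').const_mul C).integrableOn_compact hcomp
  have hc : ∀ c : ℝ, IntegrableOn (fun _ => c) (Metric.closedBall x s) := fun c =>
    continuousOn_const.integrableOn_compact hcomp
  have i1 := setIntegral_mono_on (hc n) hfi Metric.isClosed_closedBall.measurableSet
    (fun y hy => (hr' (hsub hy)).2.le)
  have i2 := setIntegral_mono_on hki (hc m) Metric.isClosed_closedBall.measurableSet
    (fun y hy => (hr' (hsub hy)).1.le)
  rw [integral_const_mul] at i2
  rw [setIntegral_const] at i1 i2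
  have i3 := h s hs0 (min_le_right _ _)
  have hvol : 0 < (volume : Measure (EuclideanSpace ℝ (Fin d))).real (Metric.closedBall x s) :=
    ENNReal.toReal_pos (Metric.measure_closedBall_pos _ _ hs0).ne' hcomp.measure_lt_top.ne
  have : m < n := hn1
  simp only [smul_eq_mul] at i1 i2
  nlinarith

theorem dw_final (N t ε r : ℝ) (hN : 0 < N) (ht : N < t) (hε : 0 < ε)
    (htε : (N / (2 * Real.exp 1)) ^ (N / 2) * N / (2 * ε) ≤ t) (hr : 0 ≤ r)
    (h : Real.exp (-N) * (N / (2 * t)) ^ N * (1 - N / (2 * t)) ^ 2 ≤ r ^ 2) :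
    ((N / (2 * Real.exp 1)) ^ (N / 2) - ε) * t ^ (-N / 2) ≤ r := by
  have ht0 : 0 < t := hN.trans ht
  set c := (N / (2 * Real.exp 1)) ^ (N / 2) with hc
  have hsq : (c * t ^ (-N / 2)) ^ 2 = Real.exp (-N) * (N / (2 * t)) ^ N := by
    have e : (0:ℝ) < Real.exp 1 := Real.exp_pos 1
    have h1 : c ^ 2 = (N / (2 * Real.exp 1)) ^ N := by
      rw [hc, ← Real.rpow_natCast, ← Real.rpow_mul (by positivity)]
      norm_num
    have h2 : (t ^ (-N / 2)) ^ 2 = t ^ (-N) := by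
      rw [← Real.rpow_natCast, ← Real.rpow_mul ht0.le]
      norm_num
    have h3 : Real.exp (-N) = (Real.exp 1) ^ (-N) := by
      rw [← Real.exp_mul]; simp
    rw [mul_pow, h1, h2, h3, Real.rpow_neg e.le, Real.rpow_neg ht0.le,
      Real.div_rpow hN.le (by positivity), Real.div_rpow hN.le (by positivity),
      Real.mul_rpow (by norm_num) e.le, Real.mul_rpow (by norm_num) ht0.le]
    field_simp
  have hμ : N / (2 * t) ≤ 1 := by rw [div_le_one (by positivity)]; linarith
  have hc0 : 0 ≤ c := by positivity
  have hle : c * t ^ (-N / 2) * (1 - N / (2 * t)) ≤ r := by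
    refine abs_le_of_sq_le_sq' ?_ hr |>.2
    rw [mul_pow, hsq]; exact h
  refine le_trans ?_ hle
  have hp : 0 ≤ t ^ (-N / 2) := by positivity
  have hcm : c * (N / (2 * t)) ≤ ε := by
    rw [div_le_iff₀ (by positivity)] at htε
    rw [← mul_div_assoc, div_le_iff₀ (by positivity)]
    linarith
  nlinarith

theorem dw_pointwise
    (d : ℕ) (hd : 1 ≤ d) (r₀ r₁ r₂ t : ℝ)
    (hρ : ∀ F : EuclideanSpace ℝ (Fin d) → Fin 2 → ℂ, Measurable F →
      Integrable (KKint d F) → 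
      (∫ ξ, ‖(dwProp d t ξ).mulVec (F ξ) 0‖ ^ 2) ≤ r₀ ^ 2 * ∫ ξ, KKint d F ξ ∧
      (∫ ξ, ‖ξ‖ ^ 2 * ‖(dwProp d t ξ).mulVec (F ξ) 0‖ ^ 2) ≤ r₁ ^ 2 * ∫ ξ, KKint d F ξ ∧
      (∫ ξ, ‖(dwProp d t ξ).mulVec (F ξ) 1‖ ^ 2) ≤ r₂ ^ 2 * ∫ ξ, KKint d F ξ)
    (m : ℝ) (hm0 : 0 < m) (hm1 : m < 1) :
    Real.exp (-(2 * t * m)) ≤ r₀ ^ 2 * (m + 1 / m) ∧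
    m * (1 - m) * Real.exp (-(2 * t * m)) ≤ r₁ ^ 2 * (m + 1 / m) ∧
    m ^ 2 * Real.exp (-(2 * t * m)) ≤ r₂ ^ 2 * (m + 1 / m) := by
  have : Nonempty (Fin d) := ⟨⟨0, hd⟩⟩
  have hs0 : 0 < m * (1 - m) := by nlinarith
  obtain ⟨x, hx⟩ : ∃ x : EuclideanSpace ℝ (Fin d), ‖x‖ = Real.sqrt (m * (1 - m)) :=
    ⟨EuclideanSpace.single ⟨0, hd⟩ (Real.sqrt (m * (1 - m))), by
      simp [abs_of_nonneg (Real.sqrt_nonneg _)]⟩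
  have hx2 : ‖x‖ ^ 2 = m * (1 - m) := by rw [hx, Real.sq_sqrt hs0.le]
  have hxpos : 0 < ‖x‖ := by rw [hx]; exact Real.sqrt_pos.2 hs0
  set v : Fin 2 → ℂ := ![1, -(m : ℂ)] with hv
  have hval : (dwProp d t x).mulVec v = Complex.exp ((t : ℂ) * (-(m : ℂ))) • v := by
    refine dw_exp_mulVec _ _ _ ?_
    have hxc : (‖x‖ : ℂ) ^ 2 = m * (1 - m) := by exact_mod_cast hx2
    ext i
    fin_cases i
    · simp [dwSymbol, hv, Matrix.mulVec, dotProduct]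
    · simp [dwSymbol, hv, Matrix.mulVec, dotProduct, hxc]
      ring
  have hexp : ‖Complex.exp ((t : ℂ) * (-(m : ℂ)))‖ ^ 2 = Real.exp (-(2 * t * m)) := by
    rw [Complex.norm_exp, ← Real.exp_nat_mul]
    congr 1
    simp
    ring
  have hV0 : ‖(dwProp d t x).mulVec v 0‖ ^ 2 = Real.exp (-(2 * t * m)) := by
    rw [hval]; simp only [Pi.smul_apply, smul_eq_mul, norm_mul, mul_pow, hexp]; simp [hv]
  have hV1 : ‖(dwProp d t x).mulVec v 1‖ ^ 2 = m ^ 2 * Real.exp (-(2 * t * m)) := by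
    rw [hval]; simp only [Pi.smul_apply, smul_eq_mul, norm_mul, mul_pow, hexp]
    simp [hv, mul_comm]
  have hK : KKint d (fun _ => v) x = m + 1 / m := by
    have h1 : ‖(1 : ℂ) + -(m : ℂ)‖ ^ 2 = (1 - m) ^ 2 := by
      have : (1 : ℂ) + -(m : ℂ) = ((1 - m : ℝ) : ℂ) := by push_cast; ring
      rw [this, Complex.norm_real, Real.norm_eq_abs, sq_abs]
    have h2 : 1 - m ≠ 0 := by linarith
    simp only [KKint, hv, hx2, Matrix.cons_val_zero, Matrix.cons_val_one, h1]
    simp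
    field_simp
    ring
  have hcV : Continuous (fun ξ => (dwProp d t ξ).mulVec v) :=
    Continuous.matrix_mulVec (dwProp_continuous d t) continuous_const
  have hc0 : Continuous (fun ξ => (dwProp d t ξ).mulVec v 0) := (continuous_apply 0).comp hcV
  have hc1 : Continuous (fun ξ => (dwProp d t ξ).mulVec v 1) := (continuous_apply 1).comp hcV
  have hR : 0 < ‖x‖ / 2 := by positivity
  have hkc : ContinuousOn (KKint d (fun _ => v)) (Metric.closedBall x (‖x‖ / 2)) := by
    unfold KKint
    have hne : ∀ y ∈ Metric.closedBall x (‖x‖ / 2), ‖y‖ ^ 2 ≠ 0 := by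
      intro y hy h0
      have : y = 0 := by simpa using h0
      rw [this, Metric.mem_closedBall, dist_comm, dist_zero_right] at hy
      linarith
    have hinv : ContinuousOn (fun y : EuclideanSpace ℝ (Fin d) => (‖y‖ ^ 2)⁻¹)
        (Metric.closedBall x (‖x‖ / 2)) :=
      ContinuousOn.inv₀ (by fun_prop) hne
    exact ContinuousOn.add (by fun_prop) (hinv.mul continuousOn_const)
  have key : ∀ r, 0 < r → r ≤ ‖x‖ / 2 →
      (∫ ξ in Metric.closedBall x r, ‖(dwProp d t ξ).mulVec v 0‖ ^ 2)
        ≤ r₀ ^ 2 * ∫ ξ in Metric.closedBall x r, KKint d (fun _ => v) ξ ∧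
      (∫ ξ in Metric.closedBall x r, ‖ξ‖ ^ 2 * ‖(dwProp d t ξ).mulVec v 0‖ ^ 2)
        ≤ r₁ ^ 2 * ∫ ξ in Metric.closedBall x r, KKint d (fun _ => v) ξ ∧
      (∫ ξ in Metric.closedBall x r, ‖(dwProp d t ξ).mulVec v 1‖ ^ 2)
        ≤ r₂ ^ 2 * ∫ ξ in Metric.closedBall x r, KKint d (fun _ => v) ξ := by
    intro r hr hrR
    set B := Metric.closedBall x r with hB
    have hBm : MeasurableSet B := Metric.isClosed_closedBall.measurableSet
    have hKi : KKint d (B.indicator (fun _ => v)) = B.indicator (KKint d (fun _ => v)) := by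
      ext ξ
      by_cases hξ : ξ ∈ B <;> simp [KKint, hξ]
    have hint : Integrable (KKint d (B.indicator (fun _ => v))) := by
      rw [hKi, integrable_indicator_iff hBm]
      exact (hkc.mono (Metric.closedBall_subset_closedBall hrR)).integrableOn_compact
        (isCompact_closedBall x r)
    have := hρ (B.indicator (fun _ => v)) (measurable_const.indicator hBm) hint
    rw [hKi, integral_indicator hBm] at this
    refine ⟨?_, ?_, ?_⟩
    · refine le_trans (le_of_eq ?_) this.1
      rw [← integral_indicator hBm]
      congr 1
      ext ξ
      by_cases hξ : ξ ∈ B <;> simp [hξ]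
    · refine le_trans (le_of_eq ?_) this.2.1
      rw [← integral_indicator hBm]
      congr 1
      ext ξ
      by_cases hξ : ξ ∈ B <;> simp [hξ]
    · refine le_trans (le_of_eq ?_) this.2.2
      rw [← integral_indicator hBm]
      congr 1
      ext ξ
      by_cases hξ : ξ ∈ B <;> simp [hξ]
  have k0 := dw_localize _ _ (r₀ ^ 2) x _ hR (hc0.norm.pow 2) hkc
    (fun r h1 h2 => (key r h1 h2).1)
  have k1 := dw_localize _ _ (r₁ ^ 2) x _ hR ((continuous_norm.pow 2).mul (hc0.norm.pow 2)) hkc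
    (fun r h1 h2 => (key r h1 h2).2.1)
  have k2 := dw_localize _ _ (r₂ ^ 2) x _ hR (hc1.norm.pow 2) hkc
    (fun r h1 h2 => (key r h1 h2).2.2)
  simp only [Pi.mul_apply, Pi.pow_apply, hV0, hV1, hK, hx2] at k0 k1 k2
  exact ⟨k0, k1, k2⟩

theorem dw_alg (E m R w W : ℝ) (hm0 : 0 < m) (hm1 : m < 1) (hE : 0 ≤ E) (hw : 0 ≤ w)
    (hW : w * (1 - m) ≤ W) (h : W * E ≤ R * (m + 1 / m)) :
    E * (w * m) * (1 - m) ^ 2 ≤ R := by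
  have h1 : R * (m + 1 / m) = R * (1 + m ^ 2) / m := by field_simp; ring
  rw [h1, le_div_iff₀ hm0] at h
  have h2 : w * (1 - m) * E * m ≤ R * (1 + m ^ 2) :=
    le_trans (by gcongr) h
  have h3 : (1 - m) * (1 + m ^ 2) ≤ 1 := by nlinarith [sq_nonneg (m - 1), sq_nonneg m, mul_pos hm0 hm0]
  have h4 : 0 ≤ E * (w * m) * (1 - m) :=
    mul_nonneg (mul_nonneg hE (mul_nonneg hw hm0.le)) (by linarith)
  have h5 : E * (w * m) * (1 - m) ^ 2 * (1 + m ^ 2) ≤ R * (1 + m ^ 2) := by nlinarith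
  exact le_of_mul_le_mul_right h5 (by positivity)

/-- **Proposition 6.1 (sharpness of the decay rates for constant damping), on the Fourier
side via Plancherel.** -/
theorem sharpness_constant_damping
    (d : ℕ) (hd : 1 ≤ d)
    (ρ₀ ρ₁ ρ₂ : ℝ → ℝ)
    (hρ_nonneg : ∀ t : ℝ, 0 < t → 0 ≤ ρ₀ t ∧ 0 ≤ ρ₁ t ∧ 0 ≤ ρ₂ t)
    (hρ : ∀ F : EuclideanSpace ℝ (Fin d) → Fin 2 → ℂ, Measurable F →
      Integrable (KKint d F) → ∀ t : ℝ, 0 < t →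
      (∫ ξ, ‖(dwProp d t ξ).mulVec (F ξ) 0‖ ^ 2) ≤ ρ₀ t ^ 2 * ∫ ξ, KKint d F ξ ∧
      (∫ ξ, ‖ξ‖ ^ 2 * ‖(dwProp d t ξ).mulVec (F ξ) 0‖ ^ 2) ≤ ρ₁ t ^ 2 * ∫ ξ, KKint d F ξ ∧
      (∫ ξ, ‖(dwProp d t ξ).mulVec (F ξ) 1‖ ^ 2) ≤ ρ₂ t ^ 2 * ∫ ξ, KKint d F ξ) :
    ∀ ε : ℝ, 0 < ε → ∃ t₀ : ℝ, 1 ≤ t₀ ∧ ∀ t : ℝ, t₀ ≤ t →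
      ((1 / (2 * Real.exp 1)) ^ ((1 : ℝ) / 2) - ε) * t ^ (-(1 : ℝ) / 2) ≤ ρ₀ t ∧
      ((2 / (2 * Real.exp 1)) ^ ((2 : ℝ) / 2) - ε) * t ^ (-(2 : ℝ) / 2) ≤ ρ₁ t ∧
      ((3 / (2 * Real.exp 1)) ^ ((3 : ℝ) / 2) - ε) * t ^ (-(3 : ℝ) / 2) ≤ ρ₂ t := by
  intro ε hε
  refine ⟨4 + (1 / (2 * Real.exp 1)) ^ ((1 : ℝ) / 2) * 1 / (2 * ε)
    + (2 / (2 * Real.exp 1)) ^ ((2 : ℝ) / 2) * 2 / (2 * ε)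
    + (3 / (2 * Real.exp 1)) ^ ((3 : ℝ) / 2) * 3 / (2 * ε), ?_, ?_⟩
  · have h1 : 0 ≤ (1 / (2 * Real.exp 1)) ^ ((1 : ℝ) / 2) * 1 / (2 * ε) := by positivity
    have h2 : 0 ≤ (2 / (2 * Real.exp 1)) ^ ((2 : ℝ) / 2) * 2 / (2 * ε) := by positivity
    have h3 : 0 ≤ (3 / (2 * Real.exp 1)) ^ ((3 : ℝ) / 2) * 3 / (2 * ε) := by positivity
    linarith
  intro t ht
  have h1 : 0 ≤ (1 / (2 * Real.exp 1)) ^ ((1 : ℝ) / 2) * 1 / (2 * ε) := by positivity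
  have h2 : 0 ≤ (2 / (2 * Real.exp 1)) ^ ((2 : ℝ) / 2) * 2 / (2 * ε) := by positivity
  have h3 : 0 ≤ (3 / (2 * Real.exp 1)) ^ ((3 : ℝ) / 2) * 3 / (2 * ε) := by positivity
  have ht4 : 4 ≤ t := by linarith
  have ht0 : 0 < t := by linarith
  obtain ⟨hr0, hr1, hr2⟩ := hρ_nonneg t ht0
  have hpt := dw_pointwise d hd (ρ₀ t) (ρ₁ t) (ρ₂ t) t (fun F hF hFi => hρ F hF hFi t ht0)
  have hm : ∀ N : ℝ, 0 < N → N < 4 → 0 < N / (2 * t) ∧ N / (2 * t) < 1 ∧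
      -(2 * t * (N / (2 * t))) = -N := by
    intro N hN hN4
    refine ⟨by positivity, ?_, by field_simp⟩
    rw [div_lt_one (by positivity)]; linarith
  refine ⟨?_, ?_, ?_⟩
  · obtain ⟨m0, m1, me⟩ := hm 1 (by norm_num) (by norm_num)
    refine dw_final 1 t ε _ (by norm_num) (by linarith) hε (by linarith) hr0 ?_
    have := (hpt _ m0 m1).1
    rw [me, ← one_mul (Real.exp (-1))] at this
    have := dw_alg _ _ _ 1 _ m0 m1 (Real.exp_pos _).le (by norm_num) (by linarith) this
    simpa using this
  · obtain ⟨m0, m1, me⟩ := hm 2 (by norm_num) (by norm_num)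
    refine dw_final 2 t ε _ (by norm_num) (by linarith) hε (by linarith) hr1 ?_
    have := (hpt _ m0 m1).2.1
    rw [me] at this
    have := dw_alg _ _ _ (2 / (2 * t)) _ m0 m1 (Real.exp_pos _).le m0.le le_rfl this
    rw [Real.rpow_ofNat, sq (2 / (2 * t))]
    exact this
  · obtain ⟨m0, m1, me⟩ := hm 3 (by norm_num) (by norm_num)
    refine dw_final 3 t ε _ (by norm_num) (by linarith) hε (by linarith) hr2 ?_
    have := (hpt _ m0 m1).2.2
    rw [me] at this
    have := dw_alg _ _ _ ((3 / (2 * t)) ^ 2) _ m0 m1 (Real.exp_pos _).le (by positivity)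
      (by nlinarith [sq_nonneg (3 / (2 * t))]) this
    rw [Real.rpow_ofNat, pow_succ (3 / (2 * t)) 2]
    exact this
end

section
/- Fix d ≥ 1. There exists c > 0 such that for every measurable F = (F₀, F₁) : ℝ^d → ℂ² with N(F)² := ∫_{ℝ^d} ( (‖ξ‖²+1)|F₀(ξ)|² + |F₁(ξ)|² ) dξ < ∞ and every t ≥ 1, with û(t,ξ) := (exp(tM(ξ))F(ξ))₀, v̂(t,ξ) := (exp(tM(ξ))F(ξ))₁ and û₀(t,ξ) := e^{−t‖ξ‖²}(F₀(ξ)+F₁(ξ)): (∫ |û(t,ξ) − û₀(t,ξ)|² dξ)^{1/2} ≤ c t^{−1} N(F), (∫ ‖ξ‖² |û(t,ξ) − û₀(t,ξ)|² dξ)^{1/2} ≤ c t^{−3/2} N(F), and (∫ |v̂(t,ξ) + ‖ξ‖² û₀(t,ξ)|² dξ)^{1/2} ≤ c t^{−2} N(F). -/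
open MeasureTheory

/-- The Fourier-side integrand of the squared `H¹ ⊕ L²` norm of data `F = (F₀, F₁)`. -/
noncomputable def Nint (d : ℕ) (F : EuclideanSpace ℝ (Fin d) → Fin 2 → ℂ)
    (ξ : EuclideanSpace ℝ (Fin d)) : ℝ :=
  (‖ξ‖ ^ 2 + 1) * ‖F ξ 0‖ ^ 2 + ‖F ξ 1‖ ^ 2


/-- Polynomial-vs-exponential bound. -/
lemma dw_pow_le_exp (n : ℕ) (x : ℝ) (hx : 0 ≤ x) : x ^ n ≤ n.factorial * Real.exp x := by
  have h := Real.pow_div_factorial_le_exp x hx n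
  have hf : (0 : ℝ) < n.factorial := by exact_mod_cast n.factorial_pos
  rw [div_le_iff₀ hf] at h
  linarith

/-- Scalar linear ODE. -/
lemma dw_scalar (y : ℝ → ℂ) (k : ℝ) (hy : ∀ τ, HasDerivAt y (-(k : ℂ) * y τ) τ) (t : ℝ) :
    y t = (Real.exp (-(k * t)) : ℂ) * y 0 := by
  have hd : ∀ τ : ℝ, HasDerivAt (fun τ : ℝ => Complex.exp ((k : ℂ) * τ) * y τ) 0 τ := by
    intro τ
    have h1 : HasDerivAt (fun τ : ℝ => (k : ℂ) * (τ : ℂ)) (k : ℂ) τ := by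
      simpa using (Complex.ofRealCLM.hasDerivAt (x := τ)).const_mul (k : ℂ)
    have h2 := h1.cexp.mul (hy τ)
    exact h2.congr_deriv (by ring)
  have hc := is_const_of_deriv_eq_zero (fun τ => (hd τ).differentiableAt)
    (fun τ => (hd τ).deriv) t 0
  simp only [Complex.ofReal_zero, mul_zero, Complex.exp_zero, one_mul] at hc
  rw [← hc, ← mul_assoc]
  push_cast
  rw [← Complex.exp_add]
  simp

set_option maxHeartbeats 2000000 in
lemma dw_low (u v : ℝ → ℂ) (s a : ℝ) (ha0 : 0 ≤ a) (ha1 : a ≤ 1 / 4) (hs : s = a * (1 - a))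
    (hu : ∀ τ, HasDerivAt u (v τ) τ) (hv : ∀ τ, HasDerivAt v (-(s : ℂ) * u τ - v τ) τ)
    (t : ℝ) (ht : 1 ≤ t) :
    t * ‖u t - (Real.exp (-(t * s)) : ℂ) * (u 0 + v 0)‖
        ≤ 24 * Real.exp (-(a * t / 4)) * (‖u 0‖ + ‖v 0‖) ∧
    t ^ 2 * ‖v t + (s : ℂ) * ((Real.exp (-(t * s)) : ℂ) * (u 0 + v 0))‖
        ≤ 120 * (‖u 0‖ + ‖v 0‖) := by
  have hsC : (s : ℂ) = a * (1 - a) := by rw [hs]; push_cast; ring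
  have hy := dw_scalar (fun τ => v τ + ((1 - a : ℝ) : ℂ) * u τ) a (by
    intro τ
    exact ((hv τ).add ((hu τ).const_mul ((1 - a : ℝ) : ℂ))).congr_deriv (by
      rw [hsC]; push_cast; ring)) t
  have hz := dw_scalar (fun τ => v τ + (a : ℂ) * u τ) (1 - a) (by
    intro τ
    exact ((hv τ).add ((hu τ).const_mul (a : ℂ))).congr_deriv (by
      rw [hsC]; push_cast; ring)) t
  set e1 := Real.exp (-(a * t)) with he1
  set e2 := Real.exp (-((1 - a) * t)) with he2
  set h := Real.exp (-(t * s)) with hh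
  set g := Real.exp (-(3 / 4 * (a * t))) with hg
  set X := ‖u 0‖ + ‖v 0‖ with hX
  have hb0 : 0 ≤ a * t := by positivity
  have e1g : e1 ≤ g := Real.exp_le_exp.2 (by linarith)
  have hhg : h ≤ g := Real.exp_le_exp.2 (by rw [hs]; nlinarith)
  have e1h : e1 ≤ h := Real.exp_le_exp.2 (by rw [hs]; nlinarith)
  have e1p : 0 < e1 := Real.exp_pos _
  have e2p : 0 < e2 := Real.exp_pos _
  have hp : 0 < h := Real.exp_pos _
  have gp : 0 < g := Real.exp_pos _
  have e2le : e2 ≤ Real.exp (-(3 / 4 * t)) := Real.exp_le_exp.2 (by nlinarith)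
  have hdiff : h - e1 ≤ a ^ 2 * t * g := by
    have h1 : e1 = h * Real.exp (-(a ^ 2 * t)) := by
      rw [he1, hh, ← Real.exp_add, hs]; congr 1; ring
    have h2 := Real.add_one_le_exp (-(a ^ 2 * t))
    have h3 : 0 ≤ a ^ 2 * t := by positivity
    calc h - e1 = h * (1 - Real.exp (-(a ^ 2 * t))) := by rw [h1]; ring
      _ ≤ h * (a ^ 2 * t) := by gcongr; linarith
      _ ≤ g * (a ^ 2 * t) := by gcongr
      _ = _ := by ring
  -- the inverse of the eigenvalue gap
  obtain ⟨r, hr⟩ : ∃ r : ℝ, r = (1 - 2 * a)⁻¹ := ⟨_, rfl⟩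
  have hq : (0 : ℝ) < 1 - 2 * a := by linarith
  have hr1 : r * (1 - 2 * a) = 1 := by rw [hr]; field_simp
  have hr0 : 0 < r := by rw [hr]; positivity
  have hr2 : r ≤ 2 := by nlinarith
  have hrC : (r : ℂ) * (1 - 2 * a) = 1 := by exact_mod_cast hr1
  have hut : u t = r * (e1 * (v 0 + ((1 - a : ℝ) : ℂ) * u 0) - e2 * (v 0 + a * u 0)) := by
    rw [← hy, ← hz]; push_cast; linear_combination (-u t) * hrC
  have hvt : v t = r * ((1 - a) * (e2 * (v 0 + a * u 0))
      - a * (e1 * (v 0 + ((1 - a : ℝ) : ℂ) * u 0))) := by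
    rw [← hy, ← hz]; push_cast; linear_combination (-v t) * hrC
  have hrr : r - 1 = 2 * a * r := by linarith
  have hrrC : (r : ℂ) - 1 = 2 * a * r := by exact_mod_cast hrr
  have hP : ‖u 0 + v 0‖ ≤ X := norm_add_le _ _
  have hu0 : ‖u 0‖ ≤ X := by rw [hX]; linarith [norm_nonneg (v 0)]
  have hX0 : 0 ≤ X := by positivity
  have hZ : ‖v 0 + a * u 0‖ ≤ X := by
    refine (norm_add_le _ _).trans ?_
    rw [norm_mul, Complex.norm_real, Real.norm_of_nonneg ha0, hX]
    nlinarith [norm_nonneg (u 0)]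
  have hD : u t - (h : ℂ) * (u 0 + v 0) = ((2 * a * r * e1 - (h - e1) : ℝ) : ℂ) * (u 0 + v 0)
      + ((-(r * e1 * a) : ℝ) : ℂ) * u 0 + ((-(r * e2) : ℝ) : ℂ) * (v 0 + a * u 0) := by
    rw [hut]; push_cast; linear_combination (e1 : ℂ) * (u 0 + v 0) * hrrC
  have hV : v t + (s : ℂ) * ((h : ℂ) * (u 0 + v 0)) =
      ((-a * (2 * a * r * e1 - (h - e1)) - a ^ 2 * h : ℝ) : ℂ) * (u 0 + v 0)
      + ((r * e1 * a ^ 2 : ℝ) : ℂ) * u 0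
      + ((r * e2 * (1 - a) : ℝ) : ℂ) * (v 0 + a * u 0) := by
    rw [hvt, hsC]; push_cast; linear_combination (-a : ℂ) * (e1 : ℂ) * (u 0 + v 0) * hrrC
  have hre1 : r * e1 ≤ 2 * g := mul_le_mul hr2 e1g e1p.le (by norm_num)
  have hc1 : |2 * a * r * e1 - (h - e1)| ≤ (4 * a + a ^ 2 * t) * g := by
    have : a * (r * e1) ≤ a * (2 * g) := by gcongr
    have h0 : 0 ≤ a * (r * e1) := by positivity
    have h1 : 0 ≤ a ^ 2 * t * g := by positivity
    rw [abs_le]; constructor <;> nlinarith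
  have hnorm : ∀ (c C : ℝ) (w : ℂ), |c| ≤ C → ‖w‖ ≤ X → ‖(c : ℂ) * w‖ ≤ C * X := by
    intro c C w h1 h2
    rw [norm_mul, Complex.norm_real, Real.norm_eq_abs]
    exact mul_le_mul h1 h2 (norm_nonneg _) ((abs_nonneg _).trans h1)
  have hDle : ‖u t - (h : ℂ) * (u 0 + v 0)‖ ≤ ((6 * a + a ^ 2 * t) * g + 2 * e2) * X := by
    rw [hD]
    refine (norm_add₃_le).trans ?_
    have h1 := hnorm _ _ _ hc1 hP
    have h2 := hnorm (-(r * e1 * a)) (2 * g * a) (u 0) (by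
      rw [abs_neg, abs_of_nonneg (by positivity)]; gcongr) hu0
    have h3 := hnorm (-(r * e2)) (2 * e2) _ (by
      rw [abs_neg, abs_of_nonneg (by positivity)]; gcongr) hZ
    linarith
  have hVle : ‖v t + (s : ℂ) * ((h : ℂ) * (u 0 + v 0))‖
      ≤ ((7 * a ^ 2 + a ^ 3 * t) * g + 2 * e2) * X := by
    rw [hV]
    refine (norm_add₃_le).trans ?_
    have h1 := hnorm (-a * (2 * a * r * e1 - (h - e1)) - a ^ 2 * h)
      (a * ((4 * a + a ^ 2 * t) * g) + a ^ 2 * g) _ (by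
      refine (abs_sub _ _).trans ?_
      rw [abs_mul, abs_neg, abs_of_nonneg ha0, abs_of_nonneg (by positivity : 0 ≤ a ^ 2 * h)]
      gcongr) hP
    have h2 := hnorm (r * e1 * a ^ 2) (2 * g * a ^ 2) (u 0) (by
      rw [abs_of_nonneg (by positivity)]; gcongr) hu0
    have h3 := hnorm (r * e2 * (1 - a)) (2 * e2) _ (by
      have : 0 ≤ 1 - a := by linarith
      rw [abs_of_nonneg (by positivity)]
      calc r * e2 * (1 - a) ≤ 2 * e2 * 1 := by gcongr; linarith
        _ = _ := by ring) hZ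
    linarith
  -- scalar bounds
  obtain ⟨b, hb⟩ : ∃ b : ℝ, b = a * t := ⟨_, rfl⟩
  rw [← hb] at hb0 hg ⊢
  set m := Real.exp (-(b / 4)) with hm
  have hm1 : m ≤ 1 := Real.exp_le_one_iff.2 (by linarith)
  have gE : g * Real.exp (b / 2) = m := by rw [hg, hm, ← Real.exp_add]; congr 1; ring
  have b1 := dw_pow_le_exp 1 (b / 2) (by linarith)
  have b2 := dw_pow_le_exp 2 (b / 2) (by linarith)
  have b3 := dw_pow_le_exp 3 (b / 2) (by linarith)
  have t1 := dw_pow_le_exp 1 (t / 2) (by linarith)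
  have t2 := dw_pow_le_exp 2 (t / 2) (by linarith)
  norm_num [Nat.factorial] at b1 b2 b3 t1 t2
  have eE : e2 * Real.exp (t / 2) ≤ m := by
    calc e2 * Real.exp (t / 2) ≤ Real.exp (-(3 / 4 * t)) * Real.exp (t / 2) := by gcongr
      _ = Real.exp (-(t / 4)) := by rw [← Real.exp_add]; congr 1; ring
      _ ≤ m := Real.exp_le_exp.2 (by
        have : a * t ≤ 1 * t := mul_le_mul_of_nonneg_right (by linarith) (by linarith)
        linarith)
  constructor
  · have k1 : g * (6 * b + b ^ 2) ≤ g * (20 * Real.exp (b / 2)) := by gcongr; nlinarith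
    have k2 : e2 * (2 * t) ≤ e2 * (4 * Real.exp (t / 2)) :=
      mul_le_mul_of_nonneg_left (by linarith) e2p.le
    have k3 : t * ((6 * a + a ^ 2 * t) * g + 2 * e2) ≤ 24 * m := by
      calc _ = g * (6 * b + b ^ 2) + e2 * (2 * t) := by rw [hb]; ring
        _ ≤ 24 * m := by linarith
    calc _ ≤ t * (((6 * a + a ^ 2 * t) * g + 2 * e2) * X) := by gcongr
      _ = (t * ((6 * a + a ^ 2 * t) * g + 2 * e2)) * X := by ring
      _ ≤ _ := by gcongr
  · have k1 : g * (7 * b ^ 2 + b ^ 3) ≤ g * (104 * Real.exp (b / 2)) := by gcongr; nlinarith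
    have k2 : e2 * (2 * t ^ 2) ≤ e2 * (16 * Real.exp (t / 2)) :=
      mul_le_mul_of_nonneg_left (by linarith) e2p.le
    have k3 : t ^ 2 * ((7 * a ^ 2 + a ^ 3 * t) * g + 2 * e2) ≤ 120 := by
      calc _ = g * (7 * b ^ 2 + b ^ 3) + e2 * (2 * t ^ 2) := by rw [hb]; ring
        _ ≤ 120 := by linarith
    calc _ ≤ t ^ 2 * (((7 * a ^ 2 + a ^ 3 * t) * g + 2 * e2) * X) := by gcongr
      _ = (t ^ 2 * ((7 * a ^ 2 + a ^ 3 * t) * g + 2 * e2)) * X := by ring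
      _ ≤ _ := by gcongr

lemma dw_energy (u v : ℝ → ℂ) (s : ℝ) (hs : 3 / 16 ≤ s)
    (hu : ∀ τ, HasDerivAt u (v τ) τ) (hv : ∀ τ, HasDerivAt v (-(s : ℂ) * u τ - v τ) τ)
    (t : ℝ) (ht : 1 ≤ t) :
    t ^ 4 * (‖v t‖ ^ 2 / 2 + s * ‖u t‖ ^ 2)
      ≤ 60000 * ((s + 1) * ‖u 0‖ ^ 2 + ‖v 0‖ ^ 2) := by
  set p : ℝ → ℝ := fun τ => (u τ).re
  set q : ℝ → ℝ := fun τ => (u τ).im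
  set p' : ℝ → ℝ := fun τ => (v τ).re
  set q' : ℝ → ℝ := fun τ => (v τ).im
  have hp : ∀ τ, HasDerivAt p (p' τ) τ := fun τ =>
    Complex.reCLM.hasFDerivAt.comp_hasDerivAt τ (hu τ)
  have hq : ∀ τ, HasDerivAt q (q' τ) τ := fun τ =>
    Complex.imCLM.hasFDerivAt.comp_hasDerivAt τ (hu τ)
  have hp' : ∀ τ, HasDerivAt p' (-s * p τ - p' τ) τ := fun τ => by
    have := Complex.reCLM.hasFDerivAt.comp_hasDerivAt τ (hv τ)
    exact this.congr_deriv (by simp [p, p'])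
  have hq' : ∀ τ, HasDerivAt q' (-s * q τ - q' τ) τ := fun τ => by
    have := Complex.imCLM.hasFDerivAt.comp_hasDerivAt τ (hv τ)
    exact this.congr_deriv (by simp [q, q'])
  set G : ℝ → ℝ := fun τ => (p' τ ^ 2 + q' τ ^ 2) + (s + 1 / 2) * (p τ ^ 2 + q τ ^ 2)
    + (p τ * p' τ + q τ * q' τ) with hG
  have hGd : ∀ τ, HasDerivAt G (-((p' τ ^ 2 + q' τ ^ 2) + s * (p τ ^ 2 + q τ ^ 2))) τ := by
    intro τ
    have := ((((hp' τ).pow 2).add ((hq' τ).pow 2)).add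
      ((((hp τ).pow 2).add ((hq τ).pow 2)).const_mul (s + 1 / 2))).add
      (((hp τ).mul (hp' τ)).add ((hq τ).mul (hq' τ)))
    exact this.congr_deriv (by push_cast; ring)
  have hH : ∀ τ, HasDerivAt (fun τ => Real.exp (3 / 19 * τ) * G τ)
      (Real.exp (3 / 19 * τ) * (3 / 19) * G τ + Real.exp (3 / 19 * τ) *
      (-((p' τ ^ 2 + q' τ ^ 2) + s * (p τ ^ 2 + q τ ^ 2)))) τ := by
    intro τ
    have h1 : HasDerivAt (fun τ : ℝ => 3 / 19 * τ) (3 / 19 : ℝ) τ := by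
      simpa using (hasDerivAt_id τ).const_mul (3 / 19 : ℝ)
    exact h1.exp.mul (hGd τ)
  have hanti : Antitone (fun τ => Real.exp (3 / 19 * τ) * G τ) := by
    apply antitone_of_deriv_nonpos (fun τ => (hH τ).differentiableAt)
    intro τ
    rw [(hH τ).deriv]
    have : 3 / 19 * G τ ≤ (p' τ ^ 2 + q' τ ^ 2) + s * (p τ ^ 2 + q τ ^ 2) := by
      simp only [hG]
      nlinarith [sq_nonneg (p τ - p' τ), sq_nonneg (q τ - q' τ),
        mul_nonneg (sub_nonneg.2 hs) (sq_nonneg (p τ)),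
        mul_nonneg (sub_nonneg.2 hs) (sq_nonneg (q τ))]
    nlinarith [Real.exp_pos (3 / 19 * τ)]
  have h0 := hanti (show (0 : ℝ) ≤ t by linarith)
  simp only [mul_zero, Real.exp_zero, one_mul] at h0
  have hn : ∀ z : ℂ, ‖z‖ ^ 2 = z.re ^ 2 + z.im ^ 2 := fun z => by
    rw [← Complex.normSq_eq_norm_sq, Complex.normSq_apply]; ring
  have hlow : ‖v t‖ ^ 2 / 2 + s * ‖u t‖ ^ 2 ≤ G t := by
    rw [hn, hn]; simp only [hG, p, q, p', q']
    nlinarith [sq_nonneg ((u t).re + (v t).re), sq_nonneg ((u t).im + (v t).im)]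
  have hup : G 0 ≤ 3 / 2 * ((s + 1) * ‖u 0‖ ^ 2 + ‖v 0‖ ^ 2) := by
    rw [hn, hn]; simp only [hG, p, q, p', q']
    nlinarith [sq_nonneg ((u 0).re - (v 0).re), sq_nonneg ((u 0).im - (v 0).im),
        mul_nonneg (sub_nonneg.2 hs) (sq_nonneg (u 0).re),
        mul_nonneg (sub_nonneg.2 hs) (sq_nonneg (u 0).im), sq_nonneg (u 0).re,
        sq_nonneg (u 0).im]
  have t4 := dw_pow_le_exp 4 (3 / 19 * t) (by linarith)
  norm_num [Nat.factorial] at t4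
  have t4' : t ^ 4 ≤ 40000 * Real.exp (3 / 19 * t) := by
    have := Real.exp_pos (3 / 19 * t)
    have e : (3 / 19 * t) ^ 4 = 81 / 130321 * t ^ 4 := by ring
    rw [e] at t4
    nlinarith
  have hG0 : 0 ≤ G t := le_trans (by have : 0 ≤ s := by linarith
                                     positivity) hlow
  calc _ ≤ t ^ 4 * G t := by gcongr
    _ ≤ (40000 * Real.exp (3 / 19 * t)) * G t := by gcongr
    _ = 40000 * (Real.exp (3 / 19 * t) * G t) := by ring
    _ ≤ 40000 * G 0 := by gcongr
    _ ≤ _ := by linarith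

lemma dw_heat (s t : ℝ) (hs : 3 / 16 ≤ s) (ht : 1 ≤ t) (k : ℕ) (hk : k ≤ 2) :
    t ^ 4 * s ^ k * Real.exp (-(t * s)) ^ 2 ≤ 1300 := by
  have hs0 : 0 < s := by linarith
  have h4 := dw_pow_le_exp 4 (2 * (t * s)) (by positivity)
  norm_num [Nat.factorial] at h4
  have hE : Real.exp (-(t * s)) ^ 2 = (Real.exp (2 * (t * s)))⁻¹ := by
    rw [← Real.exp_nat_mul, ← Real.exp_neg]; congr 1; push_cast; ring
  rw [hE, ← div_eq_mul_inv, div_le_iff₀ (Real.exp_pos _)]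
  have key : s ^ k ≤ (16 / 3) ^ 4 * s ^ 4 := by
    have h1 : 1 ≤ 16 / 3 * s := by linarith
    have hsk : s ^ 4 = s ^ k * s ^ (4 - k) := by rw [← pow_add]; congr 1; omega
    calc s ^ k = s ^ k * 1 := by ring
      _ ≤ s ^ k * ((16 / 3 * s) ^ (4 - k) * (16 / 3) ^ k) := by
        gcongr
        exact one_le_mul_of_one_le_of_one_le (one_le_pow₀ h1) (one_le_pow₀ (by norm_num))
      _ = _ := by
        rw [hsk, mul_pow]
        have : ((16 : ℝ) / 3) ^ 4 = (16 / 3) ^ (4 - k) * (16 / 3) ^ k := by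
          rw [← pow_add]; congr 1; omega
        rw [this]; ring
  have : t ^ 4 * s ^ k ≤ t ^ 4 * ((16 / 3) ^ 4 * s ^ 4) := by gcongr
  have e : (2 * (t * s)) ^ 4 = 16 * (t ^ 4 * s ^ 4) := by ring
  rw [e] at h4
  nlinarith [Real.exp_pos (2 * (t * s))]

lemma dw_pointwise_s6 (u v : ℝ → ℂ) (s : ℝ) (hs : 0 ≤ s)
    (hu : ∀ τ, HasDerivAt u (v τ) τ) (hv : ∀ τ, HasDerivAt v (-(s : ℂ) * u τ - v τ) τ)
    (t : ℝ) (ht : 1 ≤ t) :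
    t ^ 2 * ‖u t - (Real.exp (-(t * s)) : ℂ) * (u 0 + v 0)‖ ^ 2
        ≤ 1000 ^ 2 * ((s + 1) * ‖u 0‖ ^ 2 + ‖v 0‖ ^ 2) ∧
    t ^ 3 * (s * ‖u t - (Real.exp (-(t * s)) : ℂ) * (u 0 + v 0)‖ ^ 2)
        ≤ 1000 ^ 2 * ((s + 1) * ‖u 0‖ ^ 2 + ‖v 0‖ ^ 2) ∧
    t ^ 4 * ‖v t + (s : ℂ) * ((Real.exp (-(t * s)) : ℂ) * (u 0 + v 0))‖ ^ 2
        ≤ 1000 ^ 2 * ((s + 1) * ‖u 0‖ ^ 2 + ‖v 0‖ ^ 2) := by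
  set N := (s + 1) * ‖u 0‖ ^ 2 + ‖v 0‖ ^ 2 with hN
  have hN0 : 0 ≤ N := by positivity
  have hX2 : (‖u 0‖ + ‖v 0‖) ^ 2 ≤ 2 * N := by
    rw [hN]; nlinarith [sq_nonneg (‖u 0‖ - ‖v 0‖), mul_nonneg hs (sq_nonneg ‖u 0‖)]
  rcases le_total s (3 / 16) with hl | hh
  · obtain ⟨a, ha0, ha1, hsa⟩ : ∃ a : ℝ, 0 ≤ a ∧ a ≤ 1 / 4 ∧ s = a * (1 - a) := by
      have hsq : Real.sqrt (1 - 4 * s) ^ 2 = 1 - 4 * s := Real.sq_sqrt (by linarith)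
      have hsq0 := Real.sqrt_nonneg (1 - 4 * s)
      refine ⟨(1 - Real.sqrt (1 - 4 * s)) / 2, ?_, ?_, ?_⟩ <;> nlinarith
    obtain ⟨h1, h2⟩ := dw_low u v s a ha0 ha1 hsa hu hv t ht
    set D := ‖u t - (Real.exp (-(t * s)) : ℂ) * (u 0 + v 0)‖ with hD
    set V := ‖v t + (s : ℂ) * ((Real.exp (-(t * s)) : ℂ) * (u 0 + v 0))‖ with hV
    set X := ‖u 0‖ + ‖v 0‖ with hX
    have hD0 : 0 ≤ D := norm_nonneg _
    have hV0 : 0 ≤ V := norm_nonneg _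
    have hX0 : 0 ≤ X := by positivity
    set m := Real.exp (-(a * t / 4)) with hm
    have hm0 : 0 < m := Real.exp_pos _
    have hb0 : 0 ≤ a * t := by positivity
    have hm1 : m ≤ 1 := Real.exp_le_one_iff.2 (by linarith)
    have hmm : m ^ 2 ≤ 1 := by nlinarith
    have hDD : (t * D) ^ 2 ≤ 576 * m ^ 2 * X ^ 2 := by
      calc (t * D) ^ 2 ≤ (24 * m * X) ^ 2 := by gcongr
        _ = _ := by ring
    have hbm : a * t * m ^ 2 ≤ 2 := by
      have : m ^ 2 * Real.exp (a * t / 2) = 1 := by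
        rw [hm, ← Real.exp_nat_mul, ← Real.exp_add]
        rw [Real.exp_eq_one_iff]; push_cast; ring
      have h3 := dw_pow_le_exp 1 (a * t / 2) (by linarith)
      norm_num at h3
      nlinarith [mul_le_mul_of_nonneg_left h3 (sq_nonneg m)]
    have hX20 := sq_nonneg X
    refine ⟨?_, ?_, ?_⟩
    · calc t ^ 2 * D ^ 2 = (t * D) ^ 2 := by ring
        _ ≤ 576 * m ^ 2 * X ^ 2 := hDD
        _ ≤ 576 * 1 * (2 * N) := by gcongr
        _ ≤ _ := by linarith
    · have hsa' : s ≤ a := by nlinarith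
      calc t ^ 3 * (s * D ^ 2) = s * (t * (t * D) ^ 2) := by ring
        _ ≤ a * (t * (576 * m ^ 2 * X ^ 2)) := by gcongr
        _ = 576 * (a * t * m ^ 2) * X ^ 2 := by ring
        _ ≤ 576 * 2 * (2 * N) := by gcongr
        _ ≤ _ := by linarith
    · calc t ^ 4 * V ^ 2 = (t ^ 2 * V) ^ 2 := by ring
        _ ≤ (120 * X) ^ 2 := by gcongr
        _ = 14400 * X ^ 2 := by ring
        _ ≤ 14400 * (2 * N) := by gcongr
        _ ≤ _ := by linarith
  · have hE := dw_energy u v s hh hu hv t ht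
    have hP : ‖u 0 + v 0‖ ^ 2 ≤ 2 * N :=
      le_trans (by gcongr; exact norm_add_le _ _) hX2
    have hP0 := sq_nonneg ‖u 0 + v 0‖
    set h := Real.exp (-(t * s)) with hhd
    have hh0 : 0 < h := Real.exp_pos _
    have hk : ∀ k ≤ 2, t ^ 4 * s ^ k * (h ^ 2 * ‖u 0 + v 0‖ ^ 2) ≤ 2600 * N := by
      intro k hk
      calc _ = (t ^ 4 * s ^ k * h ^ 2) * ‖u 0 + v 0‖ ^ 2 := by ring
        _ ≤ 1300 * (2 * N) := mul_le_mul (dw_heat s t hh ht k hk) hP hP0 (by norm_num)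
        _ = _ := by ring
    have k0 := hk 0 (by norm_num)
    have k1 := hk 1 (by norm_num)
    have k2 := hk 2 (by norm_num)
    have hsum : ∀ x y : ℂ, ‖x + y‖ ^ 2 ≤ 2 * ‖x‖ ^ 2 + 2 * ‖y‖ ^ 2 := fun x y => by
      have := norm_add_le x y
      nlinarith [norm_nonneg (x + y), sq_nonneg (‖x‖ - ‖y‖), norm_nonneg x, norm_nonneg y]
    have hD : ‖u t - (h : ℂ) * (u 0 + v 0)‖ ^ 2 ≤
        2 * ‖u t‖ ^ 2 + 2 * (h ^ 2 * ‖u 0 + v 0‖ ^ 2) := by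
      rw [sub_eq_add_neg]
      refine (hsum _ _).trans (le_of_eq ?_)
      rw [norm_neg, norm_mul, Complex.norm_real, Real.norm_of_nonneg hh0.le, mul_pow]
    have hV : ‖v t + (s : ℂ) * ((h : ℂ) * (u 0 + v 0))‖ ^ 2 ≤
        2 * ‖v t‖ ^ 2 + 2 * (s ^ 2 * (h ^ 2 * ‖u 0 + v 0‖ ^ 2)) := by
      refine (hsum _ _).trans (le_of_eq ?_)
      rw [norm_mul, norm_mul, Complex.norm_real, Complex.norm_real,
        Real.norm_of_nonneg hh0.le, Real.norm_of_nonneg hs, mul_pow, mul_pow]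
    have ht4 : 0 ≤ t ^ 4 := by positivity
    have eu : t ^ 4 * (s * ‖u t‖ ^ 2) ≤ 60000 * N := by
      have : 0 ≤ t ^ 4 * (‖v t‖ ^ 2 / 2) := by positivity
      linarith
    have ev : t ^ 4 * ‖v t‖ ^ 2 ≤ 120000 * N := by
      have : 0 ≤ t ^ 4 * (s * ‖u t‖ ^ 2) := by positivity
      linarith
    have eu' : t ^ 4 * ‖u t‖ ^ 2 ≤ 320000 * N := by
      have : 3 / 16 * (t ^ 4 * ‖u t‖ ^ 2) ≤ s * (t ^ 4 * ‖u t‖ ^ 2) := by gcongr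
      linarith
    refine ⟨?_, ?_, ?_⟩
    · calc _ ≤ t ^ 4 * ‖u t - (h : ℂ) * (u 0 + v 0)‖ ^ 2 := by
            gcongr
            norm_num
        _ ≤ t ^ 4 * (2 * ‖u t‖ ^ 2 + 2 * (h ^ 2 * ‖u 0 + v 0‖ ^ 2)) := by gcongr
        _ ≤ _ := by linarith
    · calc _ ≤ t ^ 4 * (s * ‖u t - (h : ℂ) * (u 0 + v 0)‖ ^ 2) := by
            gcongr
            norm_num
        _ ≤ t ^ 4 * (s * (2 * ‖u t‖ ^ 2 + 2 * (h ^ 2 * ‖u 0 + v 0‖ ^ 2))) := by gcongr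
        _ ≤ _ := by linarith
    · calc _ ≤ t ^ 4 * (2 * ‖v t‖ ^ 2 + 2 * (s ^ 2 * (h ^ 2 * ‖u 0 + v 0‖ ^ 2))) := by gcongr
        _ ≤ _ := by linarith

section deriv
attribute [local instance] Matrix.linftyOpNormedRing Matrix.linftyOpNormedAlgebra

lemma dw_hasDeriv (d : ℕ) (ξ : EuclideanSpace ℝ (Fin d)) (τ : ℝ) :
    HasDerivAt (fun τ : ℝ => dwProp d τ ξ) (dwSymbol d ξ * dwProp d τ ξ) τ := by
  have h := hasDerivAt_exp_smul_const' (𝕂 := ℂ) (dwSymbol d ξ) (τ : ℂ)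
  have h2 := h.scomp τ (Complex.ofRealCLM.hasDerivAt (x := τ))
  simp only [Complex.ofRealCLM_apply, Complex.ofReal_one, one_smul] at h2
  exact h2

lemma dw_hasDeriv_vec (d : ℕ) (ξ : EuclideanSpace ℝ (Fin d)) (w : Fin 2 → ℂ) (i : Fin 2)
    (τ : ℝ) :
    HasDerivAt (fun τ : ℝ => (dwProp d τ ξ).mulVec w i)
      ((dwSymbol d ξ).mulVec ((dwProp d τ ξ).mulVec w) i) τ := by
  let L : Matrix (Fin 2) (Fin 2) ℂ →ₗ[ℝ] ℂ :=
    { toFun := fun A => A.mulVec w i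
      map_add' := fun A B => by simp [Matrix.add_mulVec]
      map_smul' := fun c A => by simp [Matrix.smul_mulVec] }
  have h := (LinearMap.toContinuousLinearMap L).hasFDerivAt.comp_hasDerivAt τ (dw_hasDeriv d ξ τ)
  rw [Matrix.mulVec_mulVec]
  exact h
end deriv

lemma dw_pt (d : ℕ) (F : EuclideanSpace ℝ (Fin d) → Fin 2 → ℂ) (ξ : EuclideanSpace ℝ (Fin d))
    (t : ℝ) (ht : 1 ≤ t) :
    t ^ 2 * ‖(dwProp d t ξ).mulVec (F ξ) 0
        - (Real.exp (-(t * ‖ξ‖ ^ 2)) : ℂ) * (F ξ 0 + F ξ 1)‖ ^ 2 ≤ 1000 ^ 2 * Nint d F ξ ∧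
    t ^ 3 * (‖ξ‖ ^ 2 * ‖(dwProp d t ξ).mulVec (F ξ) 0
        - (Real.exp (-(t * ‖ξ‖ ^ 2)) : ℂ) * (F ξ 0 + F ξ 1)‖ ^ 2) ≤ 1000 ^ 2 * Nint d F ξ ∧
    t ^ 4 * ‖(dwProp d t ξ).mulVec (F ξ) 1
        + ((‖ξ‖ ^ 2 : ℝ) : ℂ) * ((Real.exp (-(t * ‖ξ‖ ^ 2)) : ℂ) * (F ξ 0 + F ξ 1))‖ ^ 2
        ≤ 1000 ^ 2 * Nint d F ξ := by
  have h := dw_pointwise_s6 (fun τ => (dwProp d τ ξ).mulVec (F ξ) 0)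
    (fun τ => (dwProp d τ ξ).mulVec (F ξ) 1) (‖ξ‖ ^ 2) (by positivity)
    (fun τ => by
      exact (dw_hasDeriv_vec d ξ (F ξ) 0 τ).congr_deriv (by
        simp [dwSymbol, Matrix.mulVec, dotProduct, Fin.sum_univ_two]))
    (fun τ => by
      exact (dw_hasDeriv_vec d ξ (F ξ) 1 τ).congr_deriv (by
        simp [dwSymbol, Matrix.mulVec, dotProduct, Fin.sum_univ_two]
        ring)) t ht
  have h0 : dwProp d 0 ξ = 1 := by simp [dwProp]
  simp only [h0, Matrix.one_mulVec] at h
  exact h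

lemma dw_int (d : ℕ) (F : EuclideanSpace ℝ (Fin d) → Fin 2 → ℂ) (hF : Integrable (Nint d F))
    (f : EuclideanSpace ℝ (Fin d) → ℝ) (hf : ∀ ξ, 0 ≤ f ξ) (t r : ℝ) (n : ℕ) (ht : 1 ≤ t)
    (hr : 0 ≤ r) (hrn : r ^ 2 * t ^ n = 1) (hle : ∀ ξ, t ^ n * f ξ ≤ 1000 ^ 2 * Nint d F ξ) :
    Real.sqrt (∫ ξ, f ξ) ≤ 1000 * r * Real.sqrt (∫ ξ, Nint d F ξ) := by
  have h1 : ∫ ξ, f ξ ≤ ∫ ξ, (1000 * r) ^ 2 * Nint d F ξ := by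
    apply integral_mono_of_nonneg (Filter.Eventually.of_forall hf) (hF.const_mul _)
    refine Filter.Eventually.of_forall fun ξ => ?_
    calc f ξ = r ^ 2 * (t ^ n * f ξ) := by rw [← mul_assoc, hrn, one_mul]
      _ ≤ r ^ 2 * (1000 ^ 2 * Nint d F ξ) := mul_le_mul_of_nonneg_left (hle ξ) (sq_nonneg r)
      _ = _ := by ring
  rw [integral_const_mul] at h1
  calc _ ≤ Real.sqrt ((1000 * r) ^ 2 * ∫ ξ, Nint d F ξ) := Real.sqrt_le_sqrt h1
    _ = _ := by rw [Real.sqrt_mul (by positivity), Real.sqrt_sq (by positivity)]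

/-- **Lemma 6.2 (diffusive phenomenon: comparison of the damped wave with the heat flow),
on the Fourier side via Plancherel.** -/
theorem diffusive_phenomenon_fourier_side
    (d : ℕ) (hd : 1 ≤ d) :
    ∃ c : ℝ, 0 < c ∧
      ∀ F : EuclideanSpace ℝ (Fin d) → Fin 2 → ℂ, Measurable F →
        Integrable (Nint d F) → ∀ t : ℝ, 1 ≤ t →
        Real.sqrt (∫ ξ, ‖(dwProp d t ξ).mulVec (F ξ) 0
              - (Real.exp (-(t * ‖ξ‖ ^ 2)) : ℂ) * (F ξ 0 + F ξ 1)‖ ^ 2)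
            ≤ c * t ^ (-(1 : ℝ)) * Real.sqrt (∫ ξ, Nint d F ξ) ∧
        Real.sqrt (∫ ξ, ‖ξ‖ ^ 2 * ‖(dwProp d t ξ).mulVec (F ξ) 0
              - (Real.exp (-(t * ‖ξ‖ ^ 2)) : ℂ) * (F ξ 0 + F ξ 1)‖ ^ 2)
            ≤ c * t ^ (-(3 : ℝ) / 2) * Real.sqrt (∫ ξ, Nint d F ξ) ∧
        Real.sqrt (∫ ξ, ‖(dwProp d t ξ).mulVec (F ξ) 1
              + ((‖ξ‖ ^ 2 : ℝ) : ℂ) * ((Real.exp (-(t * ‖ξ‖ ^ 2)) : ℂ) * (F ξ 0 + F ξ 1))‖ ^ 2)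
            ≤ c * t ^ (-(2 : ℝ)) * Real.sqrt (∫ ξ, Nint d F ξ) := by
  refine ⟨1000, by norm_num, fun F _ hF t ht => ?_⟩
  have ht0 : 0 < t := by linarith
  have hr : ∀ (e : ℝ) (n : ℕ), 2 * e = -n → (t ^ e) ^ 2 * t ^ n = 1 := by
    intro e n he
    rw [← Real.rpow_natCast (t ^ e), ← Real.rpow_natCast t, ← Real.rpow_mul ht0.le,
      ← Real.rpow_add ht0]
    have : e * ((2 : ℕ) : ℝ) + n = 0 := by push_cast; linarith
    rw [this, Real.rpow_zero]
  refine ⟨?_, ?_, ?_⟩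
  · exact dw_int d F hF _ (fun ξ => by positivity) t _ 2 ht (by positivity)
      (hr _ _ (by norm_num)) (fun ξ => (dw_pt d F ξ t ht).1)
  · exact dw_int d F hF _ (fun ξ => by positivity) t _ 3 ht (by positivity)
      (hr _ _ (by norm_num)) (fun ξ => (dw_pt d F ξ t ht).2.1)
  · exact dw_int d F hF _ (fun ξ => by positivity) t _ 4 ht (by positivity)
      (hr _ _ (by norm_num)) (fun ξ => (dw_pt d F ξ t ht).2.2)
end

section
/- Fix d ≥ 1. There exists C > 0 such that for every ξ ∈ ℝ^d with ‖ξ‖ > 1, every t ≥ 0 and every v = (v₀, v₁) ∈ ℂ²: |exp(tM(ξ)) v|_ξ ≤ C e^{−t/2} |v|_ξ, where |w|²_ξ := (‖ξ‖²+1)|w₀|² + |w₁|² for w = (w₀,w₁) ∈ ℂ². -/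
/-- The `ξ`-weighted (energy) norm `|w|_ξ = ((‖ξ‖²+1)|w₀|² + |w₁|²)^{1/2}` on `ℂ²`. -/
noncomputable def xiNorm (d : ℕ) (ξ : EuclideanSpace ℝ (Fin d)) (w : Fin 2 → ℂ) : ℝ :=
  Real.sqrt ((‖ξ‖ ^ 2 + 1) * ‖w 0‖ ^ 2 + ‖w 1‖ ^ 2)

section
attribute [local instance] Matrix.linftyOpNormedRing Matrix.linftyOpNormedAlgebra

/-- The flow `exp(tM)` solves the matrix differential equation. -/
theorem dwProp_hasDerivAt (d : ℕ) (ξ : EuclideanSpace ℝ (Fin d)) (v : Fin 2 → ℂ) (t : ℝ) :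
    HasDerivAt (fun s : ℝ => (dwProp d s ξ).mulVec v)
      ((dwSymbol d ξ).mulVec ((dwProp d t ξ).mulVec v)) t := by
  have h := hasDerivAt_exp_smul_const' (𝕂 := ℝ) (dwSymbol d ξ) t
  have h2 : HasDerivAt (fun s : ℝ => dwProp d s ξ) (dwSymbol d ξ * dwProp d t ξ) t := by
    simp only [dwProp, Complex.coe_smul]
    exact h
  let L : Matrix (Fin 2) (Fin 2) ℂ →ₗ[ℝ] (Fin 2 → ℂ) :=
    { toFun := fun A => A.mulVec v
      map_add' := fun A B => Matrix.add_mulVec A B v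
      map_smul' := fun c A => Matrix.smul_mulVec c A v }
  have h3 := (LinearMap.toContinuousLinearMap L).hasFDerivAt.comp_hasDerivAt t h2
  rw [Matrix.mulVec_mulVec]
  exact h3
end

/-- Modified energy. -/
noncomputable def dwEnergy (r : ℝ) (w : Fin 2 → ℂ) : ℝ :=
  (r ^ 2 - 1 / 4) * ((w 0).re ^ 2 + (w 0).im ^ 2) +
    (((w 1).re + (w 0).re / 2) ^ 2 + ((w 1).im + (w 0).im / 2) ^ 2)

theorem dwEnergy_eq (d : ℕ) (ξ : EuclideanSpace ℝ (Fin d)) (v : Fin 2 → ℂ) (t : ℝ) :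
    Real.exp t * dwEnergy ‖ξ‖ ((dwProp d t ξ).mulVec v) = dwEnergy ‖ξ‖ v := by
  have key : ∀ s : ℝ, HasDerivAt
      (fun s => Real.exp s * dwEnergy ‖ξ‖ ((dwProp d s ξ).mulVec v)) 0 s := by
    intro s
    have hw := hasDerivAt_pi.1 (dwProp_hasDerivAt d ξ v s)
    have a0 := Complex.reCLM.hasFDerivAt.comp_hasDerivAt s (hw 0)
    have b0 := Complex.imCLM.hasFDerivAt.comp_hasDerivAt s (hw 0)
    have a1 := Complex.reCLM.hasFDerivAt.comp_hasDerivAt s (hw 1)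
    have b1 := Complex.imCLM.hasFDerivAt.comp_hasDerivAt s (hw 1)
    have H := (Real.hasDerivAt_exp s).mul
      ((((a0.pow 2).add (b0.pow 2)).const_mul (‖ξ‖ ^ 2 - 1 / 4)).add
        (((a1.add (a0.div_const 2)).pow 2).add ((b1.add (b0.div_const 2)).pow 2)))
    refine H.congr_deriv ?_
    generalize hW : (dwProp d s ξ).mulVec v = w
    simp only [Function.comp_apply, Pi.add_apply, Pi.pow_apply, Complex.reCLM_apply,
      Complex.imCLM_apply, hW]
    have e0 : (dwSymbol d ξ).mulVec w 0 = w 1 := by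
      simp [dwSymbol, Matrix.mulVec, dotProduct, Fin.sum_univ_two]
    have e1 : (dwSymbol d ξ).mulVec w 1 = -((‖ξ‖ ^ 2 : ℝ) : ℂ) * w 0 - w 1 := by
      simp [dwSymbol, Matrix.mulVec, dotProduct, Fin.sum_univ_two]
      ring
    have e2 : ((dwSymbol d ξ).mulVec w 1).re = -‖ξ‖ ^ 2 * (w 0).re - (w 1).re := by
      rw [e1, ← Complex.ofReal_neg, Complex.sub_re, Complex.re_ofReal_mul]
    have e3 : ((dwSymbol d ξ).mulVec w 1).im = -‖ξ‖ ^ 2 * (w 0).im - (w 1).im := by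
      rw [e1, ← Complex.ofReal_neg, Complex.sub_im, Complex.im_ofReal_mul]
    rw [e2, e3, e0]
    push_cast
    ring
  have hc := is_const_of_deriv_eq_zero (fun s => (key s).differentiableAt)
    (fun s => (key s).deriv) t 0
  have h0 : dwProp d 0 ξ = 1 := by simp [dwProp]
  simpa [h0] using hc

theorem xiNorm_arg (r : ℝ) (w : Fin 2 → ℂ) :
    (r ^ 2 + 1) * ‖w 0‖ ^ 2 + ‖w 1‖ ^ 2 =
      (r ^ 2 + 1) * ((w 0).re ^ 2 + (w 0).im ^ 2) + ((w 1).re ^ 2 + (w 1).im ^ 2) := by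
  rw [Complex.sq_norm, Complex.sq_norm, Complex.normSq_apply, Complex.normSq_apply]
  ring

theorem energy_upper (r : ℝ) (w : Fin 2 → ℂ) :
    dwEnergy r w ≤ 2 * ((r ^ 2 + 1) * ‖w 0‖ ^ 2 + ‖w 1‖ ^ 2) := by
  rw [xiNorm_arg, dwEnergy]
  nlinarith [sq_nonneg ((w 1).re - (w 0).re / 2), sq_nonneg ((w 1).im - (w 0).im / 2),
    sq_nonneg (w 0).re, sq_nonneg (w 0).im, sq_nonneg (r * (w 0).re), sq_nonneg (r * (w 0).im)]

theorem energy_lower (r : ℝ) (hr : 1 < r) (w : Fin 2 → ℂ) :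
    (r ^ 2 + 1) * ‖w 0‖ ^ 2 + ‖w 1‖ ^ 2 ≤ 4 * dwEnergy r w := by
  rw [xiNorm_arg, dwEnergy]
  have h : 0 ≤ r ^ 2 - 1 := by nlinarith
  nlinarith [sq_nonneg ((w 1).re + (w 0).re), sq_nonneg ((w 1).im + (w 0).im),
    sq_nonneg ((w 1).re + (w 0).re / 2), sq_nonneg ((w 1).im + (w 0).im / 2),
    sq_nonneg (w 0).re, sq_nonneg (w 0).im, mul_nonneg h (sq_nonneg (w 0).re),
    mul_nonneg h (sq_nonneg (w 0).im)]

/-- **High-frequency estimate from the proof of Lemma 6.2:** for `‖ξ‖ > 1` the damped wave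
propagator decays like `e^{−t/2}` in the energy norm `|·|_ξ`, uniformly in `ξ`. -/
theorem dwProp_high_frequency_decay (d : ℕ) (hd : 1 ≤ d) :
    ∃ C : ℝ, 0 < C ∧ ∀ ξ : EuclideanSpace ℝ (Fin d), 1 < ‖ξ‖ →
      ∀ t : ℝ, 0 ≤ t → ∀ v : Fin 2 → ℂ,
        xiNorm d ξ ((dwProp d t ξ).mulVec v) ≤ C * Real.exp (-t / 2) * xiNorm d ξ v := by
  refine ⟨3, by norm_num, fun ξ hξ t ht v => ?_⟩
  have hE := dwEnergy_eq d ξ v t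
  have h1 := energy_upper ‖ξ‖ v
  have h2 := energy_lower ‖ξ‖ hξ ((dwProp d t ξ).mulVec v)
  unfold xiNorm
  apply Real.sqrt_le_iff.2
  refine ⟨by positivity, ?_⟩
  rw [mul_pow, Real.sq_sqrt (by positivity), mul_pow]
  have he : Real.exp (-t / 2) ^ 2 = Real.exp (-t) := by
    rw [← Real.exp_nat_mul]
    congr 1
    push_cast
    ring
  have hE' : dwEnergy ‖ξ‖ ((dwProp d t ξ).mulVec v) = Real.exp (-t) * dwEnergy ‖ξ‖ v := by
    rw [← hE, ← mul_assoc, ← Real.exp_add]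
    simp
  rw [he]
  rw [hE'] at h2
  have h3 := mul_le_mul_of_nonneg_left h1 (Real.exp_pos (-t)).le
  have h4 : 0 ≤ Real.exp (-t) * ((‖ξ‖ ^ 2 + 1) * ‖v 0‖ ^ 2 + ‖v 1‖ ^ 2) := by positivity
  linarith
end

section
/- Fix d ≥ 1. There exist δ ∈ (0, 1/8] and C > 0 such that for every ξ ∈ ℝ^d with ‖ξ‖ < δ, every t ≥ 1 and every v = (v₀, v₁) ∈ ℂ²: |(exp(tM(ξ)) v)₀ − e^{−t‖ξ‖²}(v₀ + v₁)| ≤ C t^{−1} |v|_ξ and ‖ξ‖ · |(exp(tM(ξ)) v)₀ − e^{−t‖ξ‖²}(v₀ + v₁)| ≤ C t^{−3/2} |v|_ξ, where |w|²_ξ := (‖ξ‖²+1)|w₀|² + |w₁|². -/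
/-- The first row of `exp(tM)` satisfies the two eigenvector relations. -/
lemma dw_row (d : ℕ) (t : ℝ) (ξ : EuclideanSpace ℝ (Fin d)) (a b : ℝ)
    (hab : a + b = 1) (hm : a * b = ‖ξ‖ ^ 2) (hne : a < b) :
    dwProp d t ξ 0 0 - a * dwProp d t ξ 0 1 = (Real.exp (-(a * t)) : ℂ) ∧
    dwProp d t ξ 0 0 - b * dwProp d t ξ 0 1 = (Real.exp (-(b * t)) : ℂ) := by
  set U : Matrix (Fin 2) (Fin 2) ℂ := !![1, 1; -(a : ℂ), -(b : ℂ)] with hU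
  set D : Fin 2 → ℂ := ![-((a * t : ℝ) : ℂ), -((b * t : ℝ) : ℂ)] with hD
  have hdet : IsUnit U.det := by
    rw [hU, Matrix.det_fin_two_of, isUnit_iff_ne_zero]
    have h : ((a - b : ℝ) : ℂ) ≠ 0 := by
      rw [Complex.ofReal_ne_zero]; linarith
    intro h0
    apply h
    push_cast
    linear_combination h0
  have hUu : IsUnit U := (Matrix.isUnit_iff_isUnit_det U).2 hdet
  have hab' : (a : ℂ) + b = 1 := by exact_mod_cast hab
  have hm' : (a : ℂ) * b = (‖ξ‖ : ℂ) ^ 2 := by exact_mod_cast hm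
  have hMU : ((t : ℂ) • dwSymbol d ξ) * U = U * Matrix.diagonal D := by
    ext i j
    fin_cases i <;> fin_cases j <;>
      simp [dwSymbol, hU, hD, Matrix.mul_apply, Fin.sum_univ_two, ← hm']
    · ring
    · ring
    · linear_combination (a * t : ℂ) * (-hab')
    · linear_combination (b * t : ℂ) * (-hab')
  have hconj : (t : ℂ) • dwSymbol d ξ = U * Matrix.diagonal D * U⁻¹ := by
    rw [← hMU, Matrix.mul_assoc, Matrix.mul_nonsing_inv U hdet, Matrix.mul_one]
  have hexp : dwProp d t ξ * U = U * Matrix.diagonal (NormedSpace.exp D) := by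
    rw [dwProp, hconj, Matrix.exp_conj U _ hUu, Matrix.mul_assoc _ U⁻¹ U,
      Matrix.nonsing_inv_mul U hdet, Matrix.mul_one, Matrix.exp_diagonal]
  have h0 := congrFun (congrFun hexp 0) 0
  have h1 := congrFun (congrFun hexp 0) 1
  simp [hU, hD, Matrix.mul_apply, Fin.sum_univ_two, Pi.coe_exp, ← Complex.exp_eq_exp_ℂ] at h0 h1
  push_cast
  constructor
  · linear_combination h0
  · linear_combination h1

lemma dw_exp3 (x : ℝ) (hx : 0 ≤ x) :
    Real.exp (-x) * (1 + x + x ^ 2 / 2 + x ^ 3 / 6) ≤ 1 := by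
  have h := Real.sum_le_exp_of_nonneg hx 4
  simp [Finset.sum_range_succ, Nat.factorial] at h
  rw [Real.exp_neg, inv_mul_le_iff₀ (Real.exp_pos x)]
  linarith

/-- Decay of the error majorant. -/
lemma dw_major (r t : ℝ) (hr : 0 ≤ r) (hr1 : r < 1 / 8) (ht : 1 ≤ t) :
    t * (4 * r ^ 4 * t * Real.exp (-(t * r ^ 2)) + 8 * r ^ 2 * Real.exp (-(t * r ^ 2))
      + 2 * Real.exp (-(t / 2))) * (1 + t * r ^ 2) ≤ 40 := by
  have hx : 0 ≤ t * r ^ 2 := by positivity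
  have h1 := dw_exp3 (t * r ^ 2) hx
  have h2 := dw_exp3 (t / 2) (by linarith)
  have hxt : t * r ^ 2 ≤ t := by
    have : r ^ 2 ≤ 1 := by nlinarith
    nlinarith
  set x := t * r ^ 2 with hxd
  have hE := Real.exp_pos (-x)
  have hF := Real.exp_pos (-(t / 2))
  have e : t * (4 * r ^ 4 * t * Real.exp (-x) + 8 * r ^ 2 * Real.exp (-x)
      + 2 * Real.exp (-(t / 2))) * (1 + x)
      = Real.exp (-x) * (8 * x + 12 * x ^ 2 + 4 * x ^ 3)
        + Real.exp (-(t / 2)) * (2 * t * (1 + x)) := by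
    rw [hxd]; ring
  rw [e]
  have i1 : Real.exp (-x) * (8 * x + 12 * x ^ 2 + 4 * x ^ 3)
      ≤ Real.exp (-x) * (24 * (1 + x + x ^ 2 / 2 + x ^ 3 / 6)) := by
    apply mul_le_mul_of_nonneg_left _ hE.le
    nlinarith
  have i2 : Real.exp (-(t / 2)) * (2 * t * (1 + x))
      ≤ Real.exp (-(t / 2)) * (16 * (1 + t / 2 + (t / 2) ^ 2 / 2 + (t / 2) ^ 3 / 6)) := by
    apply mul_le_mul_of_nonneg_left _ hF.le
    have : 0 ≤ t ^ 3 := by positivity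
    nlinarith
  linarith

/-- Bounds of the two scalar coefficients. -/
lemma dw_coef (r t a b p q : ℝ) (hr : 0 ≤ r) (hr1 : r < 1 / 8) (ht : 1 ≤ t)
    (hab : a + b = 1) (hm : a * b = r ^ 2) (hb : 3 / 4 ≤ b) (ha : 0 ≤ a)
    (hp : p - a * q = Real.exp (-(a * t))) (hq : p - b * q = Real.exp (-(b * t))) :
    |p - Real.exp (-(t * r ^ 2))| ≤ 4 * r ^ 4 * t * Real.exp (-(t * r ^ 2))
      + 8 * r ^ 2 * Real.exp (-(t * r ^ 2)) + 2 * Real.exp (-(t / 2)) ∧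
    |q - Real.exp (-(t * r ^ 2))| ≤ 4 * r ^ 4 * t * Real.exp (-(t * r ^ 2))
      + 8 * r ^ 2 * Real.exp (-(t * r ^ 2)) + 2 * Real.exp (-(t / 2)) := by
  have ha2 : a ≤ 2 * r ^ 2 := by nlinarith
  have har : a = r ^ 2 + a ^ 2 := by
    have : b = 1 - a := by linarith
    rw [← hm, this]; ring
  set H := Real.exp (-(t * r ^ 2)) with hH
  set F := Real.exp (-(t / 2)) with hF
  set A := Real.exp (-(a * t)) with hA
  set B := Real.exp (-(b * t)) with hB
  have H0 : 0 < H := Real.exp_pos _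
  have F0 : 0 < F := Real.exp_pos _
  have A0 : 0 < A := Real.exp_pos _
  have B0 : 0 < B := Real.exp_pos _
  have hBF : B ≤ F := Real.exp_le_exp.2 (by nlinarith)
  have hAH : A ≤ H := Real.exp_le_exp.2 (by nlinarith [mul_nonneg (sq_nonneg a) (by linarith : 0 ≤ t)])
  have hBA : B ≤ A := Real.exp_le_exp.2 (by nlinarith)
  have hAe : A = H * Real.exp (-(a ^ 2 * t)) := by
    rw [hA, hH, ← Real.exp_add]
    congr 1
    linear_combination (-t) * har
  have hlow : H * (1 - 4 * r ^ 4 * t) ≤ A := by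
    rw [hAe]
    apply mul_le_mul_of_nonneg_left _ H0.le
    have h1 := Real.add_one_le_exp (-(a ^ 2 * t))
    have h2 : a ^ 2 ≤ 4 * r ^ 4 := by nlinarith
    nlinarith
  have hsq : (b - a) * q = A - B := by linarith
  have hq0 : 0 ≤ q := by
    by_contra h
    push Not at h
    nlinarith
  have hq2 : q ≤ 2 * (A - B) := by nlinarith
  have hqe : q = A - B + 2 * (a * q) := by
    have : b = 1 - a := by linarith
    rw [this] at hsq
    linarith
  have hpe : p = A + a * q := by linarith
  have haq0 : 0 ≤ a * q := mul_nonneg ha hq0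
  have haq : a * q ≤ 4 * r ^ 2 * H := by
    calc a * q ≤ (2 * r ^ 2) * (2 * H) := by
          apply mul_le_mul ha2 (by linarith) hq0 (by positivity)
      _ = _ := by ring
  have k : 0 ≤ r ^ 2 * H := by positivity
  have k2 : 0 ≤ r ^ 4 * t * H := by positivity
  constructor <;> rw [abs_le] <;> constructor <;> nlinarith

/-- **Low-frequency estimate from the proof of Lemma 6.2:** at frequencies `‖ξ‖ < δ` the
first component of the damped wave propagator is, up to errors `O(t⁻¹)` resp. `O(t^{−3/2})`
(the latter with the weight `‖ξ‖`), the heat propagator `e^{−t‖ξ‖²}` applied to `v₀ + v₁`. -/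
theorem dwProp_low_frequency_heat_comparison (d : ℕ) (hd : 1 ≤ d) :
    ∃ δ C : ℝ, δ ∈ Set.Ioc (0 : ℝ) (1 / 8) ∧ 0 < C ∧
      ∀ ξ : EuclideanSpace ℝ (Fin d), ‖ξ‖ < δ →
      ∀ t : ℝ, 1 ≤ t → ∀ v : Fin 2 → ℂ,
        ‖(dwProp d t ξ).mulVec v 0 - (Real.exp (-(t * ‖ξ‖ ^ 2)) : ℂ) * (v 0 + v 1)‖
            ≤ C * t⁻¹ * xiNorm d ξ v ∧
        ‖ξ‖ * ‖(dwProp d t ξ).mulVec v 0 - (Real.exp (-(t * ‖ξ‖ ^ 2)) : ℂ) * (v 0 + v 1)‖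
            ≤ C * t ^ (-(3 : ℝ) / 2) * xiNorm d ξ v := by
  refine ⟨1 / 8, 160, ⟨by norm_num, le_refl _⟩, by norm_num, ?_⟩
  intro ξ hξ t ht v
  have hr0 : 0 ≤ ‖ξ‖ := norm_nonneg ξ
  have hs0 : 0 ≤ 1 - 4 * ‖ξ‖ ^ 2 := by nlinarith
  have hss := Real.mul_self_sqrt hs0
  have hsn := Real.sqrt_nonneg (1 - 4 * ‖ξ‖ ^ 2)
  set s := Real.sqrt (1 - 4 * ‖ξ‖ ^ 2) with hs
  have hs1 : s ≤ 1 := by nlinarith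
  have hs2 : 1 / 2 ≤ s := by nlinarith
  obtain ⟨h1, h2⟩ := dw_row d t ξ ((1 - s) / 2) ((1 + s) / 2) (by ring)
    (by linear_combination (-1 / 4) * hss) (by linarith)
  set a := (1 - s) / 2 with ha
  set b := (1 + s) / 2 with hb
  have hba : 0 < b - a := by rw [ha, hb]; linarith
  obtain ⟨q, hq⟩ : ∃ q : ℝ, (b - a) * q = Real.exp (-(a * t)) - Real.exp (-(b * t)) :=
    ⟨(Real.exp (-(a * t)) - Real.exp (-(b * t))) / (b - a), by field_simp⟩
  obtain ⟨p, hp⟩ : ∃ p : ℝ, p = Real.exp (-(a * t)) + a * q := ⟨_, rfl⟩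
  have hq' : ((b : ℂ) - a) * q = (Real.exp (-(a * t)) : ℂ) - (Real.exp (-(b * t)) : ℂ) := by
    exact_mod_cast hq
  have hp' : (p : ℂ) = (Real.exp (-(a * t)) : ℂ) + a * q := by exact_mod_cast hp
  have hba' : (b : ℂ) - a ≠ 0 := by exact_mod_cast hba.ne'
  have e1 : dwProp d t ξ 0 1 = q := by
    apply mul_left_cancel₀ hba'
    rw [hq']
    linear_combination h1 - h2
  have e0 : dwProp d t ξ 0 0 = p := by
    rw [e1] at h1
    rw [hp']
    linear_combination h1
  obtain ⟨c0, c1⟩ := dw_coef ‖ξ‖ t a b p q hr0 hξ ht (by rw [ha, hb]; ring)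
    (by rw [ha, hb]; linear_combination (-1 / 4) * hss) (by rw [hb]; linarith)
    (by rw [ha]; linarith) (by linarith) (by linarith)
  have hmaj := dw_major ‖ξ‖ t hr0 hξ ht
  set H := Real.exp (-(t * ‖ξ‖ ^ 2)) with hH
  set K := 4 * ‖ξ‖ ^ 4 * t * H + 8 * ‖ξ‖ ^ 2 * H + 2 * Real.exp (-(t / 2)) with hK
  have hK0 : 0 ≤ K := le_trans (abs_nonneg _) c0
  have hN0 : 0 ≤ xiNorm d ξ v := Real.sqrt_nonneg _
  have hv0 : ‖v 0‖ ≤ xiNorm d ξ v := by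
    apply Real.le_sqrt_of_sq_le
    nlinarith [mul_nonneg (sq_nonneg ‖ξ‖) (sq_nonneg ‖v 0‖), sq_nonneg ‖v 1‖]
  have hv1 : ‖v 1‖ ≤ xiNorm d ξ v := by
    apply Real.le_sqrt_of_sq_le
    nlinarith [mul_nonneg (sq_nonneg ‖ξ‖) (sq_nonneg ‖v 0‖), sq_nonneg ‖v 0‖]
  set N := xiNorm d ξ v with hN
  have hX : ‖(dwProp d t ξ).mulVec v 0 - (H : ℂ) * (v 0 + v 1)‖ ≤ 2 * K * N := by
    have : (dwProp d t ξ).mulVec v 0 - (H : ℂ) * (v 0 + v 1)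
        = ((p - H : ℝ) : ℂ) * v 0 + ((q - H : ℝ) : ℂ) * v 1 := by
      simp only [Matrix.mulVec, dotProduct, Fin.sum_univ_two, e0, e1]
      push_cast
      ring
    rw [this]
    refine (norm_add_le _ _).trans ?_
    rw [norm_mul, norm_mul, Complex.norm_real, Complex.norm_real, Real.norm_eq_abs,
      Real.norm_eq_abs]
    have i0 := mul_le_mul c0 hv0 (norm_nonneg _) hK0
    have i1 := mul_le_mul c1 hv1 (norm_nonneg _) hK0
    linarith
  have t0 : 0 < t := by linarith
  have hx0 : 0 ≤ t * ‖ξ‖ ^ 2 := by positivity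
  have htK : 0 ≤ t * K := by positivity
  have hK1 : t * K ≤ 40 := by nlinarith
  have hst : 0 < Real.sqrt t := Real.sqrt_pos.2 t0
  have hsts : Real.sqrt t * Real.sqrt t = t := Real.mul_self_sqrt t0.le
  have hrs : ‖ξ‖ * Real.sqrt t ≤ 1 + t * ‖ξ‖ ^ 2 := by
    have : t * ‖ξ‖ ^ 2 = (‖ξ‖ * Real.sqrt t) ^ 2 := by
      rw [mul_pow, Real.sq_sqrt t0.le]; ring
    rw [this]
    nlinarith [sq_nonneg (‖ξ‖ * Real.sqrt t - 1)]
  have hpow : t ^ (-(3 : ℝ) / 2) = (t * Real.sqrt t)⁻¹ := by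
    rw [Real.sqrt_eq_rpow, ← Real.rpow_one_add' t0.le (by norm_num), ← Real.rpow_neg t0.le]
    norm_num
  have hK2 : ‖ξ‖ * K * (t * Real.sqrt t) ≤ 40 := by
    calc ‖ξ‖ * K * (t * Real.sqrt t) = t * K * (‖ξ‖ * Real.sqrt t) := by ring
      _ ≤ t * K * (1 + t * ‖ξ‖ ^ 2) := mul_le_mul_of_nonneg_left hrs htK
      _ ≤ 40 := hmaj
  have hK1' : K ≤ 40 * t⁻¹ := by
    rw [← div_eq_mul_inv, le_div_iff₀ t0]; linarith
  have hK2' : ‖ξ‖ * K ≤ 40 * (t * Real.sqrt t)⁻¹ := by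
    rw [← div_eq_mul_inv, le_div_iff₀ (by positivity)]; exact hK2
  constructor
  · refine hX.trans (mul_le_mul_of_nonneg_right ?_ hN0)
    have : 0 < t⁻¹ := inv_pos.2 t0
    linarith
  · rw [hpow]
    calc _ ≤ ‖ξ‖ * (2 * K * N) := mul_le_mul_of_nonneg_left hX hr0
      _ = 2 * (‖ξ‖ * K) * N := by ring
      _ ≤ _ := by
        refine mul_le_mul_of_nonneg_right ?_ hN0
        have : 0 < (t * Real.sqrt t)⁻¹ := by positivity
        linarith
end
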